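/- Let f be a loxodromic automorphism of ℂ² which is unstably real, meaning that for some transversal γ : 𝔻 → ℂ² to J⁺ the Julia slice E_γ = 𝔻 ∩ ∂(γ⁻¹(K⁺)) is contained in the image of an injective continuously differentiable map η : I → ℂ (I ⊆ ℝ an open interval) with nowhere-vanishing derivative. Assume moreover that f is dissipative, i.e., |det Df_z| < 1 for all z (the Jacobian determinant of a polynomial automorphism of ℂ² is constant). Then every periodic point of f is a saddle: for every p ∈ ℂ² and n ≥ 1 with fⁿ(p) = p, the two eigenvalues λ₁, λ₂ of D(fⁿ)_p satisfy, up to ordering, |λ₁| < 1 < |λ₂|. -/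

import Mathlib

open Function Set Filter Topology

noncomputable section

/-- A polynomial map of `ℂ²`. -/
def IsPolyMap (F : ℂ × ℂ → ℂ × ℂ) : Prop :=
  ∃ P Q : MvPolynomial (Fin 2) ℂ, ∀ z : ℂ × ℂ,
    F z = (MvPolynomial.eval ![z.1, z.2] P, MvPolynomial.eval ![z.1, z.2] Q)

/-- A polynomial automorphism of `ℂ²`. -/
def IsPolyAuto (F : ℂ × ℂ → ℂ × ℂ) : Prop :=
  IsPolyMap F ∧ ∃ G : ℂ × ℂ → ℂ × ℂ, IsPolyMap G ∧
    (∀ z, G (F z) = z) ∧ (∀ z, F (G z) = z)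

/-- A generalized Hénon map. -/
def IsHenon (h : ℂ × ℂ → ℂ × ℂ) : Prop :=
  ∃ (p : Polynomial ℂ) (a : ℂ), a ≠ 0 ∧ 2 ≤ p.natDegree ∧
    ∀ z : ℂ × ℂ, h z = (Polynomial.eval z.1 p - a * z.2, z.1)

/-- A loxodromic automorphism of `ℂ²`. -/
def IsLoxodromic (f : ℂ × ℂ → ℂ × ℂ) : Prop :=
  IsPolyAuto f ∧
  ∃ (u uinv : ℂ × ℂ → ℂ × ℂ) (hs : List (ℂ × ℂ → ℂ × ℂ)),
    IsPolyAuto u ∧ (∀ z, uinv (u z) = z) ∧ (∀ z, u (uinv z) = z) ∧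
    hs ≠ [] ∧ (∀ h ∈ hs, IsHenon h) ∧
    ∀ z, f z = uinv (hs.foldr (fun h acc => h ∘ acc) id (u z))

/-- The set of points with bounded forward orbit. -/
def Kplus (f : ℂ × ℂ → ℂ × ℂ) : Set (ℂ × ℂ) :=
  {z | ∃ C : ℝ, ∀ n : ℕ, ‖f^[n] z‖ ≤ C}

/-- `lam` is an eigenvalue of the continuous linear map `T`. -/
def IsEigenvalue (T : (ℂ × ℂ) →L[ℂ] ℂ × ℂ) (lam : ℂ) : Prop :=
  ∃ v : ℂ × ℂ, v ≠ 0 ∧ T v = lam • v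

/-- `p` is a saddle periodic point of period `n` with stable multiplier `ls`
and unstable multiplier `lu`. -/
def IsSaddle (f : ℂ × ℂ → ℂ × ℂ) (p : ℂ × ℂ) (n : ℕ) (ls lu : ℂ) : Prop :=
  1 ≤ n ∧ f^[n] p = p ∧
  IsEigenvalue (fderiv ℂ (f^[n]) p) ls ∧ IsEigenvalue (fderiv ℂ (f^[n]) p) lu ∧
  ‖ls‖ < 1 ∧ 1 < ‖lu‖

/-- Coordinatewise complex conjugation `σ(x,y) = (x̄, ȳ)`. -/
def conjMap (z : ℂ × ℂ) : ℂ × ℂ := (starRingEnd ℂ z.1, starRingEnd ℂ z.2)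

/-- The open unit disk in `ℂ`. -/
def unitDisk : Set ℂ := Metric.ball 0 1

/-- `γ` is a transversal to `J⁺`. -/
def IsTransversal (f : ℂ × ℂ → ℂ × ℂ) (γ : ℂ → ℂ × ℂ) : Prop :=
  Set.InjOn γ unitDisk ∧ DifferentiableOn ℂ γ unitDisk ∧
  (∃ z ∈ unitDisk, γ z ∈ Kplus f) ∧ ¬ (∀ z ∈ unitDisk, γ z ∈ Kplus f)

/-- The Julia slice associated to a transversal. -/
def juliaSlice (f : ℂ × ℂ → ℂ × ℂ) (γ : ℂ → ℂ × ℂ) : Set ℂ :=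
  unitDisk ∩ frontier {z | z ∈ unitDisk ∧ γ z ∈ Kplus f}

/-- An unstable parametrization of a saddle periodic point. -/
def IsUnstableParam (f : ℂ × ℂ → ℂ × ℂ) (n : ℕ) (lu : ℂ) (p : ℂ × ℂ) (ψ : ℂ → ℂ × ℂ) : Prop :=
  Function.Injective ψ ∧ Differentiable ℂ ψ ∧ ψ 0 = p ∧
  ∀ ζ : ℂ, f^[n] (ψ ζ) = ψ (lu * ζ)

/-- `S` is contained in a proper real-analytic subvariety of `ℂ²`. -/
def ContainedInProperRealAnalyticSubvariety (S : Set (ℂ × ℂ)) : Prop :=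
  ∃ V : Set (ℂ × ℂ), IsClosed V ∧ V ≠ Set.univ ∧ S ⊆ V ∧
    ∀ x ∈ V, ∃ (U : Set (ℂ × ℂ)) (g : ℂ × ℂ → ℝ),
      IsOpen U ∧ x ∈ U ∧ (∀ y ∈ U, AnalyticAt ℝ g y) ∧
      (∃ y ∈ U, g y ≠ 0) ∧ ∀ y ∈ V ∩ U, g y = 0


/-- local real part of an analytic function -/
def HA (u : ℂ → ℝ) (z : ℂ) : Prop :=
  ∃ F : ℂ → ℂ, AnalyticAt ℂ F z ∧ ∀ᶠ w in 𝓝 z, u w = (F w).re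

theorem HA.harmonicAt {u : ℂ → ℝ} {z : ℂ} (h : HA u z) : InnerProductSpace.HarmonicAt u z := by
  obtain ⟨F, hF, he⟩ := h
  exact (InnerProductSpace.harmonicAt_congr_nhds he).2 hF.harmonicAt_re

theorem HA.add {u v : ℂ → ℝ} {z : ℂ} (h : HA u z) (h' : HA v z) : HA (fun w => u w + v w) z := by
  obtain ⟨F, hF, he⟩ := h
  obtain ⟨F', hF', he'⟩ := h'
  refine ⟨fun w => F w + F' w, hF.add hF', ?_⟩
  filter_upwards [he, he'] with w h1 h2
  simp [h1, h2]

theorem HA.sub {u v : ℂ → ℝ} {z : ℂ} (h : HA u z) (h' : HA v z) : HA (fun w => u w - v w) z := by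
  obtain ⟨F, hF, he⟩ := h
  obtain ⟨F', hF', he'⟩ := h'
  refine ⟨fun w => F w - F' w, hF.sub hF', ?_⟩
  filter_upwards [he, he'] with w h1 h2
  simp [h1, h2]

theorem HA.const_mul {u : ℂ → ℝ} {z : ℂ} (h : HA u z) (c : ℝ) : HA (fun w => c * u w) z := by
  obtain ⟨F, hF, he⟩ := h
  refine ⟨fun w => c * F w, analyticAt_const.mul hF, ?_⟩
  filter_upwards [he] with w h1
  simp [h1]

theorem HA.congr {u v : ℂ → ℝ} {z : ℂ} (h : HA u z) (e : ∀ᶠ w in 𝓝 z, v w = u w) : HA v z := by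
  obtain ⟨F, hF, he⟩ := h
  refine ⟨F, hF, ?_⟩
  filter_upwards [he, e] with w h1 h2
  rw [h2, h1]

theorem HA_const (c : ℝ) (z : ℂ) : HA (fun _ => c) z :=
  ⟨fun _ => (c : ℂ), analyticAt_const, by simp⟩

theorem HA_re {F : ℂ → ℂ} {z : ℂ} (hF : AnalyticAt ℂ F z) : HA (fun w => (F w).re) z :=
  ⟨F, hF, by simp⟩

theorem HA_im (z : ℂ) : HA (fun w => w.im) z :=
  ⟨fun w => -Complex.I * w, by fun_prop, by simp⟩

theorem HA.comp_analytic {u : ℂ → ℝ} {g : ℂ → ℂ} {z : ℂ} (h : HA u (g z)) (hg : AnalyticAt ℂ g z) :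
    HA (fun w => u (g w)) z := by
  obtain ⟨F, hF, he⟩ := h
  exact ⟨fun w => F (g w), hF.fun_comp hg, hg.continuousAt.eventually he⟩

theorem HA_log_norm {F : ℂ → ℂ} {z : ℂ} (hF : AnalyticAt ℂ F z) (h0 : F z ≠ 0) :
    HA (fun w => Real.log ‖F w‖) z := by
  refine ⟨fun w => Complex.log (F w / F z) + (Real.log ‖F z‖ : ℝ), ?_, ?_⟩
  · refine AnalyticAt.add (AnalyticAt.clog (hF.div analyticAt_const h0) ?_) analyticAt_const
    rw [div_self h0]; exact Complex.one_mem_slitPlane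
  · filter_upwards [hF.continuousAt.eventually_ne h0] with w hw
    rw [Complex.add_re, Complex.log_re, norm_div, Real.log_div (by simpa) (by simpa)]
    simp

/-- maximum principle -/
theorem maxP {K : Set ℂ} (hK : IsCompact K) {v : ℂ → ℝ} (hv : ContinuousOn v K) {m : ℝ}
    (h : ∀ z ∈ K, v z ≤ m ∨ (K ∈ 𝓝 z ∧ HA v z)) : ∀ z ∈ K, v z ≤ m := by
  by_contra! hcon
  obtain ⟨z0, hz0, hm⟩ := hcon
  obtain ⟨z1, hz1, hmax⟩ := hK.exists_isMaxOn ⟨z0, hz0⟩ hv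
  have hM : m < v z1 := lt_of_lt_of_le hm (hmax hz0)
  set S := K ∩ v ⁻¹' {v z1} with hS
  have hSc : IsCompact S := by
    refine hK.of_isClosed_subset (hv.preimage_isClosed_of_isClosed hK.isClosed isClosed_singleton) ?_
    exact inter_subset_left
  have hSo : IsOpen S := by
    rw [isOpen_iff_mem_nhds]
    rintro z ⟨hzK, hzv⟩
    have hzv : v z = v z1 := hzv
    rcases h z hzK with h1 | ⟨hn, F, hF, he⟩
    · linarith
    have hd : ∀ᶠ w in 𝓝 z, DifferentiableAt ℂ (fun w => Complex.exp (F w)) w := by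
      filter_upwards [hF.eventually_analyticAt] with w hw
      exact hw.differentiableAt.cexp
    have hl : IsLocalMax (norm ∘ fun w => Complex.exp (F w)) z := by
      have hez := he.self_of_nhds
      filter_upwards [he, hn] with w hw hwK
      simp only [comp, Complex.norm_exp, Real.exp_le_exp]
      rw [← hw, ← hez, hzv]; exact hmax hwK
    have := Complex.norm_eventually_eq_of_isLocalMax hd hl
    have hez := he.self_of_nhds
    filter_upwards [this, he, hn] with w h1 h2 h3
    refine ⟨h3, ?_⟩
    simp only [Complex.norm_exp, Real.exp_eq_exp] at h1
    simp only [mem_preimage, mem_singleton_iff]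
    rw [h2, h1, ← hez, hzv]
  have hSu : S = univ := IsClopen.eq_univ ⟨hSc.isClosed, hSo⟩ ⟨z1, hz1, rfl⟩
  rw [hSu] at hSc
  exact noncompact_univ ℂ hSc

/-- Harnack, exact form -/
theorem harnack {u : ℂ → ℝ} {z : ℂ} {R : ℝ} (hu : ∀ w ∈ Metric.ball z R, HA u w)
    (h0 : ∀ w ∈ Metric.ball z R, 0 ≤ u w) {w : ℂ} (hw : w ∈ Metric.ball z R) :
    (R - dist w z) * u w ≤ (R + dist w z) * u z ∧ (R - dist w z) * u z ≤ (R + dist w z) * u w := by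
  have hR : 0 < R := lt_of_le_of_lt dist_nonneg hw
  obtain ⟨F, hF, hFe⟩ := InnerProductSpace.HarmonicOnNhd.exists_analyticOnNhd_ball_re_eq
    (f := u) (z := z) (R := R) (fun w hw => (hu w hw).harmonicAt)
  set s := dist w z
  have hs : s < R := hw
  have hs0 : 0 ≤ s := dist_nonneg
  -- for every e>0
  have key : ∀ e > 0, |u w - u z| * R ≤ s * (u w + u z + 2 * e) := by
    intro e he
    set a := u z + e with ha
    have hz : z ∈ Metric.ball z R := Metric.mem_ball_self hR
    have ha0 : 0 < a := by have := h0 z hz; linarith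
    have hFz : (F z).re = u z := hFe hz
    set f : ℂ → ℂ := fun x => F x - (F z).im * Complex.I + e with hf
    have hfz : f z = a := by
      apply Complex.ext <;> simp [hf, ha, hFz]
    have hfre : ∀ x ∈ Metric.ball z R, (f x).re = u x + e := by
      intro x hx
      have : (F x).re = u x := hFe hx
      simp [hf, this]
    set g : ℂ → ℂ := fun x => (f x - a) / (f x + a) with hg
    have hne : ∀ x ∈ Metric.ball z R, f x + a ≠ 0 := by
      intro x hx h
      have := congrArg Complex.re h
      simp [hfre x hx] at this
      have := h0 x hx
      linarith
    have hgd : DifferentiableOn ℂ g (Metric.ball z R) := by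
      have hFd : DifferentiableOn ℂ F (Metric.ball z R) := hF.differentiableOn
      have hfd : DifferentiableOn ℂ f (Metric.ball z R) := (hFd.sub_const _).add_const _
      exact (hfd.sub_const _).div (hfd.add_const _) hne
    have hgz : g z = 0 := by simp [hg, hfz]
    have hmaps : MapsTo g (Metric.ball z R) (Metric.ball (g z) 1) := by
      intro x hx
      rw [hgz, mem_ball_zero_iff, hg]
      simp only [norm_div]
      have h1 := norm_pos_iff.2 (hne x hx)
      rw [div_lt_one h1]
      have : ‖f x - a‖ ^ 2 < ‖f x + a‖ ^ 2 := by
        rw [← Complex.normSq_eq_norm_sq, ← Complex.normSq_eq_norm_sq, Complex.normSq_apply,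
          Complex.normSq_apply]
        have h2 := hfre x hx
        have h3 := h0 x hx
        simp [h2]
        nlinarith
      exact lt_of_pow_lt_pow_left₀ 2 h1.le this
    have hsch := Complex.dist_le_div_mul_dist_of_mapsTo_ball hgd (hmaps.mono_right Metric.ball_subset_closedBall) hw
    rw [hgz, dist_zero_right, hg] at hsch
    simp only [norm_div] at hsch
    have h1 := norm_pos_iff.2 (hne w hw)
    rw [div_le_iff₀ h1] at hsch
    have h4 : ‖f w - a‖ * R ≤ s * ‖f w + a‖ := by
      have : ‖f w - a‖ * R ≤ (1 / R * s * ‖f w + a‖) * R := by gcongr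
      calc _ ≤ _ := this
        _ = _ := by field_simp
    have h5 : (‖f w - a‖ * R)^2 ≤ (s * ‖f w + a‖)^2 := by gcongr
    rw [mul_pow, mul_pow, ← Complex.normSq_eq_norm_sq, ← Complex.normSq_eq_norm_sq,
      Complex.normSq_apply, Complex.normSq_apply] at h5
    have h6 := hfre w hw
    simp [h6] at h5
    have h7 := h0 w hw
    have h8 := h0 z hz
    have h9 : (|u w - u z| * R)^2 ≤ (s * (u w + u z + 2 * e))^2 := by
      rw [mul_pow, sq_abs]
      have : s^2 * ((f w).im * (f w).im) ≤ R^2 * ((f w).im * (f w).im) := by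
        apply mul_le_mul_of_nonneg_right _ (mul_self_nonneg _)
        gcongr
      have e1 : u w + e - a = u w - u z := by rw [ha]; ring
      have e2 : u w + e + a = u w + u z + 2 * e := by rw [ha]; ring
      rw [e1, e2] at h5
      nlinarith
    exact le_of_sq_le_sq h9 (by positivity)
  have key' : |u w - u z| * R ≤ s * (u w + u z) := by
    apply le_of_forall_pos_le_add
    intro e he
    have h1 := key (e / (2 * R)) (by positivity)
    have h2 : s * (u w + u z + 2 * (e / (2 * R))) = s * (u w + u z) + (s / R) * e := by
      field_simp
    rw [h2] at h1
    have h3 : s / R * e ≤ 1 * e := by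
      gcongr
      rw [div_le_one hR]; exact hs.le
    linarith
  have h1 := le_abs_self (u w - u z)
  have h2 := neg_abs_le (u w - u z)
  constructor <;> nlinarith

theorem harnack12 {u : ℂ → ℝ} {z : ℂ} {R : ℝ} (hu : ∀ w ∈ Metric.ball z R, HA u w)
    (h0 : ∀ w ∈ Metric.ball z R, 0 ≤ u w) (hR : 0 < R) {w : ℂ} (hw : dist w z ≤ R / 11) :
    u w ≤ 1.2 * u z ∧ u z ≤ 1.2 * u w := by
  have hwb : w ∈ Metric.ball z R := by
    rw [Metric.mem_ball]; linarith
  obtain ⟨h1, h2⟩ := harnack hu h0 hwb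
  have h3 := h0 w hwb
  have h4 := h0 z (Metric.mem_ball_self hR)
  have h5 : 10 / 11 * R ≤ R - dist w z := by linarith
  have h6 : R + dist w z ≤ 12 / 11 * R := by linarith
  have a1 := mul_le_mul_of_nonneg_right h5 h3
  have a2 := mul_le_mul_of_nonneg_right h6 h4
  have a3 := mul_le_mul_of_nonneg_right h5 h4
  have a4 := mul_le_mul_of_nonneg_right h6 h3
  constructor
  · have : R * u w ≤ R * (1.2 * u z) := by nlinarith
    exact le_of_mul_le_mul_left this hR
  · have : R * u z ≤ R * (1.2 * u w) := by nlinarith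
    exact le_of_mul_le_mul_left this hR


/-- admissible potentials relative to a graph -/
structure Adm (u : ℂ → ℝ) (φ : ℝ → ℝ) (U : Set ℂ) : Prop where
  nonneg : ∀ z ∈ U, 0 ≤ u z
  cont : ContinuousOn u U
  harm : ∀ z ∈ U, HA u z ∨ (u z = 0 ∧ z.im = φ z.re)

theorem Adm.mono {u : ℂ → ℝ} {φ : ℝ → ℝ} {U V : Set ℂ} (h : Adm u φ U) (hV : V ⊆ U) : Adm u φ V :=
  ⟨fun z hz => h.nonneg z (hV hz), h.cont.mono hV, fun z hz => h.harm z (hV hz)⟩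

/-- balls around points at height `s` avoid the graph -/
theorem Adm.ball {u : ℂ → ℝ} {φ : ℝ → ℝ} {U : Set ℂ} (h : Adm u φ U)
    (hφ : ∀ x y, |φ x - φ y| ≤ 0.1 * |x - y|) {z : ℂ} {s : ℝ} (hs : s ≤ |z.im - φ z.re|)
    (hU : Metric.ball z (s / 1.1) ⊆ U) : ∀ w ∈ Metric.ball z (s / 1.1), HA u w := by
  intro w hw
  rcases h.harm w (hU hw) with h1 | ⟨_, h2⟩
  · exact h1
  exfalso
  rw [Metric.mem_ball, Complex.dist_eq] at hw
  have h3 := Complex.abs_re_le_norm (w - z)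
  have h4 := Complex.abs_im_le_norm (w - z)
  simp only [Complex.sub_re, Complex.sub_im] at h3 h4
  have h5 := hφ w.re z.re
  rw [h2] at h4
  have h6 : |z.im - φ z.re| ≤ |φ w.re - z.im| + |φ w.re - φ z.re| := by
    have := abs_sub_le z.im (φ w.re) (φ z.re)
    rw [abs_sub_comm z.im (φ w.re)] at this
    exact this
  have : ‖w - z‖ * 1.1 < s := by
    rwa [lt_div_iff₀ (by norm_num)] at hw
  norm_num at *
  linarith

theorem Adm.step {u : ℂ → ℝ} {φ : ℝ → ℝ} {U : Set ℂ} (h : Adm u φ U)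
    (hφ : ∀ x y, |φ x - φ y| ≤ 0.1 * |x - y|) {z w : ℂ} {s : ℝ} (hs0 : 0 < s)
    (hs : s ≤ |z.im - φ z.re|)
    (hU : Metric.ball z (s / 1.1) ⊆ U) (hw : ‖w - z‖ ≤ 0.08 * s) :
    u w ≤ 1.2 * u z ∧ u z ≤ 1.2 * u w := by
  refine harnack12 (h.ball hφ hs hU) (fun w hw => h.nonneg w (hU hw)) (by positivity) ?_
  rw [Complex.dist_eq]
  refine hw.trans ?_
  rw [div_div, le_div_iff₀ (by norm_num)]
  nlinarith

/-- the point at signed height `s` above `x` -/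
def gpt (φ : ℝ → ℝ) (x s : ℝ) : ℂ := ⟨x, φ x + s⟩

theorem gpt_norm (φ : ℝ → ℝ) (hφ : ∀ x y, |φ x - φ y| ≤ 0.1 * |x - y|) (h0 : φ 0 = 0) (x s : ℝ) :
    ‖gpt φ x s‖ ≤ 1.1 * |x| + |s| := by
  have h1 := Complex.norm_le_abs_re_add_abs_im (gpt φ x s)
  have h2 := hφ x 0
  rw [h0, sub_zero, sub_zero] at h2
  have h3 : |φ x + s| ≤ |φ x| + |s| := abs_add_le _ _
  simp only [gpt] at *
  linarith

/-- vertical chain, heights going down by the factor 0.92 -/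
theorem Adm.vert {u : ℂ → ℝ} {φ : ℝ → ℝ} {U : Set ℂ} (h : Adm u φ U)
    (hφ : ∀ x y, |φ x - φ y| ≤ 0.1 * |x - y|) {x S σ : ℝ} (hσ : |σ| = 1) (hS : 0 < S)
    (hU : ∀ s, 0 < s → s ≤ S → Metric.ball (gpt φ x (σ * s)) (s / 1.1) ⊆ U) (k : ℕ) :
    ∀ s, s ≤ S → 0.92 ^ k * S ≤ s → u (gpt φ x (σ * s)) ≤ 1.2 ^ k * u (gpt φ x (σ * S)) ∧
      u (gpt φ x (σ * S)) ≤ 1.2 ^ k * u (gpt φ x (σ * s)) := by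
  induction k with
  | zero =>
    intro s h1 h2
    have : s = S := by simp at h2; linarith
    simp [this]
  | succ k ih =>
    intro s h1 h2
    have hs0 : 0 < s := lt_of_lt_of_le (by positivity) h2
    set t := min (s / 0.92) S with ht
    have ht0 : 0 < t := lt_min (by positivity) hS
    have hts : s ≤ t := by
      refine le_min ?_ h1
      rw [le_div_iff₀ (by norm_num)]; nlinarith
    have htS : t ≤ S := min_le_right _ _
    have ht92 : 0.92 * t ≤ s := by
      have : t ≤ s / 0.92 := min_le_left _ _
      rw [le_div_iff₀ (by norm_num)] at this
      linarith
    have hk : 0.92 ^ k * S ≤ t := by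
      refine le_min ?_ ?_
      · rw [le_div_iff₀ (by norm_num)]
        calc _ = 0.92 ^ (k+1) * S := by ring
          _ ≤ s := h2
      · have : (0.92:ℝ) ^ k ≤ 1 := pow_le_one₀ (by norm_num) (by norm_num)
        nlinarith
    obtain ⟨i1, i2⟩ := ih t htS hk
    have hst := h.step hφ (z := gpt φ x (σ * t)) (w := gpt φ x (σ * s)) (s := t) ht0
      (by simp [gpt, abs_mul, hσ, abs_of_pos ht0]) (hU t ht0 htS) (by
        have : gpt φ x (σ * s) - gpt φ x (σ * t) = ((σ * (s - t) : ℝ) : ℂ) * Complex.I := by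
          apply Complex.ext <;> simp [gpt] <;> ring
        rw [this, norm_mul, Complex.norm_real, Complex.norm_I, mul_one, Real.norm_eq_abs, abs_mul, hσ,
          one_mul, abs_sub_comm, abs_of_nonneg (by linarith)]
        linarith)
    obtain ⟨j1, j2⟩ := hst
    have hp : (0:ℝ) < 1.2 ^ k := by positivity
    rw [pow_succ]
    constructor
    · calc _ ≤ _ := j1
        _ ≤ 1.2 * (1.2 ^ k * u (gpt φ x (σ * S))) := by gcongr
        _ = _ := by ring
    · calc _ ≤ _ := i2
        _ ≤ 1.2 ^ k * (1.2 * u (gpt φ x (σ * s))) := by gcongr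
        _ = _ := by ring

/-- horizontal chain at height 1 -/
theorem Adm.horiz {u : ℂ → ℝ} {φ : ℝ → ℝ} (h : Adm u φ (Metric.ball 0 20))
    (hφ : ∀ x y, |φ x - φ y| ≤ 0.1 * |x - y|) (h0 : φ 0 = 0) {σ : ℝ} (hσ : |σ| = 1) {y : ℝ}
    (hy : |y| ≤ 1 / 15) (k : ℕ) (hk : k ≤ 60) :
    u (gpt φ (k * y) σ) ≤ 1.2 ^ k * u (gpt φ 0 σ) := by
  induction k with
  | zero => simp
  | succ k ih =>
    have ih := ih (by omega)
    have hb : |(k:ℝ) * y| ≤ 4 := by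
      rw [abs_mul, Nat.abs_cast]
      have : (k:ℝ) ≤ 60 := by exact_mod_cast (by omega : k ≤ 60)
      nlinarith [abs_nonneg y]
    have hst := h.step hφ (z := gpt φ (k * y) σ) (w := gpt φ ((k + 1 : ℕ) * y) σ) (s := 1) (by norm_num)
      (by simp [gpt, hσ]) (by
        apply Metric.ball_subset_ball'
        rw [dist_zero_right]
        have := gpt_norm φ hφ h0 (k * y) σ
        rw [hσ] at this
        norm_num at *
        linarith) (by
        have h1 := Complex.norm_le_abs_re_add_abs_im (gpt φ ((k + 1 : ℕ) * y) σ - gpt φ (k * y) σ)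
        have h2 := hφ ((k + 1 : ℕ) * y) (k * y)
        have e1 : ((k + 1 : ℕ) : ℝ) * y - k * y = y := by push_cast; ring
        simp only [gpt, Complex.sub_re, Complex.sub_im, add_sub_add_right_eq_sub, e1] at h1 h2 ⊢
        norm_num at *
        linarith)
    calc _ ≤ _ := hst.1
      _ ≤ 1.2 * (1.2 ^ k * u (gpt φ 0 σ)) := by gcongr
      _ = _ := by ring

theorem Adm.N1 {u : ℂ → ℝ} {φ : ℝ → ℝ} (h : Adm u φ (Metric.ball 0 20))
    (hφ : ∀ x y, |φ x - φ y| ≤ 0.1 * |x - y|) (h0 : φ 0 = 0) {N : ℝ} (hN0 : 0 < N)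
    (hN1 : u Complex.I ≤ N) (hN2 : u (-Complex.I) ≤ N) (k : ℕ) {w : ℂ} (hw : |w.re| ≤ 4)
    (h1 : 0.92 ^ k ≤ |w.im - φ w.re|) (h2 : |w.im - φ w.re| ≤ 5) :
    u w ≤ 1.2 ^ 80 * N * 1.2 ^ k := by
  set s := |w.im - φ w.re| with hs
  have hs0 : 0 < s := lt_of_lt_of_le (by positivity) h1
  obtain ⟨σ, hσ, hσs⟩ : ∃ σ : ℝ, (σ = 1 ∨ σ = -1) ∧ w.im - φ w.re = σ * s := by
    rcases abs_cases (w.im - φ w.re) with h | h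
    · exact ⟨1, Or.inl rfl, by rw [hs, h.1]; ring⟩
    · exact ⟨-1, Or.inr rfl, by rw [hs, h.1]; ring⟩
  have hσ1 : |σ| = 1 := by rcases hσ with h | h <;> simp [h]
  have hwg : w = gpt φ w.re (σ * s) := by
    apply Complex.ext <;> simp [gpt]
    linarith
  have hdom : ∀ t, 0 < t → t ≤ 5 → Metric.ball (gpt φ w.re (σ * t)) (t / 1.1) ⊆ Metric.ball 0 20 := by
    intro t ht ht1
    apply Metric.ball_subset_ball'
    rw [dist_zero_right]
    have := gpt_norm φ hφ h0 w.re (σ * t)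
    rw [abs_mul, hσ1, abs_of_pos ht] at this
    norm_num at *
    linarith
  have hz := h.horiz hφ h0 hσ1 (y := w.re / 60) (by
    rw [abs_div]; norm_num; linarith) 60 le_rfl
  have e : ((60:ℕ):ℝ) * (w.re / 60) = w.re := by push_cast; ring
  rw [e] at hz
  have h3 : u (gpt φ 0 σ) ≤ N := by
    rcases hσ with rfl | rfl
    · convert hN1 using 2
      apply Complex.ext <;> simp [gpt, h0]
    · convert hN2 using 2
      apply Complex.ext <;> simp [gpt, h0]
  have hz' : u (gpt φ w.re σ) ≤ 1.2 ^ 60 * N := hz.trans (by gcongr)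
  rcases le_total s 1 with h5 | h5
  · have v := (h.vert hφ (x := w.re) (S := 1) hσ1 one_pos
      (fun t ht ht1 => hdom t ht (by linarith)) k s h5 (by simpa using h1)).1
    rw [← hwg, mul_one] at v
    calc _ ≤ _ := v
      _ ≤ 1.2 ^ k * (1.2 ^ 60 * N) := by gcongr
      _ ≤ 1.2 ^ k * (1.2 ^ 80 * N) := by gcongr <;> norm_num
      _ = _ := by ring
  · have v := (h.vert hφ (x := w.re) (S := s) hσ1 hs0
      (fun t ht ht1 => hdom t ht (by linarith)) 20 1 h5 (by
        have : (0.92:ℝ) ^ 20 * 5 ≤ 1 := by norm_num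
        nlinarith)).2
    rw [← hwg, mul_one] at v
    have hk : (1:ℝ) ≤ 1.2 ^ k := one_le_pow₀ (by norm_num)
    calc _ ≤ _ := v
      _ ≤ 1.2 ^ 20 * (1.2 ^ 60 * N) := by gcongr
      _ = 1.2 ^ 80 * N * 1 := by ring
      _ ≤ _ := by gcongr

theorem Adm.domar {u : ℂ → ℝ} {φ : ℝ → ℝ} (h : Adm u φ (Metric.ball 0 20))
    (hφ : ∀ x y, |φ x - φ y| ≤ 0.1 * |x - y|) (h0 : φ 0 = 0) {N : ℝ} (hN : 0 < N)
    (hN1 : u Complex.I ≤ N) (hN2 : u (-Complex.I) ≤ N) (k : ℕ) (hk : (0.92:ℝ) ^ k ≤ 0.02) {q : ℂ}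
    (hq : ‖q‖ ≤ 3) (hM : 2 * 1.2 ^ 80 * N * 1.2 ^ k ≤ u q) :
    ∃ w, ‖w - q‖ ≤ 20 * 0.92 ^ k ∧ 1.2 * u q ≤ u w := by
  by_contra! hcon
  set t : ℝ := 0.92 ^ k with ht
  have ht0 : 0 < t := by positivity
  set A : ℝ := 1.2 ^ 80 * N * 1.2 ^ k with hA
  have hA0 : 0 < A := by positivity
  have hMA : 2 * A ≤ u q := by rw [hA]; linarith
  set M := u q with hMdef
  have hM0 : 0 < M := by linarith
  have hqre : |q.re| ≤ 3 := (Complex.abs_re_le_norm q).trans hq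
  have hqim : |q.im| ≤ 3 := (Complex.abs_im_le_norm q).trans hq
  have hφq : |φ q.re| ≤ 0.3 := by
    have := hφ q.re 0
    rw [h0, sub_zero, sub_zero] at this
    norm_num at *; linarith
  -- height of q is small
  have hqh : |q.im - φ q.re| < t := by
    by_contra! hge
    have := h.N1 hφ h0 hN hN1 hN2 k (by linarith) hge (by
      have := abs_sub q.im (φ q.re); norm_num at *; linarith)
    linarith
  set ρ : ℝ := 20 * t with hρ
  have hρ0 : 0 < ρ := by positivity
  set H : ℂ → ℝ := fun w => M * (1 / 2 + 0.35 / 0.96 * (1 + ((w - q) ^ 2).re / ρ ^ 2)) with hH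
  have hmain : ∀ w ∈ Metric.closedBall q ρ, u w - H w ≤ 0 := by
    have hsub : Metric.closedBall q ρ ⊆ Metric.ball 0 20 := by
      intro w hw
      rw [mem_closedBall_iff_norm] at hw
      rw [mem_ball_zero_iff]
      have := norm_le_norm_add_norm_sub q w
      rw [norm_sub_rev] at this
      norm_num at *; linarith
    have hHc : Continuous H := by
      have : Continuous fun w : ℂ => ((w - q) ^ 2).re := by fun_prop
      simp only [hH]
      fun_prop
    have hHA : ∀ w, HA H w := by
      intro w
      refine ⟨fun w => M * (1 / 2 + 0.35 / 0.96 * (1 + (w - q) ^ 2 / ρ ^ 2)), by fun_prop, ?_⟩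
      refine Eventually.of_forall fun x => ?_
      have e : ((M:ℂ) * (1 / 2 + 0.35 / 0.96 * (1 + (x - q) ^ 2 / ρ ^ 2))) =
        ((M * (1/2 + 0.35 / 0.96) : ℝ) : ℂ) + ((M * (0.35 / 0.96) / ρ ^ 2 : ℝ) : ℂ) * (x - q) ^ 2 := by
        push_cast; ring
      simp only [e, Complex.add_re, Complex.ofReal_re, Complex.re_ofReal_mul, hH]
      ring
    refine maxP (v := fun w => u w - H w) (isCompact_closedBall q ρ)
      ((h.cont.mono hsub).sub hHc.continuousOn) ?_
    intro w hw
    have hwn : ‖w - q‖ ≤ ρ := by rwa [mem_closedBall_iff_norm] at hw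
    set X := w.re - q.re with hX
    set Y := w.im - q.im with hY
    have hsq : ((w - q) ^ 2).re = X ^ 2 - Y ^ 2 := by
      simp [sq, hX, hY]
    have hnsq : ‖w - q‖ ^ 2 = X ^ 2 + Y ^ 2 := by
      rw [← Complex.normSq_eq_norm_sq, Complex.normSq_apply]; simp [hX, hY]; ring
    have hn2 : X ^ 2 + Y ^ 2 ≤ ρ ^ 2 := by rw [← hnsq]; gcongr
    have hρ2 : 0 < ρ ^ 2 := by positivity
    have hHnn : M / 2 ≤ H w := by
      have : 0 ≤ 1 + ((w - q) ^ 2).re / ρ ^ 2 := by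
        rw [hsq]
        rw [show 1 + (X ^ 2 - Y ^ 2) / ρ ^ 2 = (ρ ^ 2 + X ^ 2 - Y ^ 2) / ρ ^ 2 by field_simp; ring]
        apply div_nonneg _ hρ2.le
        nlinarith [sq_nonneg X]
      simp only [hH]
      have : M * (1/2) ≤ M * (1 / 2 + 0.35 / 0.96 * (1 + ((w - q) ^ 2).re / ρ ^ 2)) := by
        gcongr
        have : 0 ≤ 0.35 / 0.96 * (1 + ((w - q) ^ 2).re / ρ ^ 2) := by positivity
        linarith
      linarith
    rcases hwn.lt_or_eq with hlt | heq
    · rcases h.harm w (hsub hw) with h1 | ⟨h1, _⟩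
      · right
        refine ⟨Metric.closedBall_mem_nhds_of_mem ?_, h1.sub (hHA w)⟩
        rwa [mem_ball_iff_norm]
      · left; simp only [h1]; linarith
    left
    rw [heq] at hnsq
    by_cases hYb : 0.2 * ρ ≤ |Y|
    · have hXb := (Complex.abs_re_le_norm (w - q)).trans hwn
      have hYb' := (Complex.abs_im_le_norm (w - q)).trans hwn
      simp only [Complex.sub_re, Complex.sub_im] at hXb hYb'
      have f1 := hφ w.re q.re
      have e1 : w.im - φ w.re = Y + (q.im - φ q.re) - (φ w.re - φ q.re) := by rw [hY]; ring
      have b1 : |w.im - φ w.re| ≤ |Y| + |q.im - φ q.re| + |φ w.re - φ q.re| := by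
        rw [e1]
        exact (abs_sub _ _).trans (by gcongr; exact abs_add_le _ _)
      have b2 : |Y| ≤ |w.im - φ w.re| + |q.im - φ q.re| + |φ w.re - φ q.re| := by
        have : Y = (w.im - φ w.re) - (q.im - φ q.re) + (φ w.re - φ q.re) := by rw [hY]; ring
        rw [this]
        exact (abs_add_le _ _).trans (by gcongr; exact abs_sub _ _)
      have b3 : |w.re| ≤ |q.re| + |X| := by
        have : w.re = q.re + X := by rw [hX]; ring
        rw [this]; exact abs_add_le _ _
      have := h.N1 hφ h0 hN hN1 hN2 k (w := w) (by norm_num at *; linarith)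
        (by norm_num at *; linarith) (by norm_num at *; linarith)
      linarith
    · have hY2 : Y ^ 2 ≤ 0.04 * ρ ^ 2 := by
        rw [← sq_abs]
        have : |Y| ^ 2 ≤ (0.2 * ρ) ^ 2 := by gcongr; linarith
        calc _ ≤ _ := this
          _ = _ := by ring
      have h3 : 1.92 ≤ 1 + ((w - q) ^ 2).re / ρ ^ 2 := by
        rw [hsq, show 1 + (X ^ 2 - Y ^ 2) / ρ ^ 2 = (ρ ^ 2 + X ^ 2 - Y ^ 2) / ρ ^ 2 by field_simp; ring,
          le_div_iff₀ hρ2]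
        norm_num at *; linarith
      have h4 : 1.2 * M ≤ H w := by
        simp only [hH]
        have : M * (1 / 2 + 0.35 / 0.96 * 1.92) ≤ M * (1 / 2 + 0.35 / 0.96 * (1 + ((w - q) ^ 2).re / ρ ^ 2)) := by
          gcongr
        norm_num at *; linarith
      have := hcon w hwn
      linarith
  have := hmain q (Metric.mem_closedBall_self hρ0.le)
  simp [hH] at this
  norm_num at this
  linarith

theorem Adm.N2 {u : ℂ → ℝ} {φ : ℝ → ℝ} (h : Adm u φ (Metric.ball 0 20))
    (hφ : ∀ x y, |φ x - φ y| ≤ 0.1 * |x - y|) (h0 : φ 0 = 0) {N : ℝ} (hN : 0 < N)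
    (hN1 : u Complex.I ≤ N) (hN2 : u (-Complex.I) ≤ N) {q : ℂ} (hq : ‖q‖ ≤ 2) :
    u q ≤ 2 * 1.2 ^ 80 * N * 1.2 ^ 80 := by
  by_contra! hcon
  have hstep : ∀ j : ℕ, ∃ w, ‖w‖ ≤ 2 + (1 - 0.92 ^ j) ∧ 2 * 1.2 ^ 80 * N * 1.2 ^ (80 + j) ≤ u w := by
    intro j
    induction j with
    | zero => exact ⟨q, by simpa using hq, by simpa using hcon.le⟩
    | succ j ih =>
      obtain ⟨w, hw, hwu⟩ := ih
      have hj : (0:ℝ) < 0.92 ^ j := by positivity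
      have hj1 : (0.92:ℝ) ^ j ≤ 1 := pow_le_one₀ (by norm_num) (by norm_num)
      have h80 : (0.92:ℝ) ^ 80 ≤ 0.002 := by norm_num
      have hpow : (0.92:ℝ) ^ (80 + j) ≤ 0.002 * 0.92 ^ j := by rw [pow_add]; gcongr
      obtain ⟨w', h1, h2⟩ := h.domar hφ h0 hN hN1 hN2 (80 + j) (by norm_num at *; linarith) (q := w)
        (by linarith) hwu
      refine ⟨w', ?_, ?_⟩
      · have := norm_le_norm_add_norm_sub w w'
        rw [norm_sub_rev] at this
        have e : (0.92:ℝ) ^ (j + 1) = 0.92 * 0.92 ^ j := by ring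
        rw [e]
        linarith
      · calc _ = 1.2 * (2 * 1.2 ^ 80 * N * 1.2 ^ (80 + j)) := by ring
          _ ≤ 1.2 * u w := by gcongr
          _ ≤ _ := h2
  obtain ⟨B, hB⟩ := (isCompact_closedBall (0:ℂ) 3).bddAbove_image
    (h.cont.mono (Metric.closedBall_subset_ball (by norm_num)))
  obtain ⟨j, hj⟩ := pow_unbounded_of_one_lt (B / (2 * 1.2 ^ 80 * N)) (by norm_num : (1:ℝ) < 1.2)
  obtain ⟨w, hw, hwu⟩ := hstep j
  have hj' : (0:ℝ) < 0.92 ^ j := by positivity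
  have := hB ⟨w, by rw [mem_closedBall_zero_iff]; linarith, rfl⟩
  rw [div_lt_iff₀ (by positivity)] at hj
  have h3 : (1.2:ℝ) ^ j ≤ 1.2 ^ (80 + j) := pow_le_pow_right₀ (by norm_num) (by omega)
  have : 2 * 1.2 ^ 80 * N * 1.2 ^ j ≤ 2 * 1.2 ^ 80 * N * 1.2 ^ (80 + j) := by gcongr
  linarith

/-- the Carleson constant -/
def cN : ℝ := 2 * 1.2 ^ 80 * 1.2 ^ 80

theorem cN_pos : 0 < cN := by unfold cN; positivity

/-- growth control -/
theorem Adm.N3 {u : ℂ → ℝ} {φ : ℝ → ℝ} {k : ℕ} (h : Adm u φ (Metric.ball 0 (20 / 0.92 ^ k)))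
    (hφ : ∀ x y, |φ x - φ y| ≤ 0.1 * |x - y|) (h0 : φ 0 = 0) {N : ℝ} (hN : 0 < N)
    (hN1 : u Complex.I ≤ N) (hN2 : u (-Complex.I) ≤ N) {q : ℂ} (hq : ‖q‖ * 0.92 ^ k ≤ 2) :
    u q ≤ cN * 1.2 ^ k * N := by
  set t : ℝ := 0.92 ^ k with ht
  have ht0 : 0 < t := by positivity
  have ht1 : t ≤ 1 := pow_le_one₀ (by norm_num) (by norm_num)
  have hv : ∀ σ : ℝ, |σ| = 1 → u (gpt φ 0 (σ * (1 / t))) ≤ 1.2 ^ k * u (gpt φ 0 (σ * 1)) := by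
    intro σ hσ
    refine (h.vert hφ (x := 0) (S := 1 / t) hσ (by positivity) ?_ k 1 ?_ ?_).2
    · intro s hs hs1
      apply Metric.ball_subset_ball'
      rw [dist_zero_right]
      have := gpt_norm φ hφ h0 0 (σ * s)
      rw [abs_mul, hσ, abs_of_pos hs] at this
      have e : 20 / t = 20 * (1 / t) := by ring
      rw [e]
      norm_num at *
      have : 0 < t⁻¹ := by positivity
      linarith
    · rw [le_div_iff₀ ht0]; linarith
    · rw [← ht]; field_simp; rfl
  set u' : ℂ → ℝ := fun ζ => u ((1 / t : ℝ) * ζ) with hu'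
  have hmem : ∀ ζ ∈ Metric.ball (0:ℂ) 20, ((1 / t : ℝ) : ℂ) * ζ ∈ Metric.ball (0:ℂ) (20 / t) := by
    intro ζ hζ
    rw [mem_ball_zero_iff] at *
    rw [norm_mul, Complex.norm_real, Real.norm_eq_abs, abs_of_pos (by positivity)]
    rw [div_mul_eq_mul_div, one_mul]
    gcongr
  have hA : Adm u' (fun x => t * φ (x / t)) (Metric.ball 0 20) := by
    refine ⟨fun z hz => h.nonneg _ (hmem z hz), ?_, ?_⟩
    · exact h.cont.comp (by fun_prop) hmem
    · intro z hz
      rcases h.harm _ (hmem z hz) with h1 | ⟨h1, h2⟩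
      · left
        exact HA.comp_analytic (g := fun ζ => ((1 / t : ℝ) : ℂ) * ζ) h1 (by fun_prop)
      · right
        refine ⟨h1, ?_⟩
        rw [Complex.im_ofReal_mul, Complex.re_ofReal_mul] at h2
        rw [show z.re / t = 1 / t * z.re by ring, ← h2]
        field_simp
  have hpt : ∀ σ : ℝ, gpt φ 0 (σ * (1 / t)) = ((1 / t : ℝ) : ℂ) * (σ * Complex.I) := by
    intro σ
    apply Complex.ext <;> simp [gpt, h0]
    ring
  have hpt1 : ∀ σ : ℝ, gpt φ 0 (σ * 1) = σ * Complex.I := by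
    intro σ
    apply Complex.ext <;> simp [gpt, h0]
  have := hA.N2 (N := 1.2 ^ k * N) (q := t * q) (by
      intro x y
      rw [← mul_sub, abs_mul, abs_of_pos ht0]
      have := hφ (x / t) (y / t)
      rw [← sub_div, abs_div, abs_of_pos ht0] at this
      calc _ ≤ t * (0.1 * (|x - y| / t)) := by gcongr
        _ = _ := by field_simp) (by simp [h0]) (by positivity) (by
      have := hv 1 (by simp)
      rw [hpt, hpt1] at this
      simp only [hu']
      simp at this ⊢
      exact this.trans (by gcongr)) (by
      have := hv (-1) (by simp)
      rw [hpt, hpt1] at this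
      simp only [hu']
      simp at this ⊢
      exact this.trans (by gcongr)) (by
      rw [norm_mul, Complex.norm_real, Real.norm_eq_abs, abs_of_pos ht0]; linarith)
  have e : ((1 / t : ℝ) : ℂ) * (t * q) = q := by
    have : (t:ℂ) ≠ 0 := by exact_mod_cast ht0.ne'
    push_cast; field_simp
  simp only [hu'] at this
  rw [e] at this
  calc _ ≤ _ := this
    _ = _ := by unfold cN; ring


theorem ball_upper {c : ℂ} {T : ℝ} (h : T ≤ c.im) : ∀ w ∈ Metric.ball c T, 0 < w.im := by
  intro w hw
  rw [Metric.mem_ball, Complex.dist_eq] at hw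
  have := (Complex.abs_im_le_norm (w - c)).trans_lt hw
  rw [Complex.sub_im, abs_lt] at this
  linarith [this.1]

theorem hp_zero {v : ℂ → ℝ} (h0 : ∀ z : ℂ, 0 < z.im → 0 ≤ v z) (hh : ∀ z : ℂ, 0 < z.im → HA v z)
    {z0 : ℂ} (hz0 : 0 < z0.im) (hv : v z0 = 0) : ∀ z : ℂ, 0 < z.im → v z = 0 := by
  intro z hz
  set T : ℝ := ‖z‖ ^ 2 / z.im + ‖z0‖ ^ 2 / z0.im with hT
  have aux : ∀ w : ℂ, 0 < w.im → ‖w‖ ^ 2 / w.im ≤ T → w ∈ Metric.ball ((T : ℂ) * Complex.I) T := by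
    intro w hw hwT
    rw [div_le_iff₀ hw] at hwT
    have hn : ‖w‖ ^ 2 = w.re ^ 2 + w.im ^ 2 := by
      rw [← Complex.normSq_eq_norm_sq, Complex.normSq_apply]; ring
    have hT0 : 0 < T := by
      by_contra! hle
      have := mul_nonpos_of_nonpos_of_nonneg hle hw.le
      nlinarith [sq_nonneg w.re]
    rw [mem_ball_iff_norm]
    apply lt_of_pow_lt_pow_left₀ 2 hT0.le
    rw [← Complex.normSq_eq_norm_sq, Complex.normSq_apply]
    simp
    nlinarith
  have p1 : 0 < ‖z‖ ^ 2 / z.im := by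
    have : z ≠ 0 := by rintro rfl; simp at hz
    positivity
  have p2 : 0 < ‖z0‖ ^ 2 / z0.im := by
    have : z0 ≠ 0 := by rintro rfl; simp at hz0
    positivity
  have b1 := aux z hz (by linarith)
  have b2 := aux z0 hz0 (by linarith)
  have hup : ∀ w ∈ Metric.ball ((T : ℂ) * Complex.I) T, 0 < w.im := ball_upper (by simp)
  have k1 := (harnack (fun w hw => hh w (hup w hw)) (fun w hw => h0 w (hup w hw)) b1).1
  have k2 := (harnack (fun w hw => hh w (hup w hw)) (fun w hw => h0 w (hup w hw)) b2).2
  rw [Metric.mem_ball] at b1 b2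
  have hT0 : 0 < T := by linarith
  have c0 := h0 ((T : ℂ) * Complex.I) (by simpa using hT0)
  have c1 := h0 z hz
  rw [hv, mul_zero] at k2
  have k3 : v ((T : ℂ) * Complex.I) = 0 := by
    apply le_antisymm _ c0
    by_contra! hlt
    have := mul_pos (by linarith : 0 < T - dist z0 ((T : ℂ) * Complex.I)) hlt
    linarith
  rw [k3, mul_zero] at k1
  apply le_antisymm _ c1
  by_contra! hlt
  have := mul_pos (by linarith : 0 < T - dist z ((T : ℂ) * Complex.I)) hlt
  linarith

/-- upper barrier -/
theorem hp_upper {w : ℂ → ℝ} (hc : Continuous w) 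
    (hz : ∀ z : ℂ, z.im ≤ 0 → w z = 0) (hh : ∀ z : ℂ, 0 < z.im → HA w z) {R B : ℝ} (hR : 0 < R)
    (hB0 : 0 ≤ B) (hB : ∀ z : ℂ, ‖z‖ ≤ R → w z ≤ B) {y : ℝ} (hy : 0 < y) (hyR : y ≤ R) :
    w (y * Complex.I) ≤ B * (2 / Real.log 2) * (y / R) := by
  have hl2 : 0 < Real.log 2 := Real.log_pos (by norm_num)
  set K : Set ℂ := Metric.closedBall 0 R ∩ {z | 0 ≤ z.im} with hK
  have hKc : IsCompact K := (isCompact_closedBall 0 R).inter_right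
    (isClosed_le continuous_const Complex.continuous_im)
  set b : ℂ → ℝ := fun z => B * (2 / Real.log 2) * (Real.log ‖z + R * Complex.I‖ - Real.log R) with hb
  have hne : ∀ z : ℂ, 0 ≤ z.im → z + R * Complex.I ≠ 0 := by
    intro z hz h
    have := congrArg Complex.im h
    simp at this
    linarith
  have hsq : ∀ z : ℂ, ‖z + R * Complex.I‖ ^ 2 = ‖z‖ ^ 2 + 2 * R * z.im + R ^ 2 := by
    intro z
    rw [← Complex.normSq_eq_norm_sq, ← Complex.normSq_eq_norm_sq, Complex.normSq_apply,
      Complex.normSq_apply]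
    simp; ring
  have hbc : ContinuousOn b K := by
    intro z hz
    have : ContinuousAt b z := by
      have h1 : ‖z + R * Complex.I‖ ≠ 0 := norm_ne_zero_iff.2 (hne z hz.2)
      have h2 : ContinuousAt (fun z : ℂ => ‖z + R * Complex.I‖) z := by fun_prop
      exact continuousAt_const.mul ((h2.log h1).sub continuousAt_const)
    exact this.continuousWithinAt
  have hmain : ∀ z ∈ K, w z - b z ≤ 0 := by
    refine maxP (v := fun z => w z - b z) hKc (hc.continuousOn.sub hbc) ?_
    intro z hzK
    obtain ⟨hz1, hz2⟩ := hzK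
    rw [mem_closedBall_zero_iff] at hz1
    have hz2 : 0 ≤ z.im := hz2
    have hbnn : 0 ≤ b z := by
      refine mul_nonneg (by positivity) (sub_nonneg.2 (Real.log_le_log hR ?_))
      apply le_of_sq_le_sq _ (norm_nonneg _)
      rw [hsq]; nlinarith [sq_nonneg ‖z‖, mul_nonneg hR.le hz2]
    rcases hz2.eq_or_lt with h1 | h1
    · left; simp only [hz z h1.symm.le]; linarith
    rcases hz1.lt_or_eq with h2 | h2
    · right
      constructor
      · apply inter_mem
        · exact Metric.closedBall_mem_nhds_of_mem (by simpa using h2)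
        · exact mem_of_superset ((isOpen_lt continuous_const Complex.continuous_im).mem_nhds h1)
            (fun x (hx : 0 < x.im) => (hx.le : 0 ≤ x.im))
      · have hF : AnalyticAt ℂ (fun z : ℂ => z + R * Complex.I) z := by fun_prop
        exact (hh z h1).sub (HA.const_mul ((HA_log_norm hF (hne z hz2)).sub (HA_const _ _)) _)
    · left
      have h3 : Real.log 2 / 2 ≤ Real.log ‖z + R * Complex.I‖ - Real.log R := by
        have : Real.log (2 * R ^ 2) ≤ Real.log (‖z + R * Complex.I‖ ^ 2) := by
          apply Real.log_le_log (by positivity)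
          rw [hsq, h2]
          nlinarith
        rw [Real.log_mul (by norm_num) (by positivity), Real.log_pow, Real.log_pow] at this
        push_cast at this
        linarith
      have h4 : B ≤ b z := by
        calc B = B * (2 / Real.log 2) * (Real.log 2 / 2) := by field_simp
          _ ≤ _ := by simp only [hb]; gcongr
      have := hB z h2.le
      linarith
  have h1 := hmain (y * Complex.I) (by
    refine ⟨?_, by simp [hy.le]⟩
    rw [mem_closedBall_zero_iff, norm_mul, Complex.norm_I, mul_one, Complex.norm_real,
      Real.norm_eq_abs, abs_of_pos hy]
    exact hyR)
  have h2 : Real.log ‖(y * Complex.I : ℂ) + R * Complex.I‖ - Real.log R ≤ y / R := by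
    have : (y * Complex.I : ℂ) + R * Complex.I = ((y + R : ℝ) : ℂ) * Complex.I := by push_cast; ring
    rw [this, norm_mul, Complex.norm_I, mul_one, Complex.norm_real,
      Real.norm_eq_abs, abs_of_pos (by linarith), ← Real.log_div (by linarith) (by linarith)]
    have := Real.log_le_sub_one_of_pos (x := (y + R) / R) (by positivity)
    rw [add_div, div_self hR.ne'] at this ⊢
    linarith
  have h3 : b (y * Complex.I) ≤ B * (2 / Real.log 2) * (y / R) := by
    simp only [hb]; gcongr
  linarith

theorem half_adm {w : ℂ → ℝ} (hc : Continuous w) (h0 : ∀ z, 0 ≤ w z)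
    (hz : ∀ z : ℂ, z.im ≤ 0 → w z = 0) (hh : ∀ z : ℂ, 0 < z.im → HA w z) (U : Set ℂ) :
    Adm w (fun _ => 0) U := by
  refine ⟨fun z _ => h0 z, hc.continuousOn, fun z _ => ?_⟩
  rcases lt_trichotomy z.im 0 with h | h | h
  · left
    refine (HA_const 0 z).congr ?_
    filter_upwards [(isOpen_lt Complex.continuous_im continuous_const).mem_nhds h] with x hx
    exact hz x (le_of_lt hx)
  · right; exact ⟨hz z h.le, h⟩
  · left; exact hh z h

theorem halfplane {v : ℂ → ℝ} (hc : Continuous v) (h0 : ∀ z, 0 ≤ v z)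
    (hz : ∀ z : ℂ, z.im ≤ 0 → v z = 0) (hh : ∀ z : ℂ, 0 < z.im → HA v z) :
    ∃ a : ℝ, 0 ≤ a ∧ ∀ z : ℂ, v z = a * max z.im 0 := by
  set S : Set ℝ := {r | ∃ z : ℂ, 0 < z.im ∧ r = v z / z.im} with hS
  have hSb : BddBelow S := ⟨0, by rintro r ⟨z, h, rfl⟩; exact div_nonneg (h0 z) h.le⟩
  have hSn : S.Nonempty := ⟨_, Complex.I, by simp, rfl⟩
  set a := sInf S with ha
  have ha0 : 0 ≤ a := Real.sInf_nonneg (by rintro r ⟨z, h, rfl⟩; exact div_nonneg (h0 z) h.le)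
  refine ⟨a, ha0, ?_⟩
  have hle : ∀ z : ℂ, 0 < z.im → a * z.im ≤ v z := by
    intro z h
    have : a ≤ v z / z.im := csInf_le hSb ⟨z, h, rfl⟩
    rwa [le_div_iff₀ h] at this
  set w : ℂ → ℝ := fun z => v z - a * max z.im 0 with hw
  have wc : Continuous w := by fun_prop
  have w0 : ∀ z, 0 ≤ w z := by
    intro z
    rcases le_or_gt z.im 0 with h | h
    · simp [hw, max_eq_right h, hz z h]
    · simp only [hw, max_eq_left h.le]; linarith [hle z h]
  have wz : ∀ z : ℂ, z.im ≤ 0 → w z = 0 := by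
    intro z h; simp [hw, max_eq_right h, hz z h]
  have wh : ∀ z : ℂ, 0 < z.im → HA w z := by
    intro z h
    refine ((hh z h).sub ((HA_im z).const_mul a)).congr ?_
    filter_upwards [(isOpen_lt continuous_const Complex.continuous_im).mem_nhds h] with x hx
    simp only [hw, max_eq_left (le_of_lt hx : (0:ℝ) ≤ x.im)]
  -- upper estimate
  set C : ℝ := cN * (2 / Real.log 2) with hC
  have hl2 : 0 < Real.log 2 := Real.log_pos (by norm_num)
  have hC0 : 0 < C := mul_pos cN_pos (by positivity)
  have upper : ∀ R : ℝ, 1 ≤ R → w Complex.I ≤ C * (w (R * Complex.I) / R) := by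
    intro R hR
    have hR0 : 0 < R := by linarith
    apply le_of_forall_pos_le_add
    intro e he
    set N : ℝ := w (R * Complex.I) + e * R / C with hN
    have hN0 : 0 < N := by have := w0 (R * Complex.I); positivity
    set w' : ℂ → ℝ := fun z => w (R * z) with hw'
    have w'c : Continuous w' := by fun_prop
    have him : ∀ z : ℂ, ((R:ℂ) * z).im = R * z.im := fun z => by simp
    have w'z : ∀ z : ℂ, z.im ≤ 0 → w' z = 0 := fun z h => wz _ (by
      rw [him]; exact mul_nonpos_of_nonneg_of_nonpos hR0.le h)
    have w'h : ∀ z : ℂ, 0 < z.im → HA w' z := by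
      intro z h
      exact HA.comp_analytic (g := fun z => (R:ℂ) * z) (wh _ (by rw [him]; positivity)) (by fun_prop)
    have A := half_adm w'c (fun z => w0 _) w'z w'h (Metric.ball 0 20)
    have hb : ∀ z : ℂ, ‖z‖ ≤ 1 → w' z ≤ cN * N := by
      intro z h
      have := A.N2 (N := N) (q := z) (by intro x y; simp; positivity) rfl hN0
        (by simp only [hw', hN]; linarith [show 0 < e * R / C by positivity])
        (by rw [w'z _ (by simp)]; exact hN0.le) (by linarith)
      calc _ ≤ _ := this
        _ = _ := by unfold cN; ring
    have := hp_upper w'c w'z w'h one_pos (mul_nonneg cN_pos.le hN0.le) hb (y := 1 / R) (by positivity)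
      (by rw [div_le_one hR0]; exact hR)
    have e1 : (R:ℂ) * (((1 / R : ℝ) : ℂ) * Complex.I) = Complex.I := by
      have : (R:ℂ) ≠ 0 := by exact_mod_cast hR0.ne'
      push_cast; field_simp
    simp only [hw', e1] at this
    calc _ ≤ _ := this
      _ = C * (w (R * Complex.I) / R) + e := by rw [hN, hC]; have := cN_pos.ne'; field_simp
  -- lower estimate
  have lower : ∀ z : ℂ, 0 < z.im → w Complex.I / (2.4 * C) * z.im ≤ w z := by
    intro z h
    set R : ℝ := 11 * |z.re| + z.im + 1 with hR
    have hR0 : 0 < R := by positivity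
    have hup : ∀ c : ℂ, c.im = R → ∀ x ∈ Metric.ball c R, 0 < x.im := fun c hc => ball_upper hc.ge
    have k1 := (harnack12 (z := (⟨z.re, R⟩ : ℂ)) (fun x hx => wh x (hup _ rfl x hx)) (fun x _ => w0 x) hR0
      (w := R * Complex.I) (by
        rw [Complex.dist_eq]
        have : (R * Complex.I : ℂ) - ⟨z.re, R⟩ = ((-z.re : ℝ) : ℂ) := by
          apply Complex.ext <;> simp
        rw [this, Complex.norm_real, Real.norm_eq_abs, abs_neg]
        rw [le_div_iff₀ (by norm_num)]; linarith)).1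
    have hd : dist z (⟨z.re, R⟩ : ℂ) = R - z.im := by
      rw [Complex.dist_eq]
      have : z - (⟨z.re, R⟩ : ℂ) = ((z.im - R : ℝ) : ℂ) * Complex.I := by
        apply Complex.ext <;> simp
      rw [this, norm_mul, Complex.norm_I, mul_one, Complex.norm_real, Real.norm_eq_abs,
        abs_of_neg (by rw [hR]; linarith [abs_nonneg z.re])]
      ring
    have k2 := (harnack (z := (⟨z.re, R⟩ : ℂ)) (fun x hx => wh x (hup _ rfl x hx)) (fun x _ => w0 x)
      (w := z) (by rw [Metric.mem_ball, hd]; linarith)).2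
    rw [hd] at k2
    have k3 := upper R (by rw [hR]; linarith [abs_nonneg z.re])
    have hwz := w0 z
    have k4 : z.im * w ⟨z.re, R⟩ ≤ 2 * R * w z := by nlinarith
    have k5 : z.im * w (R * Complex.I) ≤ 2.4 * R * w z := by
      calc _ ≤ z.im * (1.2 * w ⟨z.re, R⟩) := by gcongr
        _ = 1.2 * (z.im * w ⟨z.re, R⟩) := by ring
        _ ≤ 1.2 * (2 * R * w z) := by gcongr
        _ = _ := by ring
    calc _ ≤ (C * (w (R * Complex.I) / R)) / (2.4 * C) * z.im := by gcongr
      _ = (z.im * w (R * Complex.I)) / (2.4 * R) := by field_simp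
      _ ≤ (2.4 * R * w z) / (2.4 * R) := by gcongr
      _ = _ := by field_simp
  have hwI : w Complex.I = 0 := by
    apply le_antisymm _ (w0 _)
    by_contra! hlt
    have hpos : 0 < w Complex.I / (2.4 * C) := by positivity
    have : a + w Complex.I / (2.4 * C) ≤ a := by
      conv_rhs => rw [ha]
      apply le_csInf hSn
      rintro r ⟨z, h, rfl⟩
      rw [le_div_iff₀ h]
      have := lower z h
      simp only [hw, max_eq_left h.le] at this ⊢
      linarith
    linarith
  have := hp_zero (fun z _ => w0 z) wh (by simp) hwI
  intro z
  rcases le_or_gt z.im 0 with h | h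
  · simp [max_eq_right h, hz z h]
  · have := this z h
    simp only [hw] at this
    linarith


/-- nonempty compositions of Hénon maps -/
inductive HComp : (ℂ × ℂ → ℂ × ℂ) → Prop
  | single {h : ℂ × ℂ → ℂ × ℂ} : IsHenon h → HComp h
  | cons {h g : ℂ × ℂ → ℂ × ℂ} : IsHenon h → HComp g → HComp (h ∘ g)

theorem HComp.comp {h g : ℂ × ℂ → ℂ × ℂ} (hh : HComp h) (hg : HComp g) : HComp (h ∘ g) := by
  induction hh with
  | single h1 => exact .cons h1 hg
  | cons h1 _ ih => exact HComp.cons (g := _ ∘ g) h1 ih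

theorem HComp.of_list (hs : List (ℂ × ℂ → ℂ × ℂ)) (h0 : hs ≠ []) (h : ∀ h ∈ hs, IsHenon h) :
    HComp (hs.foldr (fun h acc => h ∘ acc) id) := by
  induction hs with
  | nil => exact absurd rfl h0
  | cons a l ih =>
    rcases eq_or_ne l [] with rfl | hl
    · exact .single (h a (by simp))
    · exact HComp.cons (h := a) (g := l.foldr (fun h acc => h ∘ acc) id) (h a (by simp)) (ih hl fun x hx => h x (by simp [hx]))

/-- the sector where orbits escape -/
def Vp (R : ℝ) : Set (ℂ × ℂ) := {z | R ≤ ‖z.1‖ ∧ ‖z.2‖ ≤ ‖z.1‖}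
/-- forward invariant region -/
def Om (M : ℝ) : Set (ℂ × ℂ) := {z | ‖z.2‖ ≤ max ‖z.1‖ M}

structure Good (h : ℂ × ℂ → ℂ × ℂ) (d : ℕ) (c : ℂ) (R C : ℝ) : Prop where
  R1 : 1 ≤ R
  d2 : 2 ≤ d
  c0 : c ≠ 0
  C0 : 0 ≤ C
  CR : 2 * C ≤ ‖c‖ * R
  diff : Differentiable ℂ h
  vp : ∀ z ∈ Vp R, h z ∈ Vp R
  grow : ∀ z ∈ Vp R, 2 * ‖z.1‖ ≤ ‖(h z).1‖
  asym : ∀ z ∈ Vp R, ‖(h z).1 - c * z.1 ^ d‖ ≤ C * ‖z.1‖ ^ (d - 1)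
  om : ∀ M, R ≤ M → ∀ z ∈ Om M, h z ∈ Om M
  par : ∀ M, R ≤ M → ∃ K, 0 ≤ K ∧ ∀ z ∈ Om M, ‖(h z).2‖ ^ 2 ≤ K * (1 + ‖(h z).1‖)

theorem Vp_mono {R R' : ℝ} (h : R ≤ R') : Vp R' ⊆ Vp R := fun _ hz => ⟨h.trans hz.1, hz.2⟩

theorem Good.mono {h : ℂ × ℂ → ℂ × ℂ} {d : ℕ} {c : ℂ} {R C R' : ℝ} (H : Good h d c R C) (hR : R ≤ R') :
    Good h d c R' C := by
  refine ⟨H.R1.trans hR, H.d2, H.c0, H.C0, H.CR.trans (by gcongr), H.diff, ?_, ?_, ?_, ?_, ?_⟩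
  · intro z hz
    have h1 := H.vp z (Vp_mono hR hz)
    have h2 := H.grow z (Vp_mono hR hz)
    refine ⟨?_, h1.2⟩
    have := hz.1
    have := norm_nonneg z.1
    linarith
  · exact fun z hz => H.grow z (Vp_mono hR hz)
  · exact fun z hz => H.asym z (Vp_mono hR hz)
  · exact fun M hM => H.om M (hR.trans hM)
  · exact fun M hM => H.par M (hR.trans hM)

/-- polynomial asymptotics -/
theorem poly_asym (p : Polynomial ℂ) (hp : 1 ≤ p.natDegree) : ∃ K : ℝ, 0 ≤ K ∧ ∀ x : ℂ, 1 ≤ ‖x‖ →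
    ‖p.eval x - p.leadingCoeff * x ^ p.natDegree‖ ≤ K * ‖x‖ ^ (p.natDegree - 1) := by
  refine ⟨∑ i ∈ Finset.range p.natDegree, ‖p.coeff i‖, Finset.sum_nonneg fun _ _ => norm_nonneg _, ?_⟩
  intro x hx
  rw [Polynomial.eval_eq_sum_range, Finset.sum_range_succ, Polynomial.coeff_natDegree,
    add_sub_cancel_right, Finset.sum_mul]
  refine (norm_sum_le _ _).trans (Finset.sum_le_sum fun i hi => ?_)
  rw [norm_mul, norm_pow]
  rw [Finset.mem_range] at hi
  exact mul_le_mul_of_nonneg_left (pow_le_pow_right₀ hx (by omega)) (norm_nonneg _)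

theorem henon_good {h : ℂ × ℂ → ℂ × ℂ} {p : Polynomial ℂ} {a : ℂ} (hp : 2 ≤ p.natDegree)
    (hh : ∀ z : ℂ × ℂ, h z = (Polynomial.eval z.1 p - a * z.2, z.1)) : ∃ c R C, Good h p.natDegree c R C := by
  obtain ⟨K, hK, hKx⟩ := poly_asym p (by omega)
  set d := p.natDegree with hd
  set c := p.leadingCoeff with hc
  have hc0 : c ≠ 0 := by
    rw [hc, Polynomial.leadingCoeff_ne_zero]
    rintro rfl
    simp at hd; omega
  have hcn : 0 < ‖c‖ := norm_pos_iff.2 hc0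
  set C : ℝ := K + ‖a‖ with hC
  set R : ℝ := 1 + (2 * C + 4) / ‖c‖ with hR
  have hR1 : 1 ≤ R := by
    have : 0 ≤ (2 * C + 4) / ‖c‖ := by positivity
    linarith
  have hcR : 2 * C + 4 ≤ ‖c‖ * R := by
    have : ‖c‖ * R = ‖c‖ + (2 * C + 4) := by rw [hR]; field_simp
    linarith
  have hasym : ∀ z ∈ Vp R, ‖(h z).1 - c * z.1 ^ d‖ ≤ C * ‖z.1‖ ^ (d - 1) := by
    intro z hz
    have hx1 : 1 ≤ ‖z.1‖ := hR1.trans hz.1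
    rw [hh]
    have h1 := hKx z.1 hx1
    have h2 : ‖z.1‖ ≤ ‖z.1‖ ^ (d - 1) := le_self_pow₀ hx1 (by omega)
    calc _ = ‖(p.eval z.1 - c * z.1 ^ d) - a * z.2‖ := by simp only; congr 1; ring
      _ ≤ ‖p.eval z.1 - c * z.1 ^ d‖ + ‖a * z.2‖ := norm_sub_le _ _
      _ ≤ K * ‖z.1‖ ^ (d - 1) + ‖a‖ * ‖z.1‖ ^ (d - 1) := by
        rw [norm_mul]
        gcongr
        exact hz.2.trans h2
      _ = _ := by rw [hC]; ring
  have hlow : ∀ z ∈ Vp R, ‖c‖ / 2 * ‖z.1‖ ^ d ≤ ‖(h z).1‖ := by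
    intro z hz
    have h1 := hasym z hz
    have hx1 : 1 ≤ ‖z.1‖ := hR1.trans hz.1
    have h2 : ‖z.1‖ ^ d = ‖z.1‖ * ‖z.1‖ ^ (d - 1) := by
      rw [← pow_succ', show d - 1 + 1 = d by omega]
    have h3 := norm_sub_norm_le (c * z.1 ^ d) (h z).1
    rw [norm_sub_rev, norm_mul, norm_pow] at h3
    have h4 : C * ‖z.1‖ ^ (d - 1) ≤ ‖c‖ / 2 * ‖z.1‖ ^ d := by
      rw [h2, ← mul_assoc]
      gcongr
      have : ‖c‖ * R ≤ ‖c‖ * ‖z.1‖ := by gcongr; exact hz.1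
      linarith
    linarith
  have hgrow : ∀ z ∈ Vp R, 2 * ‖z.1‖ ≤ ‖(h z).1‖ := by
    intro z hz
    have hx1 : 1 ≤ ‖z.1‖ := hR1.trans hz.1
    refine le_trans ?_ (hlow z hz)
    have h2 : ‖z.1‖ ^ 2 ≤ ‖z.1‖ ^ d := pow_le_pow_right₀ hx1 hp
    have h3 : ‖c‖ * R ≤ ‖c‖ * ‖z.1‖ := by gcongr; exact hz.1
    have h4 : 0 ≤ C := by positivity
    calc 2 * ‖z.1‖ ≤ (‖c‖ / 2 * ‖z.1‖) * ‖z.1‖ := by gcongr; linarith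
      _ = ‖c‖ / 2 * ‖z.1‖ ^ 2 := by ring
      _ ≤ _ := by gcongr
  have hvp : ∀ z ∈ Vp R, h z ∈ Vp R := by
    intro z hz
    have h1 := hgrow z hz
    have := norm_nonneg z.1
    refine ⟨?_, ?_⟩
    · have := hz.1; linarith
    · have : (h z).2 = z.1 := by rw [hh]
      rw [this]; linarith
  refine ⟨c, R, C, hR1, hp, hc0, by positivity, by linarith, ?_, hvp, hgrow, hasym, ?_, ?_⟩
  · have : h = fun z : ℂ × ℂ => (p.eval z.1 - a * z.2, z.1) := funext hh
    rw [this]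
    have hpd := p.differentiable
    fun_prop
  · intro M hM z hz
    have hz : ‖z.2‖ ≤ max ‖z.1‖ M := hz
    have e2 : (h z).2 = z.1 := by rw [hh]
    rcases le_total M ‖z.1‖ with h1 | h1
    · have := hvp z ⟨hM.trans h1, by rwa [max_eq_left h1] at hz⟩
      exact this.2.trans (le_max_left _ _)
    · change ‖(h z).2‖ ≤ max ‖(h z).1‖ M
      rw [e2]; exact h1.trans (le_max_right _ _)
  · intro M hM
    refine ⟨2 / ‖c‖ + M ^ 2, by positivity, ?_⟩
    intro z hz
    have hz : ‖z.2‖ ≤ max ‖z.1‖ M := hz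
    have e2 : (h z).2 = z.1 := by rw [hh]
    rw [e2]
    have hn := norm_nonneg (h z).1
    rcases le_total M ‖z.1‖ with h1 | h1
    · have h2 := hlow z ⟨hM.trans h1, by rwa [max_eq_left h1] at hz⟩
      have h3 : ‖z.1‖ ^ 2 ≤ ‖z.1‖ ^ d := pow_le_pow_right₀ (by linarith) hp
      have h4 : ‖z.1‖ ^ 2 ≤ 2 / ‖c‖ * ‖(h z).1‖ := by
        calc _ ≤ ‖z.1‖ ^ d := h3
          _ = 2 / ‖c‖ * (‖c‖ / 2 * ‖z.1‖ ^ d) := by field_simp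
          _ ≤ _ := by gcongr
      have : 0 ≤ 2 / ‖c‖ := by positivity
      nlinarith [sq_nonneg M]
    · have h2 : ‖z.1‖ ^ 2 ≤ M ^ 2 := by gcongr
      have : 0 ≤ 2 / ‖c‖ := by positivity
      nlinarith [sq_nonneg M]

theorem IsHenon.good {h : ℂ × ℂ → ℂ × ℂ} (hh : IsHenon h) : ∃ d c R C, Good h d c R C := by
  obtain ⟨p, a, _, hp, hh⟩ := hh
  exact ⟨_, henon_good hp hh⟩

theorem pow_asym (n : ℕ) : ∃ K : ℝ, 0 ≤ K ∧ ∀ (a b : ℂ) (A B : ℝ), ‖a‖ ≤ A → ‖a - b‖ ≤ B → ‖b‖ ≤ A →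
    ‖a ^ n - b ^ n‖ ≤ K * B * A ^ (n - 1) := by
  refine ⟨n, by positivity, ?_⟩
  intro a b A B ha hab hb
  have hA : 0 ≤ A := (norm_nonneg _).trans ha
  rw [← Commute.mul_geom_sum₂ (Commute.all a b), norm_mul]
  have : ‖∑ i ∈ Finset.range n, a ^ i * b ^ (n - 1 - i)‖ ≤ n * A ^ (n - 1) := by
    refine (norm_sum_le _ _).trans ?_
    calc _ ≤ ∑ i ∈ Finset.range n, A ^ (n - 1) := by
          refine Finset.sum_le_sum fun i hi => ?_
          rw [Finset.mem_range] at hi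
          rw [norm_mul, norm_pow, norm_pow]
          calc _ ≤ A ^ i * A ^ (n - 1 - i) := by gcongr
            _ = A ^ (n - 1) := by rw [← pow_add]; congr 1; omega
      _ = _ := by simp
  calc _ ≤ B * (n * A ^ (n - 1)) := by
        gcongr
        exact (norm_nonneg _).trans hab
    _ = _ := by ring

theorem Good.up {h : ℂ × ℂ → ℂ × ℂ} {d : ℕ} {c : ℂ} {R C : ℝ} (H : Good h d c R C) {z : ℂ × ℂ}
    (hz : z ∈ Vp R) : C * ‖z.1‖ ^ (d - 1) ≤ ‖c‖ / 2 * ‖z.1‖ ^ d := by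
  have h2 : ‖z.1‖ ^ d = ‖z.1‖ * ‖z.1‖ ^ (d - 1) := by
    rw [← pow_succ', show d - 1 + 1 = d by have := H.d2; omega]
  rw [h2, ← mul_assoc]
  gcongr
  have := H.CR
  have : ‖c‖ * R ≤ ‖c‖ * ‖z.1‖ := by gcongr; exact hz.1
  linarith

theorem Good.comp {h g : ℂ × ℂ → ℂ × ℂ} {d e : ℕ} {c b : ℂ} {R C R' C' : ℝ} (H : Good h d c R C)
    (G : Good g e b R' C') : ∃ R'' C'', Good (h ∘ g) (e * d) (c * b ^ d) R'' C'' := by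
  set S := max R R' with hS
  have H := H.mono (le_max_left R R')
  have G := G.mono (le_max_right R R')
  obtain ⟨K, hK, hKp⟩ := pow_asym d
  have hd2 := H.d2
  have he2 := G.d2
  have hC := H.C0
  have hC' := G.C0
  set A : ℝ := 3 / 2 * ‖b‖ with hA
  have hA0 : 0 ≤ A := by positivity
  set C'' : ℝ := C * A ^ (d - 1) + ‖c‖ * (K * C' * A ^ (d - 1)) with hC''
  have hC0 : 0 ≤ C'' := by positivity
  have hcb : 0 < ‖c * b ^ d‖ := norm_pos_iff.2 (mul_ne_zero H.c0 (pow_ne_zero _ G.c0))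
  set R'' : ℝ := S + 2 * C'' / ‖c * b ^ d‖ with hR''
  have hRS : S ≤ R'' := by
    have : 0 ≤ 2 * C'' / ‖c * b ^ d‖ := by positivity
    linarith
  have base : ∀ z ∈ Vp S, ‖((h ∘ g) z).1 - c * b ^ d * z.1 ^ (e * d)‖ ≤ C'' * ‖z.1‖ ^ (e * d - 1) := by
    intro z hz
    have h1 := G.asym z hz
    have h2 := H.asym _ (G.vp z hz)
    have hx1 : 1 ≤ ‖z.1‖ := H.R1.trans hz.1
    set x := z.1
    set y := (g z).1
    have hu := G.up hz
    have hy : ‖y‖ ≤ A * ‖x‖ ^ e := by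
      have := norm_le_norm_add_norm_sub (b * x ^ e) y
      rw [norm_sub_rev, norm_mul, norm_pow] at this
      rw [hA]
      have h3 := h1.trans hu
      linarith
    have hb : ‖b * x ^ e‖ ≤ A * ‖x‖ ^ e := by
      rw [norm_mul, norm_pow, hA]
      have : 0 ≤ ‖b‖ * ‖x‖ ^ e := by positivity
      linarith
    have h3 := hKp y (b * x ^ e) _ _ hy h1 hb
    have hexp : (‖x‖ ^ e) ^ (d - 1) ≤ ‖x‖ ^ (e * d - 1) := by
      rw [← pow_mul]
      apply pow_le_pow_right₀ hx1
      rw [Nat.mul_sub, mul_one]; omega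
    have hexp2 : ‖x‖ ^ (e - 1) * (‖x‖ ^ e) ^ (d - 1) = ‖x‖ ^ (e * d - 1) := by
      rw [← pow_mul, ← pow_add]
      congr 1
      have : e ≤ e * d := Nat.le_mul_of_pos_right _ (by omega)
      rw [Nat.mul_sub, mul_one]; omega
    calc _ = ‖((h (g z)).1 - c * y ^ d) + c * (y ^ d - (b * x ^ e) ^ d)‖ := by
          congr 1; simp only [Function.comp_apply]; ring
      _ ≤ ‖(h (g z)).1 - c * y ^ d‖ + ‖c‖ * ‖y ^ d - (b * x ^ e) ^ d‖ := by
          rw [← norm_mul]; exact norm_add_le _ _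
      _ ≤ C * (A * ‖x‖ ^ e) ^ (d - 1) + ‖c‖ * (K * (C' * ‖x‖ ^ (e - 1)) * (A * ‖x‖ ^ e) ^ (d - 1)) := by
          gcongr
          exact h2.trans (by gcongr)
      _ = C * A ^ (d - 1) * (‖x‖ ^ e) ^ (d - 1) +
          ‖c‖ * (K * C' * A ^ (d - 1)) * (‖x‖ ^ (e - 1) * (‖x‖ ^ e) ^ (d - 1)) := by
          rw [mul_pow]; ring
      _ ≤ C * A ^ (d - 1) * ‖x‖ ^ (e * d - 1) +
          ‖c‖ * (K * C' * A ^ (d - 1)) * ‖x‖ ^ (e * d - 1) := by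
          rw [hexp2]; gcongr
      _ = _ := by rw [hC'']; ring
  have hgrow : ∀ z ∈ Vp S, 2 * ‖z.1‖ ≤ ‖((h ∘ g) z).1‖ := by
    intro z hz
    have h1 := G.grow z hz
    have h2 := H.grow _ (G.vp z hz)
    rw [Function.comp_apply]
    have := norm_nonneg z.1
    linarith
  refine ⟨R'', C'', H.R1.trans hRS, ?_, mul_ne_zero H.c0 (pow_ne_zero _ G.c0), hC0, ?_,
    H.diff.comp G.diff, ?_, fun z hz => hgrow z (Vp_mono hRS hz), fun z hz => base z (Vp_mono hRS hz),
    ?_, ?_⟩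
  · nlinarith
  · have e : ‖c * b ^ d‖ * R'' = ‖c * b ^ d‖ * S + 2 * C'' := by rw [hR'']; field_simp
    have : 0 ≤ S := by linarith [H.R1]
    rw [e]
    have := mul_nonneg hcb.le this
    linarith
  · intro z hz
    have h1 := hgrow z (Vp_mono hRS hz)
    have := norm_nonneg z.1
    exact ⟨by have := hz.1; linarith, (H.vp _ (G.vp z (Vp_mono hRS hz))).2⟩
  · exact fun M hM z hz => H.om M (hRS.trans hM) _ (G.om M (hRS.trans hM) z hz)
  · intro M hM
    obtain ⟨K, hK, hKp⟩ := H.par M (hRS.trans hM)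
    exact ⟨K, hK, fun z hz => hKp _ (G.om M (hRS.trans hM) z hz)⟩

theorem HComp.good {h : ℂ × ℂ → ℂ × ℂ} (hh : HComp h) : ∃ d c R C, Good h d c R C := by
  induction hh with
  | single h1 => exact h1.good
  | cons h1 _ ih =>
    obtain ⟨d, c, R, C, H⟩ := h1.good
    obtain ⟨d', c', R', C', H'⟩ := ih
    obtain ⟨R'', C'', H''⟩ := H.comp H'
    exact ⟨_, _, _, _, H''⟩

/-- inverse, conjugated by the swap -/
theorem HComp.inv {h : ℂ × ℂ → ℂ × ℂ} (hh : HComp h) : ∃ k, HComp k ∧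
    (∀ z, (k (h z).swap) = z.swap) ∧ (∀ z, h ((k z).swap) = z.swap) := by
  have single : ∀ h, IsHenon h → ∃ k, IsHenon k ∧
    (∀ z, (k (h z).swap) = z.swap) ∧ (∀ z, h ((k z).swap) = z.swap) := by
    rintro h ⟨p, a, ha, hp, hz⟩
    refine ⟨fun z => ((Polynomial.C a⁻¹ * p).eval z.1 - a⁻¹ * z.2, z.1), ⟨Polynomial.C a⁻¹ * p, a⁻¹,
      inv_ne_zero ha, ?_, fun z => rfl⟩, ?_, ?_⟩
    · rwa [Polynomial.natDegree_C_mul (inv_ne_zero ha)]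
    · intro z
      rw [hz]
      apply Prod.ext
      · simp; field_simp; ring
      · simp
    · intro z
      rw [hz]
      apply Prod.ext
      · simp; field_simp; ring
      · simp
  induction hh with
  | single h1 =>
    obtain ⟨k, h1, h2⟩ := single _ h1
    exact ⟨k, .single h1, h2⟩
  | cons h1 _ ih =>
    obtain ⟨k, hk, k1, k2⟩ := single _ h1
    obtain ⟨l, hl, l1, l2⟩ := ih
    refine ⟨l ∘ k, hl.comp (.single hk), ?_, ?_⟩
    · intro z
      rw [Function.comp_apply, Function.comp_apply]
      rw [k1, l1]
    · intro z
      rw [Function.comp_apply, Function.comp_apply]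
      rw [l2, k2]


def Lg (z : ℂ × ℂ) : ℝ := Real.log (max 1 ‖z.1‖)

theorem Lg_nonneg (z : ℂ × ℂ) : 0 ≤ Lg z := Real.log_nonneg (le_max_left _ _)

theorem Lg_cont : Continuous Lg := by
  unfold Lg
  refine Continuous.log (by fun_prop) fun z => ?_
  have : (1 : ℝ) ≤ max 1 ‖z.1‖ := le_max_left _ _
  linarith

theorem Lg_eq {z : ℂ × ℂ} (h : 1 ≤ ‖z.1‖) : Lg z = Real.log ‖z.1‖ := by
  rw [Lg, max_eq_right h]

theorem Lg_norm (z : ℂ × ℂ) : ‖z.1‖ ≤ Real.exp (Lg z) := by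
  rw [Lg, Real.exp_log (by positivity)]; exact le_max_right _ _

theorem Lg_le {z : ℂ × ℂ} {B : ℝ} (h : ‖z.1‖ ≤ B) (hB : 1 ≤ B) : Lg z ≤ Real.log B :=
  Real.log_le_log (by positivity) (max_le hB h)

def gterm (h : ℂ × ℂ → ℂ × ℂ) (d : ℕ) (n : ℕ) (z : ℂ × ℂ) : ℝ :=
  (Lg (h^[n + 1] z) - d * Lg (h^[n] z)) / (d : ℝ) ^ (n + 1)

def green (h : ℂ × ℂ → ℂ × ℂ) (d : ℕ) (z : ℂ × ℂ) : ℝ := Lg z + ∑' n, gterm h d n z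

theorem Om_self (R : ℝ) (z : ℂ × ℂ) : z ∈ Om (max R ‖z.2‖) :=
  (le_max_right R ‖z.2‖).trans (le_max_right _ _)

theorem Om_mono {M N : ℝ} (h : M ≤ N) : Om M ⊆ Om N := fun _ hz => hz.trans (max_le_max le_rfl h)

section
variable {h : ℂ × ℂ → ℂ × ℂ} {d : ℕ} {c : ℂ} {R C : ℝ}

theorem Good.om_iter (H : Good h d c R C) {M : ℝ} (hM : R ≤ M) (n : ℕ) {z : ℂ × ℂ} (hz : z ∈ Om M) :
    h^[n] z ∈ Om M := by
  induction n with
  | zero => exact hz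
  | succ n ih => rw [iterate_succ_apply']; exact H.om M hM _ ih

theorem Good.vp_iter (H : Good h d c R C) (n : ℕ) {z : ℂ × ℂ} (hz : z ∈ Vp R) :
    h^[n] z ∈ Vp R ∧ ‖z.1‖ ≤ ‖(h^[n] z).1‖ := by
  induction n with
  | zero => exact ⟨hz, le_rfl⟩
  | succ n ih =>
    rw [iterate_succ_apply']
    refine ⟨H.vp _ ih.1, ?_⟩
    have := H.grow _ ih.1
    have := norm_nonneg (h^[n] z).1
    linarith

theorem Good.bounds (H : Good h d c R C) {z : ℂ × ℂ} (hz : z ∈ Vp R) :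
    ‖c‖ / 2 * ‖z.1‖ ^ d ≤ ‖(h z).1‖ ∧ ‖(h z).1‖ ≤ 3 / 2 * ‖c‖ * ‖z.1‖ ^ d := by
  have h1 := H.asym z hz
  have h2 := H.up hz
  have h3 := norm_sub_norm_le (c * z.1 ^ d) (h z).1
  have h4 := norm_sub_norm_le (h z).1 (c * z.1 ^ d)
  rw [norm_sub_rev, norm_mul, norm_pow] at h3
  rw [norm_mul, norm_pow] at h4
  constructor <;> linarith

theorem Good.step (H : Good h d c R C) {M : ℝ} (hM : R ≤ M) :
    ∃ K, 0 ≤ K ∧ ∀ z ∈ Om M, |Lg (h z) - d * Lg z| ≤ K := by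
  have hcont : Continuous fun z => Lg (h z) - d * Lg z :=
    (Lg_cont.comp H.diff.continuous).sub (continuous_const.mul Lg_cont)
  obtain ⟨K, hK⟩ := ((isCompact_closedBall (0 : ℂ × ℂ) M).image hcont).isBounded.subset_closedBall 0
  have hcn : 0 < ‖c‖ := norm_pos_iff.2 H.c0
  refine ⟨max K (|Real.log (‖c‖ / 2)| + |Real.log (3 / 2 * ‖c‖)|), le_max_of_le_right (by positivity), ?_⟩
  intro z hz
  have hz' : ‖z.2‖ ≤ max ‖z.1‖ M := hz
  rcases le_total ‖z.1‖ M with h1 | h1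
  · apply le_max_of_le_left
    rw [max_eq_right h1] at hz'
    have : z ∈ Metric.closedBall (0 : ℂ × ℂ) M := by
      rw [mem_closedBall_zero_iff]; exact max_le h1 hz'
    simpa using hK (mem_image_of_mem _ this)
  · apply le_max_of_le_right
    rw [max_eq_left h1] at hz'
    have hv : z ∈ Vp R := ⟨hM.trans h1, hz'⟩
    have hx : 1 ≤ ‖z.1‖ := H.R1.trans hv.1
    have hx1 : 1 ≤ ‖(h z).1‖ := H.R1.trans (H.vp z hv).1
    have hb := H.bounds hv
    rw [Lg_eq hx, Lg_eq hx1]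
    have h2 := Real.log_le_log (by positivity) hb.1
    have h3 := Real.log_le_log (by positivity) hb.2
    rw [Real.log_mul (by positivity) (by positivity), Real.log_pow] at h2 h3
    have e1 := neg_abs_le (Real.log (‖c‖ / 2))
    have e2 := le_abs_self (Real.log (3 / 2 * ‖c‖))
    have e3 := abs_nonneg (Real.log (‖c‖ / 2))
    have e4 := abs_nonneg (Real.log (3 / 2 * ‖c‖))
    rw [abs_le]; constructor <;> linarith

theorem Good.dpos (H : Good h d c R C) : (2 : ℝ) ≤ d := by exact_mod_cast H.d2

theorem Good.dpow (H : Good h d c R C) (n : ℕ) : (2 : ℝ) * 2 ^ n ≤ (d : ℝ) ^ (n + 1) := by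
  rw [← pow_succ']; exact pow_le_pow_left₀ (by norm_num) H.dpos _

theorem Good.gterm_le (H : Good h d c R C) {M K : ℝ} (hM : R ≤ M) (hK : ∀ z ∈ Om M, |Lg (h z) - d * Lg z| ≤ K)
    (n : ℕ) {z : ℂ × ℂ} (hz : z ∈ Om M) : ‖gterm h d n z‖ ≤ K / 2 / 2 ^ n := by
  have h1 := hK _ (H.om_iter hM n hz)
  have hK0 : 0 ≤ K := (abs_nonneg _).trans h1
  rw [gterm, iterate_succ_apply', Real.norm_eq_abs, abs_div, abs_of_pos (a := (d : ℝ) ^ (n + 1))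
    (by have := H.dpos; positivity), div_div]
  have := H.dpow n
  gcongr

theorem Good.green_sub (H : Good h d c R C) {M : ℝ} (hM : R ≤ M) :
    ∃ K, 0 ≤ K ∧ ∀ z ∈ Om M, |green h d z - Lg z| ≤ K := by
  obtain ⟨K, hK0, hK⟩ := H.step hM
  refine ⟨K, hK0, fun z hz => ?_⟩
  rw [green, add_sub_cancel_left]
  exact tsum_of_norm_bounded (hasSum_geometric_two' K) fun n => H.gterm_le hM hK n hz

theorem Good.summ (H : Good h d c R C) (z : ℂ × ℂ) : Summable fun n => gterm h d n z := by
  obtain ⟨K, hK0, hK⟩ := H.step (le_max_left R ‖z.2‖)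
  exact Summable.of_norm_bounded (hasSum_geometric_two' K).summable
    fun n => H.gterm_le (le_max_left R ‖z.2‖) hK n (Om_self R z)

theorem Good.green_lim (H : Good h d c R C) (z : ℂ × ℂ) :
    Tendsto (fun n => Lg (h^[n] z) / (d : ℝ) ^ n) atTop (𝓝 (green h d z)) := by
  have hd := H.dpos
  have := (H.summ z).hasSum.tendsto_sum_nat.const_add (Lg z)
  refine this.congr fun n => ?_
  induction n with
  | zero => simp
  | succ n ih =>
    rw [Finset.sum_range_succ, ← add_assoc, ih, gterm]
    field_simp
    ring

theorem Good.green_nonneg (H : Good h d c R C) (z : ℂ × ℂ) : 0 ≤ green h d z :=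
  ge_of_tendsto' (H.green_lim z) fun n => div_nonneg (Lg_nonneg _) (by positivity)

theorem Good.green_h (H : Good h d c R C) (z : ℂ × ℂ) : green h d (h z) = d * green h d z := by
  have hd := H.dpos
  have h1 := ((tendsto_add_atTop_iff_nat 1).2 (H.green_lim z)).const_mul (d : ℝ)
  refine tendsto_nhds_unique (H.green_lim (h z)) (h1.congr fun n => ?_)
  rw [iterate_succ_apply]
  field_simp
  ring

theorem Good.green_iter (H : Good h d c R C) (n : ℕ) (z : ℂ × ℂ) :
    green h d (h^[n] z) = (d : ℝ) ^ n * green h d z := by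
  induction n with
  | zero => simp
  | succ n ih => rw [iterate_succ_apply', H.green_h, ih]; ring

theorem Good.iter_cont (H : Good h d c R C) (n : ℕ) : Continuous h^[n] := H.diff.continuous.iterate n

theorem Good.green_cont (H : Good h d c R C) : Continuous (green h d) := by
  rw [continuous_iff_continuousAt]
  intro z
  set M := max R (‖z.2‖ + 1)
  have hM : R ≤ M := le_max_left _ _
  obtain ⟨K, hK0, hK⟩ := H.step hM
  have hU : {w : ℂ × ℂ | ‖w.2‖ < M} ∈ 𝓝 z := by
    refine IsOpen.mem_nhds (isOpen_lt (by fun_prop) (by fun_prop)) ?_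
    exact lt_of_lt_of_le (by linarith) (le_max_right R (‖z.2‖ + 1))
  have : ContinuousOn (green h d) {w : ℂ × ℂ | ‖w.2‖ < M} := by
    refine Lg_cont.continuousOn.add (continuousOn_tsum (u := fun n => K / 2 / 2 ^ n) (fun n => ?_)
      (hasSum_geometric_two' K).summable fun n w hw => H.gterm_le hM hK n ?_)
    · refine Continuous.continuousOn ?_
      unfold gterm
      have := Lg_cont.comp (H.iter_cont (n + 1))
      have := Lg_cont.comp (H.iter_cont n)
      refine Continuous.div_const (Continuous.sub ‹_› (continuous_const.mul ‹_›)) _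
    · have hw : ‖w.2‖ < M := hw
      exact hw.le.trans (le_max_right _ _)
  exact this.continuousAt hU

/-- boundedness from Green function -/
theorem Good.green_bd (H : Good h d c R C) {M : ℝ} (hM : R ≤ M) (c' : ℝ) :
    ∃ B, 0 ≤ B ∧ ∀ z ∈ Om M, green h d z ≤ c' → ‖z‖ ≤ B := by
  obtain ⟨K, hK0, hK⟩ := H.green_sub hM
  refine ⟨max (Real.exp (c' + K)) M, le_max_of_le_left (by positivity), fun z hz hg => ?_⟩
  have h1 := abs_le.1 (hK z hz)
  have h2 : ‖z.1‖ ≤ Real.exp (c' + K) := (Lg_norm z).trans (Real.exp_le_exp.2 (by linarith))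
  exact max_le (le_max_of_le_left h2) (hz.trans (max_le_max h2 le_rfl))

theorem Good.kplus (H : Good h d c R C) (z : ℂ × ℂ) : z ∈ Kplus h ↔ green h d z = 0 := by
  have hd := H.dpos
  constructor
  · rintro ⟨B, hB⟩
    have h1 : ∀ n, Lg (h^[n] z) ≤ Real.log (max 1 B) := fun n =>
      Lg_le ((norm_fst_le _).trans ((hB n).trans (le_max_right _ _))) (le_max_left _ _)
    have h2 : Tendsto (fun n : ℕ => Real.log (max 1 B) / (d : ℝ) ^ n) atTop (𝓝 0) := by
      have := (tendsto_pow_atTop_atTop_of_one_lt (r := (d : ℝ)) (by linarith))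
      exact this.const_div_atTop _
    refine le_antisymm ?_ (H.green_nonneg z)
    exact le_of_tendsto_of_tendsto' (H.green_lim z) h2 fun n => by gcongr; exact h1 n
  · intro hz
    obtain ⟨B, hB0, hB⟩ := H.green_bd (le_max_left R ‖z.2‖) 0
    refine ⟨B, fun n => hB _ (H.om_iter (le_max_left R ‖z.2‖) n (Om_self R z)) ?_⟩
    rw [H.green_iter, hz, mul_zero]

def Bterm (h : ℂ × ℂ → ℂ × ℂ) (d : ℕ) (c : ℂ) (n : ℕ) (z : ℂ × ℂ) : ℂ :=
  Complex.log ((h^[n + 1] z).1 / (c * (h^[n] z).1 ^ d)) / (d : ℂ) ^ (n + 1)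

def Bser (h : ℂ × ℂ → ℂ × ℂ) (d : ℕ) (c : ℂ) (z : ℂ × ℂ) : ℂ := ∑' n, Bterm h d c n z

theorem Good.ratio (H : Good h d c R C) {z : ℂ × ℂ} (hz : z ∈ Vp R) (n : ℕ) :
    ‖(h^[n + 1] z).1 / (c * (h^[n] z).1 ^ d) - 1‖ ≤ C / ‖c‖ / ‖z.1‖ ∧
    ‖(h^[n + 1] z).1 / (c * (h^[n] z).1 ^ d) - 1‖ ≤ 1 / 2 := by
  obtain ⟨h1, h2⟩ := H.vp_iter n hz
  have h3 := H.asym _ h1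
  rw [iterate_succ_apply']
  set w := h^[n] z
  have hcn : 0 < ‖c‖ := norm_pos_iff.2 H.c0
  have hz1 : 0 < ‖z.1‖ := lt_of_lt_of_le (by linarith [H.R1]) hz.1
  have hw1 : 0 < ‖w.1‖ := by linarith
  have hw0 : w.1 ≠ 0 := norm_pos_iff.1 hw1
  have hc0 := H.c0
  have hC := H.C0
  have e : (h w).1 / (c * w.1 ^ d) - 1 = ((h w).1 - c * w.1 ^ d) / (c * w.1 ^ d) := by field_simp
  have h4 : ‖(h w).1 / (c * w.1 ^ d) - 1‖ ≤ C / ‖c‖ / ‖w.1‖ := by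
    rw [e, norm_div, norm_mul, norm_pow]
    have h5 : ‖w.1‖ ^ d = ‖w.1‖ * ‖w.1‖ ^ (d - 1) := by
      rw [← pow_succ', show d - 1 + 1 = d by have := H.d2; omega]
    rw [div_le_iff₀ (by positivity), h5]
    refine h3.trans (le_of_eq ?_)
    field_simp
  refine ⟨h4.trans (by gcongr), h4.trans ?_⟩
  rw [div_div, div_le_iff₀ (by positivity)]
  have := H.CR
  have : ‖c‖ * R ≤ ‖c‖ * ‖w.1‖ := by gcongr; exact h1.1
  linarith

theorem Good.bterm_le (H : Good h d c R C) {z : ℂ × ℂ} (hz : z ∈ Vp R) (n : ℕ) :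
    ‖Bterm h d c n z‖ ≤ (3 / 2 * (C / ‖c‖) / ‖z.1‖) / 2 / 2 ^ n := by
  obtain ⟨h1, h2⟩ := H.ratio hz n
  have h3 := Complex.norm_log_one_add_half_le_self h2
  rw [add_sub_cancel] at h3
  rw [Bterm, norm_div, norm_pow, Complex.norm_natCast, div_div _ (2 : ℝ)]
  have := H.dpow n
  have hC := H.C0
  gcongr
  refine h3.trans ?_
  rw [mul_div_assoc]
  gcongr

theorem Good.B_le (H : Good h d c R C) {z : ℂ × ℂ} (hz : z ∈ Vp R) :
    ‖Bser h d c z‖ ≤ 3 / 2 * (C / ‖c‖) / ‖z.1‖ :=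
  tsum_of_norm_bounded (hasSum_geometric_two' _) fun n => H.bterm_le hz n

theorem Good.green_eq (H : Good h d c R C) {z : ℂ × ℂ} (hz : z ∈ Vp R) :
    green h d z = Real.log ‖z.1‖ + Real.log ‖c‖ / (d - 1) + (Bser h d c z).re := by
  have hd := H.dpos
  have hx : 1 ≤ ‖z.1‖ := H.R1.trans hz.1
  have hcn : 0 < ‖c‖ := norm_pos_iff.2 H.c0
  have hs : Summable fun n => Bterm h d c n z :=
    Summable.of_norm_bounded (hasSum_geometric_two' _).summable fun n => H.bterm_le hz n
  have e1 : (Bser h d c z).re = ∑' n, (Bterm h d c n z).re := Complex.re_tsum hs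
  have hs' : Summable fun n => (Bterm h d c n z).re := (Complex.hasSum_re hs.hasSum).summable
  have hgeo : HasSum (fun n : ℕ => Real.log ‖c‖ / (d : ℝ) ^ (n + 1)) (Real.log ‖c‖ / (d - 1)) := by
    have h1 := (hasSum_geometric_of_lt_one (r := (d : ℝ)⁻¹) (by positivity)
      (inv_lt_one_of_one_lt₀ (by linarith))).mul_left (Real.log ‖c‖ / d)
    have e1 : (fun n : ℕ => Real.log ‖c‖ / (d : ℝ) ^ (n + 1)) =
        fun n : ℕ => Real.log ‖c‖ / d * (d : ℝ)⁻¹ ^ n := by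
      ext n; rw [pow_succ, inv_pow]; field_simp
    have e2 : Real.log ‖c‖ / ((d : ℝ) - 1) = Real.log ‖c‖ / d * (1 - (d : ℝ)⁻¹)⁻¹ := by
      have : (d : ℝ) - 1 ≠ 0 := by linarith
      field_simp
    rw [e1, e2]
    exact h1
  rw [green, Lg_eq hx, e1, add_assoc, ← hgeo.tsum_eq, ← hgeo.summable.tsum_add hs']
  congr 2
  ext n
  obtain ⟨h1, h2⟩ := H.vp_iter n hz
  obtain ⟨h3, h4⟩ := H.vp_iter (n + 1) hz
  have hw : 1 ≤ ‖(h^[n] z).1‖ := H.R1.trans h1.1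
  have hw' : 1 ≤ ‖(h^[n+1] z).1‖ := H.R1.trans h3.1
  rw [gterm, Bterm, Lg_eq hw, Lg_eq hw']
  have e2 : (Complex.log ((h^[n + 1] z).1 / (c * (h^[n] z).1 ^ d)) / (d : ℂ) ^ (n + 1)).re =
      Real.log ‖(h^[n + 1] z).1 / (c * (h^[n] z).1 ^ d)‖ / (d : ℝ) ^ (n + 1) := by
    rw [← Complex.log_re, ← Complex.ofReal_natCast, ← Complex.ofReal_pow, Complex.div_ofReal_re]
  rw [e2, norm_div, norm_mul, norm_pow, Real.log_div (by positivity) (by positivity),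
    Real.log_mul (by positivity) (by positivity), Real.log_pow]
  ring

theorem Good.iter_diff (H : Good h d c R C) (n : ℕ) : Differentiable ℂ h^[n] := H.diff.iterate n

theorem Good.B_diff (H : Good h d c R C) {U : Set ℂ} (hU : IsOpen U) {ψ : ℂ → ℂ × ℂ}
    (hψ : DifferentiableOn ℂ ψ U) (hm : ∀ z ∈ U, ψ z ∈ Vp R) :
    DifferentiableOn ℂ (fun z => Bser h d c (ψ z)) U := by
  have hC := H.C0
  have hR := H.R1
  unfold Bser
  refine Complex.differentiableOn_tsum_of_summable_norm
    (u := fun n => (3 / 2 * (C / ‖c‖) / R) / 2 / 2 ^ n) (hasSum_geometric_two' _).summable ?_ hU ?_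
  · intro n
    unfold Bterm
    refine DifferentiableOn.div_const ?_ _
    have h1 : DifferentiableOn ℂ (fun z => (h^[n] (ψ z)).1) U :=
      differentiable_fst.comp_differentiableOn ((H.iter_diff n).comp_differentiableOn hψ)
    have h2 : DifferentiableOn ℂ (fun z => (h^[n + 1] (ψ z)).1) U :=
      differentiable_fst.comp_differentiableOn ((H.iter_diff (n + 1)).comp_differentiableOn hψ)
    refine DifferentiableOn.clog (h2.div ((h1.pow d).const_mul c) ?_) ?_
    · intro z hz
      have := (H.vp_iter n (hm z hz)).1.1
      have h0 : (h^[n] (ψ z)).1 ≠ 0 := norm_pos_iff.1 (by linarith)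
      exact mul_ne_zero H.c0 (pow_ne_zero _ h0)
    · intro z hz
      have := (H.ratio (hm z hz) n).2
      left
      have h3 := (Complex.abs_re_le_norm _).trans this
      rw [Complex.sub_re, Complex.one_re, abs_le] at h3
      linarith
  · intro n z hz
    refine (H.bterm_le (hm z hz) n).trans ?_
    have := (hm z hz).1
    gcongr

theorem Good.green_harm (H : Good h d c R C) {U : Set ℂ} (hU : IsOpen U) {γ : ℂ → ℂ × ℂ}
    (hγ : DifferentiableOn ℂ γ U) {z : ℂ} (hz : z ∈ U) (hg : 0 < green h d (γ z)) :
    HA (fun w => green h d (γ w)) z := by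
  have hd := H.dpos
  set M := max R (‖(γ z).2‖ + 1) with hMdef
  have hM : R ≤ M := le_max_left _ _
  obtain ⟨K, hK0, hK⟩ := H.green_sub hM
  have hpow := (tendsto_pow_atTop_atTop_of_one_lt (r := (d : ℝ)) (by linarith)).atTop_mul_const hg
  obtain ⟨n, hn⟩ := (hpow.eventually_gt_atTop (K + Real.log (M + 1))).exists
  have hzM : γ z ∈ Om M := by
    have h1 : ‖(γ z).2‖ ≤ M := le_trans (by linarith) (le_max_right R (‖(γ z).2‖ + 1))
    exact h1.trans (le_max_right _ _)
  have hM1 : 1 ≤ M := H.R1.trans hM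
  have hbig : M < ‖(h^[n] (γ z)).1‖ := by
    by_contra hcon
    push Not at hcon
    have h1 := abs_le.1 (hK _ (H.om_iter hM n hzM))
    rw [H.green_iter] at h1
    have h2 := Lg_le (z := h^[n] (γ z)) (B := M + 1) (by linarith) (by linarith)
    linarith [h1.2]
  have hγc : ContinuousOn γ U := hγ.continuousOn
  have hnc : ContinuousOn (fun w => ‖(h^[n] (γ w)).1‖) U :=
    (continuous_fst.comp_continuousOn ((H.iter_cont n).comp_continuousOn hγc)).norm
  have hg2 : ContinuousOn (fun w => ‖(γ w).2‖) U := (continuous_snd.comp_continuousOn hγc).norm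
  have ev : ∀ᶠ w in 𝓝 z, w ∈ U ∧ M < ‖(h^[n] (γ w)).1‖ ∧ ‖(γ w).2‖ < M := by
    refine (hU.eventually_mem hz).and (((hnc.continuousAt (hU.mem_nhds hz)).eventually_const_lt hbig).and
      ((hg2.continuousAt (hU.mem_nhds hz)).eventually_lt_const ?_))
    exact lt_of_lt_of_le (by linarith) (le_max_right R (‖(γ z).2‖ + 1))
  obtain ⟨V, hVs, hVo, hzV⟩ := eventually_nhds_iff.1 ev
  have hVU : V ⊆ U := fun w hw => (hVs w hw).1
  have hψ : DifferentiableOn ℂ (fun w => h^[n] (γ w)) V :=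
    (H.iter_diff n).comp_differentiableOn (hγ.mono hVU)
  have hVp : ∀ w ∈ V, h^[n] (γ w) ∈ Vp R := by
    intro w hw
    obtain ⟨h1, h2, h3⟩ := hVs w hw
    have h4 := H.om_iter hM n (z := γ w) (h3.le.trans (le_max_right _ _))
    refine ⟨hM.trans h2.le, ?_⟩
    have h5 : ‖(h^[n] (γ w)).2‖ ≤ max _ M := h4
    rwa [max_eq_left h2.le] at h5
  have hB := H.B_diff hVo hψ hVp
  have hx : DifferentiableOn ℂ (fun w => (h^[n] (γ w)).1) V := differentiable_fst.comp_differentiableOn hψ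
  have hVn := hVo.mem_nhds hzV
  have h0 : (h^[n] (γ z)).1 ≠ 0 := norm_pos_iff.1 (by linarith)
  refine ((((HA_log_norm (hx.analyticAt hVn) h0).add (HA_const (Real.log ‖c‖ / (d - 1)) z)).add
    (HA_re (hB.analyticAt hVn))).const_mul (((d : ℝ) ^ n)⁻¹)).congr ?_
  filter_upwards [hVn] with w hw
  rw [← H.green_eq (hVp w hw), H.green_iter]
  field_simp

end


def Ex (c0 : ℝ) (ζ : ℂ) : ℂ := Complex.exp (-(Complex.I * c0 * ζ))

theorem Ex_norm (c0 : ℝ) (ζ : ℂ) : ‖Ex c0 ζ‖ = Real.exp (c0 * ζ.im) := by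
  rw [Ex, Complex.norm_exp]; congr 1; simp

theorem Ex_diff (c0 : ℝ) : Differentiable ℂ (Ex c0) := by unfold Ex; fun_prop

theorem Ex_surj {c0 : ℝ} (h : c0 ≠ 0) {v : ℂ} (hv : v ≠ 0) : ∃ ζ, Ex c0 ζ = v := by
  refine ⟨Complex.I * Complex.log v / c0, ?_⟩
  rw [Ex]
  have hc : (c0 : ℂ) ≠ 0 := by exact_mod_cast h
  have : -(Complex.I * c0 * (Complex.I * Complex.log v / c0)) = Complex.log v := by
    field_simp
    rw [Complex.I_sq]; ring
  rw [this, Complex.exp_log hv]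

theorem lemmaX {h : ℂ × ℂ → ℂ × ℂ} {d : ℕ} {c : ℂ} {R C : ℝ} (H : Good h d c R C) {M : ℝ} (hM : R ≤ M)
    {ψ : ℂ → ℂ × ℂ} (hψ : Differentiable ℂ ψ) (hO : ∀ ζ, ψ ζ ∈ Om M) {c0 : ℝ} (hc0 : 0 < c0)
    (hG : ∀ ζ, green h d (ψ ζ) = c0 * max ζ.im 0) :
    ∃ κ b : ℂ, κ ≠ 0 ∧ ∀ ζ, (ψ ζ).1 = κ * Ex c0 ζ + b := by
  obtain ⟨K, hK0, hK⟩ := H.green_sub hM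
  have hM1 : 1 ≤ M := H.R1.trans hM
  have hlM : 0 ≤ Real.log M := Real.log_nonneg hM1
  set Y : ℝ := (K + Real.log M + 1) / c0 with hY
  have hY0 : 0 < Y := by positivity
  have hbig : ∀ ζ : ℂ, Y < ζ.im → M < ‖(ψ ζ).1‖ := by
    intro ζ hζ
    by_contra hcon
    push Not at hcon
    have h1 := abs_le.1 (hK _ (hO ζ))
    have h2 := Lg_le (z := ψ ζ) hcon hM1
    have h3 : c0 * Y = K + Real.log M + 1 := by rw [hY]; field_simp
    rw [hG, max_eq_left (by linarith)] at h1
    have h4 : c0 * Y < c0 * ζ.im := by gcongr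
    linarith [h1.2]
  have hVp : ∀ ζ : ℂ, Y < ζ.im → ψ ζ ∈ Vp R := by
    intro ζ hζ
    have h1 := hbig ζ hζ
    have h2 : ‖(ψ ζ).2‖ ≤ max ‖(ψ ζ).1‖ M := hO ζ
    exact ⟨hM.trans h1.le, by rwa [max_eq_left h1.le] at h2⟩
  set U : Set ℂ := {ζ : ℂ | Y < ζ.im} with hU
  have hUo : IsOpen U := isOpen_lt continuous_const Complex.continuous_im
  have hUc : IsPreconnected U := (convex_halfSpace_im_gt Y).isPreconnected
  have hx : Differentiable ℂ fun ζ => (ψ ζ).1 := differentiable_fst.comp hψ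
  have hB := H.B_diff hUo hψ.differentiableOn hVp
  set F : ℂ → ℂ := fun ζ => (ψ ζ).1 * Complex.exp (Complex.I * c0 * ζ) * Complex.exp (Bser h d c (ψ ζ)) with hF
  have hFd : DifferentiableOn ℂ F U := by
    refine DifferentiableOn.mul (DifferentiableOn.mul hx.differentiableOn ?_) hB.cexp
    exact Differentiable.differentiableOn (by fun_prop)
  have hFn : ∀ ζ ∈ U, ‖F ζ‖ = Real.exp (-(Real.log ‖c‖ / (d - 1))) := by
    intro ζ hζ
    have hζ' : Y < ζ.im := hζ
    have h1 := H.green_eq (hVp ζ hζ)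
    rw [hG, max_eq_left (by linarith)] at h1
    have h2 : 0 < ‖(ψ ζ).1‖ := by linarith [hbig ζ hζ]
    rw [hF]
    simp only [norm_mul, Complex.norm_exp]
    rw [← Real.exp_log h2, Real.exp_log h2, ← Real.exp_log h2, ← Real.exp_add, ← Real.exp_add]
    congr 1
    have : (Complex.I * c0 * ζ).re = - (c0 * ζ.im) := by simp
    rw [this]
    linarith
  have hp0 : (⟨0, Y + 1⟩ : ℂ) ∈ U := by simp [hU]
  have hconst : ∀ ζ ∈ U, F ζ = F ⟨0, Y + 1⟩ := by
    intro ζ hζ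
    refine Complex.eqOn_of_isPreconnected_of_isMaxOn_norm hUc hUo hFd hp0 ?_ hζ
    intro w hw
    simp only [mem_setOf_eq, Function.comp_apply]
    rw [hFn w hw, hFn _ hp0]
  set κ := F ⟨0, Y + 1⟩ with hκ
  have hκ0 : κ ≠ 0 := by
    rw [← norm_pos_iff, hκ, hFn _ hp0]; positivity
  set K0 : ℝ := 3 / 2 * (C / ‖c‖) with hK0d
  have hK00 : 0 ≤ K0 := by have := H.C0; positivity
  have hdiff : Differentiable ℂ fun ζ => (ψ ζ).1 - κ * Ex c0 ζ := hx.sub ((Ex_diff c0).const_mul κ)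
  have hbd : ∀ ζ, ‖(ψ ζ).1 - κ * Ex c0 ζ‖ ≤
      max (K0 * Real.exp K0) (Real.exp (c0 * Y + K) + ‖κ‖ * Real.exp (c0 * Y)) := by
    intro ζ
    rcases lt_or_ge Y ζ.im with h1 | h1
    · apply le_max_of_le_left
      have h2 := hconst ζ h1
      have hx1 : 1 ≤ ‖(ψ ζ).1‖ := by linarith [hbig ζ h1]
      have hBl := H.B_le (hVp ζ h1)
      have e1 : κ * Ex c0 ζ = (ψ ζ).1 * Complex.exp (Bser h d c (ψ ζ)) := by
        rw [← h2, hF, Ex]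
        simp only
        rw [Complex.exp_neg]
        have := Complex.exp_ne_zero (Complex.I * c0 * ζ)
        field_simp
      have e2 := Complex.norm_exp_sub_sum_le_norm_mul_exp (Bser h d c (ψ ζ)) 1
      simp at e2
      have e3 : (ψ ζ).1 - κ * Ex c0 ζ = -((ψ ζ).1 * (Complex.exp (Bser h d c (ψ ζ)) - 1)) := by
        rw [e1]; ring
      have e4 : ‖Bser h d c (ψ ζ)‖ ≤ K0 := hBl.trans (div_le_self hK00 hx1)
      rw [e3, norm_neg, norm_mul]
      calc _ ≤ ‖(ψ ζ).1‖ * ((K0 / ‖(ψ ζ).1‖) * Real.exp K0) := by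
            gcongr
            exact e2.trans (by gcongr)
        _ = _ := by field_simp
    · apply le_max_of_le_right
      have h2 := abs_le.1 (hK _ (hO ζ))
      have h3 : c0 * max ζ.im 0 ≤ c0 * Y := by gcongr; exact max_le h1 hY0.le
      rw [hG] at h2
      refine (norm_sub_le _ _).trans ?_
      rw [norm_mul, Ex_norm]
      gcongr
      refine (Lg_norm _).trans (Real.exp_le_exp.2 ?_)
      linarith [h2.1]
  obtain ⟨b, hb⟩ := hdiff.exists_const_forall_eq_of_bounded
    ((isBounded_iff_forall_norm_le).2 ⟨_, by rintro _ ⟨ζ, rfl⟩; exact hbd ζ⟩)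
  exact ⟨κ, b, hκ0, fun ζ => by rw [← hb ζ]; ring⟩

theorem deg_le {P S : Polynomial ℂ} {M : ℝ} (h : ∀ v : ℂ, v ≠ 0 → ‖P.eval v‖ ≤ max ‖S.eval v‖ M) :
    P.natDegree ≤ S.natDegree := by
  by_contra hcon
  push Not at hcon
  have hn : 1 ≤ P.natDegree := by omega
  obtain ⟨K, hK0, hK⟩ := poly_asym P hn
  set n := P.natDegree with hnd
  have hlc : 0 < ‖P.leadingCoeff‖ := by
    rw [norm_pos_iff, Polynomial.leadingCoeff_ne_zero]; rintro rfl; simp at hnd; omega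
  set A : ℝ := ∑ i ∈ Finset.range (S.natDegree + 1), ‖S.coeff i‖ with hA
  have hA0 : 0 ≤ A := Finset.sum_nonneg fun _ _ => norm_nonneg _
  have hS : ∀ x : ℂ, 1 ≤ ‖x‖ → ‖S.eval x‖ ≤ A * ‖x‖ ^ (n - 1) := by
    intro x hx
    rw [Polynomial.eval_eq_sum_range, hA, Finset.sum_mul]
    refine (norm_sum_le _ _).trans (Finset.sum_le_sum fun i hi => ?_)
    rw [norm_mul, norm_pow]
    rw [Finset.mem_range] at hi
    exact mul_le_mul_of_nonneg_left (pow_le_pow_right₀ hx (by omega)) (norm_nonneg _)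
  set t : ℝ := 1 + (K + A + |M| + 1) / ‖P.leadingCoeff‖ with ht
  have ht1 : 1 ≤ t := by
    have : 0 ≤ (K + A + |M| + 1) / ‖P.leadingCoeff‖ := by positivity
    linarith
  have hxn : ‖(t : ℂ)‖ = t := by rw [Complex.norm_real, Real.norm_eq_abs, abs_of_nonneg (by linarith)]
  have hx0 : (t : ℂ) ≠ 0 := norm_pos_iff.1 (by rw [hxn]; linarith)
  have h1 := h t hx0
  have h2 := hK t (by rw [hxn]; exact ht1)
  have h3 := hS t (by rw [hxn]; exact ht1)
  rw [hxn] at h2 h3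
  have hp1 : 1 ≤ t ^ (n - 1) := one_le_pow₀ ht1
  have h4 : max ‖S.eval (t : ℂ)‖ M ≤ (A + |M|) * t ^ (n - 1) := by
    refine max_le (h3.trans (by gcongr; linarith [abs_nonneg M])) ?_
    have := le_abs_self M
    have := abs_nonneg M
    nlinarith
  have h5 := norm_sub_norm_le (P.leadingCoeff * (t : ℂ) ^ n) (P.eval (t : ℂ))
  rw [norm_sub_rev, norm_mul, norm_pow, hxn] at h5
  have h6 : t ^ n = t * t ^ (n - 1) := by rw [← pow_succ', show n - 1 + 1 = n by omega]
  have h7 : ‖P.leadingCoeff‖ * t = ‖P.leadingCoeff‖ + (K + A + |M| + 1) := by rw [ht]; field_simp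
  have h8 : ‖P.leadingCoeff‖ * t ^ n ≤ (K + A + |M|) * t ^ (n - 1) := by linarith
  rw [h6, ← mul_assoc, h7] at h8
  nlinarith

/-- elementary Hénon map -/
def hen (p : Polynomial ℂ) (a : ℂ) (z : ℂ × ℂ) : ℂ × ℂ := (p.eval z.1 - a * z.2, z.1)

/-- its inverse -/
def heninv (p : Polynomial ℂ) (a : ℂ) (z : ℂ × ℂ) : ℂ × ℂ := (z.2, (p.eval z.2 - z.1) / a)

theorem hen_isHenon {p : Polynomial ℂ} {a : ℂ} (ha : a ≠ 0) (hp : 2 ≤ p.natDegree) : IsHenon (hen p a) :=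
  ⟨p, a, ha, hp, fun _ => rfl⟩

theorem heninv_hen {p : Polynomial ℂ} {a : ℂ} (ha : a ≠ 0) (z : ℂ × ℂ) : heninv p a (hen p a z) = z := by
  rw [heninv, hen]
  apply Prod.ext
  · simp
  · simp [ha]

theorem IsHenon.eq_hen {h : ℂ × ℂ → ℂ × ℂ} (hh : IsHenon h) : ∃ p a, a ≠ 0 ∧ 2 ≤ p.natDegree ∧ h = hen p a := by
  obtain ⟨p, a, ha, hp, h⟩ := hh
  exact ⟨p, a, ha, hp, funext h⟩

theorem HComp.outer {h : ℂ × ℂ → ℂ × ℂ} (hh : HComp h) : ∃ p a, a ≠ 0 ∧ 2 ≤ p.natDegree ∧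
    ∃ R0 : ℝ, ∀ M, R0 ≤ M → ∀ z ∈ Om M, heninv p a (h z) ∈ Om M := by
  cases hh with
  | single h1 =>
    obtain ⟨p, a, ha, hp, rfl⟩ := h1.eq_hen
    exact ⟨p, a, ha, hp, 0, fun M _ z hz => by rwa [heninv_hen ha]⟩
  | cons h1 hg =>
    obtain ⟨p, a, ha, hp, rfl⟩ := h1.eq_hen
    obtain ⟨d, c, R, C, H⟩ := hg.good
    exact ⟨p, a, ha, hp, R, fun M hM z hz => by
      rw [Function.comp_apply, heninv_hen ha]; exact H.om M hM z hz⟩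

theorem HComp.inner0 {h : ℂ × ℂ → ℂ × ℂ} (hh : HComp h) : ∃ p a g, a ≠ 0 ∧ 2 ≤ p.natDegree ∧
    h = g ∘ hen p a ∧ (g = id ∨ HComp g) := by
  induction hh with
  | single h1 =>
    obtain ⟨p, a, ha, hp, rfl⟩ := h1.eq_hen
    exact ⟨p, a, id, ha, hp, rfl, .inl rfl⟩
  | cons h1 _ ih =>
    obtain ⟨p, a, g, ha, hp, rfl, hg⟩ := ih
    refine ⟨p, a, _ ∘ g, ha, hp, rfl, .inr ?_⟩
    rcases hg with rfl | hg
    · exact .single h1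
    · exact .cons h1 hg

theorem HComp.inner {h : ℂ × ℂ → ℂ × ℂ} (hh : HComp h) : ∃ d c R C, Good h d c R C ∧
    ∃ p a rot c' R' C' dk ck Rk Ck, a ≠ 0 ∧ 2 ≤ p.natDegree ∧ Good rot d c' R' C' ∧
      Good (hen p a) dk ck Rk Ck ∧ ∀ z, rot (hen p a z) = hen p a (h z) := by
  obtain ⟨p, a, g, ha, hp, rfl, hg⟩ := hh.inner0
  obtain ⟨dk, ck, Rk, Ck, Hk⟩ := (hen_isHenon ha hp).good
  rcases hg with rfl | hg
  · exact ⟨_, _, _, _, Hk, p, a, hen p a, _, _, _, _, _, _, _, ha, hp, Hk, Hk, fun z => rfl⟩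
  · obtain ⟨e, b, S, D, H⟩ := hg.good
    obtain ⟨R1, C1, H1⟩ := H.comp Hk
    obtain ⟨R2, C2, H2⟩ := Hk.comp H
    rw [mul_comm] at H2
    exact ⟨_, _, _, _, H1, p, a, hen p a ∘ g, _, _, _, _, _, _, _, ha, hp, H2, Hk, fun z => rfl⟩

theorem rot_green {h rot k : ℂ × ℂ → ℂ × ℂ} {d dk : ℕ} {c ck c' : ℂ} {R C Rk Ck R' C' : ℝ}
    (H : Good h d c R C) (Hr : Good rot d c' R' C') (Hk : Good k dk ck Rk Ck)
    (hr : ∀ z, rot (k z) = k (h z)) (z : ℂ × ℂ) : green rot d (k z) = dk * green h d z := by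
  have hd := H.dpos
  have hit : ∀ n, rot^[n] (k z) = k (h^[n] z) := by
    intro n
    induction n with
    | zero => rfl
    | succ n ih => rw [iterate_succ_apply', ih, hr, iterate_succ_apply']
  set M := max (max R Rk) ‖z.2‖
  have hMR : R ≤ M := (le_max_left _ _).trans (le_max_left _ _)
  have hMk : Rk ≤ M := (le_max_right _ _).trans (le_max_left _ _)
  have hz : z ∈ Om M := Om_self _ z
  obtain ⟨K, hK0, hK⟩ := Hk.step hMk
  have h1 := Hr.green_lim (k z)
  have h2 := (H.green_lim z).const_mul (dk : ℝ)
  have h3 : Tendsto (fun n : ℕ => K / (d : ℝ) ^ n) atTop (𝓝 0) :=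
    (tendsto_pow_atTop_atTop_of_one_lt (r := (d : ℝ)) (by linarith)).const_div_atTop _
  have h4 : Tendsto (fun n => Lg (rot^[n] (k z)) / (d : ℝ) ^ n - dk * (Lg (h^[n] z) / (d : ℝ) ^ n)) atTop (𝓝 0) := by
    refine squeeze_zero_norm (fun n => ?_) h3
    have e : Lg (rot^[n] (k z)) / (d : ℝ) ^ n - dk * (Lg (h^[n] z) / (d : ℝ) ^ n) =
      (Lg (k (h^[n] z)) - dk * Lg (h^[n] z)) / (d : ℝ) ^ n := by rw [hit]; ring
    rw [e, norm_div, norm_pow, Real.norm_eq_abs, Real.norm_eq_abs, abs_of_pos (a := (d : ℝ)) (by linarith)]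
    gcongr
    exact hK _ (H.om_iter hMR n hz)
  have := tendsto_nhds_unique h4 (h1.sub h2)
  linarith

theorem no_half {h rot : ℂ × ℂ → ℂ × ℂ} {d dk : ℕ} {c ck c' : ℂ} {R C Rk Ck R' C' : ℝ}
    {p p1 : Polynomial ℂ} {a a1 : ℂ} (ha : a ≠ 0) (ha1 : a1 ≠ 0) (hp1 : 2 ≤ p1.natDegree)
    (H : Good h d c R C) (Hr : Good rot d c' R' C') (Hk : Good (hen p a) dk ck Rk Ck)
    (hr : ∀ z, rot (hen p a z) = hen p a (h z))
    {M : ℝ} {ψ : ℂ → ℂ × ℂ} (hψ : Differentiable ℂ ψ) (hO : ∀ ζ, ψ ζ ∈ Om M)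
    (hO1 : ∀ ζ, heninv p1 a1 (ψ ζ) ∈ Om M) {c0 : ℝ} (hc0 : 0 < c0)
    (hG : ∀ ζ, green h d (ψ ζ) = c0 * max ζ.im 0) : False := by
  set M' := max M (max R (max Rk R')) with hM'
  have hMM : M ≤ M' := le_max_left _ _
  have hMR : R ≤ M' := (le_max_left _ _).trans (le_max_right _ _)
  have hMk : Rk ≤ M' := (le_max_left _ _).trans ((le_max_right _ _).trans (le_max_right _ _))
  have hMr : R' ≤ M' := (le_max_right _ _).trans ((le_max_right _ _).trans (le_max_right _ _))
  have hdk := Hk.dpos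
  obtain ⟨κ, b, hκ, hx⟩ := lemmaX H hMR hψ (fun ζ => Om_mono hMM (hO ζ)) hc0 hG
  obtain ⟨κ', b', hκ', hX⟩ := lemmaX Hr hMr (ψ := fun ζ => hen p a (ψ ζ)) (Hk.diff.comp hψ)
    (fun ζ => Hk.om M' hMk _ (Om_mono hMM (hO ζ))) (c0 := dk * c0) (by positivity)
    (fun ζ => by rw [rot_green H Hr Hk hr, hG]; ring)
  have hEx : ∀ ζ, Ex (dk * c0) ζ = Ex c0 ζ ^ dk := by
    intro ζ
    rw [Ex, Ex, ← Complex.exp_nat_mul]; congr 1; push_cast; ring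
  set X : Polynomial ℂ := Polynomial.C κ * Polynomial.X + Polynomial.C b with hXd
  set Q : Polynomial ℂ := Polynomial.C a⁻¹ * (p.comp X - (Polynomial.C κ' * Polynomial.X ^ dk + Polynomial.C b')) with hQ
  set W : Polynomial ℂ := Polynomial.C a1⁻¹ * (p1.comp Q - X) with hW
  have e1 : ∀ ζ, (ψ ζ).1 = X.eval (Ex c0 ζ) := by intro ζ; rw [hx, hXd]; simp
  have e2 : ∀ ζ, (ψ ζ).2 = Q.eval (Ex c0 ζ) := by
    intro ζ
    have h1 := hX ζ
    rw [hEx, hen] at h1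
    simp only at h1
    rw [hQ]
    simp only [Polynomial.eval_mul, Polynomial.eval_C, Polynomial.eval_sub, Polynomial.eval_comp,
      Polynomial.eval_add, Polynomial.eval_pow, Polynomial.eval_X]
    rw [← e1, ← h1]
    field_simp
    ring
  have e3 : ∀ ζ, (heninv p1 a1 (ψ ζ)).2 = W.eval (Ex c0 ζ) := by
    intro ζ
    rw [hW, heninv]
    simp only [Polynomial.eval_mul, Polynomial.eval_C, Polynomial.eval_sub, Polynomial.eval_comp]
    rw [← e1, ← e2]
    field_simp
  have d1 : Q.natDegree ≤ X.natDegree := deg_le (M := M) fun v hv => by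
    obtain ⟨ζ, rfl⟩ := Ex_surj hc0.ne' hv
    rw [← e1, ← e2]; exact hO ζ
  have d2 : W.natDegree ≤ Q.natDegree := deg_le (M := M) fun v hv => by
    obtain ⟨ζ, rfl⟩ := Ex_surj hc0.ne' hv
    rw [← e2, ← e3]; exact hO1 ζ
  have dX : X.natDegree = 1 := Polynomial.natDegree_linear hκ
  have dc : (p1.comp Q).natDegree = p1.natDegree * Q.natDegree := Polynomial.natDegree_comp
  have dW : W.natDegree = (p1.comp Q - X).natDegree := Polynomial.natDegree_C_mul (inv_ne_zero ha1)
  rcases Nat.eq_zero_or_pos Q.natDegree with h0 | h0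
  · rw [h0, mul_zero] at dc
    rw [Polynomial.natDegree_sub_eq_right_of_natDegree_lt (by omega)] at dW
    omega
  · have h1 : Q.natDegree = 1 := by omega
    rw [h1, mul_one] at dc
    rw [Polynomial.natDegree_sub_eq_left_of_natDegree_lt (by omega)] at dW
    omega


theorem HA.localmin {u : ℂ → ℝ} {z : ℂ} (h : HA u z) (hm : ∀ᶠ w in 𝓝 z, u z ≤ u w) :
    ∀ᶠ w in 𝓝 z, u w = u z := by
  obtain ⟨F, hF, he⟩ := h
  have hez := he.self_of_nhds
  have hd : ∀ᶠ w in 𝓝 z, DifferentiableAt ℂ (fun w => Complex.exp (-F w)) w := by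
    filter_upwards [hF.eventually_analyticAt] with w hw
    exact hw.differentiableAt.neg.cexp
  have hl : IsLocalMax (norm ∘ fun w => Complex.exp (-F w)) z := by
    filter_upwards [he, hm] with w hw hwK
    simp only [Function.comp_apply, Complex.norm_exp, Real.exp_le_exp, Complex.neg_re]
    rw [← hw, ← hez]; linarith
  have := Complex.norm_eventually_eq_of_isLocalMax hd hl
  filter_upwards [this, he] with w h1 h2
  simp only [Complex.norm_exp, Real.exp_eq_exp, Complex.neg_re] at h1
  rw [h2, hez]; linarith

/-- local normal form `a = a₀ + w^k` -/
theorem root_param {a : ℂ → ℂ} {z0 : ℂ} (ha : AnalyticAt ℂ a z0) (hn : ¬ ∀ᶠ z in 𝓝 z0, a z = a z0) :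
    ∃ k : ℕ, 1 ≤ k ∧ ∃ S : ℂ → ℂ, AnalyticAt ℂ S 0 ∧ S 0 = z0 ∧ ∀ᶠ w in 𝓝 0, a (S w) = a z0 + w ^ k := by
  have hb : AnalyticAt ℂ (fun z => a z - a z0) z0 := ha.sub analyticAt_const
  have hn' : ¬ ∀ᶠ z in 𝓝 z0, a z - a z0 = 0 := by simpa [sub_eq_zero] using hn
  obtain ⟨k, g, hg, hg0, hk⟩ := hb.exists_eventuallyEq_pow_smul_nonzero_iff.2 hn'
  have hk1 : 1 ≤ k := by
    by_contra h0
    have : k = 0 := by omega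
    have h1 := hk.self_of_nhds
    simp [this] at h1
    exact hg0 h1.symm
  obtain ⟨ρ, hρ⟩ := IsAlgClosed.exists_pow_nat_eq (g z0) hk1
  have hρ0 : ρ ≠ 0 := by rintro rfl; rw [zero_pow (by omega)] at hρ; exact hg0 hρ.symm
  have hlog : AnalyticAt ℂ (fun z => Complex.log (g z / g z0)) z0 := by
    refine (hg.div analyticAt_const hg0).clog ?_
    simp [hg0]
  set E : ℂ → ℂ := fun z => ρ * Complex.exp (Complex.log (g z / g z0) / k) with hE
  have hEa : AnalyticAt ℂ E z0 := analyticAt_const.mul ((hlog.div_const).cexp)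
  have hE0 : E z0 = ρ := by simp [hE, hg0]
  set σ : ℂ → ℂ := fun z => (z - z0) * E z with hσ
  have hid : AnalyticAt ℂ (fun z : ℂ => z - z0) z0 := analyticAt_id.sub analyticAt_const
  have hσa : AnalyticAt ℂ σ z0 := hid.mul hEa
  have hσ0 : σ z0 = 0 := by simp [hσ]
  have hσd : HasDerivAt σ ρ z0 := by
    have h1 : HasDerivAt (fun z : ℂ => z - z0) 1 z0 := (hasDerivAt_id z0).sub_const z0
    exact (h1.fun_mul hEa.differentiableAt.hasDerivAt).congr_deriv (by simp [hE0])
  have hσd' : deriv σ z0 ≠ 0 := by rw [hσd.deriv]; exact hρ0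
  have hpow : ∀ᶠ z in 𝓝 z0, a z = a z0 + σ z ^ k := by
    filter_upwards [hk, hg.continuousAt.eventually_ne hg0] with z h1 h2
    have h3 : E z ^ k = g z := by
      rw [hE]
      simp only
      rw [mul_pow, hρ, ← Complex.exp_nat_mul, mul_div_cancel₀ _ (by exact_mod_cast (by omega : k ≠ 0)),
        Complex.exp_log (div_ne_zero h2 hg0)]
      field_simp
    rw [hσ]
    simp only
    rw [mul_pow, h3]
    simp only [smul_eq_mul] at h1
    rw [← h1]; ring
  have hinv := hσa.analyticAt_localInverse hσd'
  set r := hσa.hasStrictDerivAt.localInverse _ _ _ hσd' with hr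
  have hr0 : r (σ z0) = z0 := HasStrictFDerivAt.localInverse_apply_image ..
  have hri : ∀ᶠ w in 𝓝 (σ z0), σ (r w) = w := HasStrictDerivAt.eventually_right_inverse ..
  rw [hσ0] at hinv hr0 hri
  refine ⟨k, hk1, r, hinv, hr0, ?_⟩
  have hc : ∀ᶠ w in 𝓝 0, a (r w) = a z0 + σ (r w) ^ k := by
    have := hinv.continuousAt
    rw [ContinuousAt, hr0] at this
    exact this.eventually hpow
  filter_upwards [hc, hri] with w h1 h2
  rw [h1, h2]

theorem disc_exists {a b : ℂ → ℂ} {z0 t0 : ℂ} (ha : AnalyticAt ℂ a z0) (hb : AnalyticAt ℂ b t0)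
    (hab : a z0 = b t0) : ∃ z t : ℂ → ℂ, AnalyticAt ℂ z 0 ∧ AnalyticAt ℂ t 0 ∧ z 0 = z0 ∧ t 0 = t0 ∧
      (∀ᶠ s in 𝓝 0, a (z s) = b (t s)) ∧ ¬ ∀ᶠ s in 𝓝 (0 : ℂ), z s = z0 ∧ t s = t0 := by
  have hne : ∀ P : ℂ → Prop, (∀ᶠ s in 𝓝 (0 : ℂ), P s) → (∀ s, P s → s = 0) → False := by
    intro P h1 h2
    have h3 : ∀ᶠ s in 𝓝[≠] (0 : ℂ), P s := h1.filter_mono nhdsWithin_le_nhds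
    obtain ⟨s, hs, hs0⟩ := (h3.and self_mem_nhdsWithin).exists
    exact hs0 (h2 s hs)
  have hlin : ∀ w : ℂ, AnalyticAt ℂ (fun s : ℂ => w + s) 0 := fun w => analyticAt_const.add analyticAt_id
  have htl : ∀ w : ℂ, Tendsto (fun s : ℂ => w + s) (𝓝 0) (𝓝 w) := by
    intro w
    have := (hlin w).continuousAt
    rw [ContinuousAt, add_zero] at this
    exact this
  by_cases h1 : ∀ᶠ z in 𝓝 z0, a z = a z0
  · refine ⟨fun s => z0 + s, fun _ => t0, hlin z0, analyticAt_const, by simp, rfl, ?_, ?_⟩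
    · filter_upwards [(htl z0).eventually h1] with s hs
      rw [hs, hab]
    · intro h
      exact hne _ h fun s hs => by simpa using hs.1
  by_cases h2 : ∀ᶠ z in 𝓝 t0, b z = b t0
  · refine ⟨fun _ => z0, fun s => t0 + s, analyticAt_const, hlin t0, rfl, by simp, ?_, ?_⟩
    · filter_upwards [(htl t0).eventually h2] with s hs
      rw [hs, hab]
    · intro h
      exact hne _ h fun s hs => by simpa using hs.2
  obtain ⟨k, hk, S, hS, hS0, hSe⟩ := root_param ha h1
  obtain ⟨l, hl, T, hT, hT0, hTe⟩ := root_param hb h2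
  have hp : ∀ n, 1 ≤ n → AnalyticAt ℂ (fun s : ℂ => s ^ n) 0 := fun n _ => analyticAt_id.pow n
  have ht : ∀ n, 1 ≤ n → Tendsto (fun s : ℂ => s ^ n) (𝓝 0) (𝓝 0) := by
    intro n hn
    have := (hp n hn).continuousAt
    rwa [ContinuousAt, zero_pow (by omega)] at this
  have e1 := (ht l hl).eventually hSe
  have e2 := (ht k hk).eventually hTe
  refine ⟨fun s => S (s ^ l), fun s => T (s ^ k), ?_, ?_, ?_, ?_, ?_, ?_⟩
  · exact AnalyticAt.comp' (by rwa [zero_pow (by omega)]) (hp l hl)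
  · exact AnalyticAt.comp' (by rwa [zero_pow (by omega)]) (hp k hk)
  · simp only; rw [zero_pow (by omega), hS0]
  · simp only; rw [zero_pow (by omega), hT0]
  · filter_upwards [e1, e2] with s h3 h4
    rw [h3, h4, hab, ← pow_mul, ← pow_mul, mul_comm]
  · intro h
    refine hne _ (h.and e1) ?_
    rintro s ⟨⟨h3, _⟩, h4⟩
    have h3 : S (s ^ l) = z0 := h3
    rw [h3] at h4
    have : (s ^ l) ^ k = 0 := by simpa using h4.symm
    exact pow_eq_zero_iff (by omega : l ≠ 0) |>.1 (pow_eq_zero_iff (by omega : k ≠ 0) |>.1 this)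

theorem normSq_expand (z w : ℂ) : ‖z‖ ^ 2 = ‖w‖ ^ 2 + ‖z - w‖ ^ 2 + 2 * ((starRingEnd ℂ w) * (z - w)).re := by
  rw [← Complex.normSq_eq_norm_sq, ← Complex.normSq_eq_norm_sq, ← Complex.normSq_eq_norm_sq]
  simp [Complex.normSq_apply]; ring

theorem min_principle {X Y : ℂ → ℂ × ℂ} {A B : ℂ → ℂ} {r₁ r₂ m : ℝ}
    (hX : ∀ z ∈ Metric.closedBall (0 : ℂ) r₁, AnalyticAt ℂ X z)
    (hA : ∀ z ∈ Metric.closedBall (0 : ℂ) r₁, AnalyticAt ℂ A z)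
    (hY : ∀ z ∈ Metric.closedBall (0 : ℂ) r₂, AnalyticAt ℂ Y z)
    (hB : ∀ z ∈ Metric.closedBall (0 : ℂ) r₂, AnalyticAt ℂ B z)
    (hne : ∀ z ∈ Metric.closedBall (0 : ℂ) r₁, ∀ t ∈ Metric.closedBall (0 : ℂ) r₂, X z ≠ Y t)
    (hbd : ∀ z ∈ Metric.closedBall (0 : ℂ) r₁, ∀ t ∈ Metric.closedBall (0 : ℂ) r₂, ‖z‖ = r₁ ∨ ‖t‖ = r₂ →
      m ≤ Real.log ‖X z - Y t‖ - (A z).re - (B t).re) :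
    ∀ z ∈ Metric.closedBall (0 : ℂ) r₁, ∀ t ∈ Metric.closedBall (0 : ℂ) r₂,
      m ≤ Real.log ‖X z - Y t‖ - (A z).re - (B t).re := by
  by_contra! hcon
  obtain ⟨z1, hz1, t1, ht1, hlt⟩ := hcon
  set D := Metric.closedBall (0 : ℂ) r₁ ×ˢ Metric.closedBall (0 : ℂ) r₂ with hD
  have hDc : IsCompact D := (isCompact_closedBall _ _).prod (isCompact_closedBall _ _)
  set Φ : ℂ × ℂ → ℝ := fun q => Real.log ‖X q.1 - Y q.2‖ - (A q.1).re - (B q.2).re with hΦ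
  have c1 : ∀ {F : ℂ → ℂ × ℂ} {r : ℝ}, (∀ z ∈ Metric.closedBall (0 : ℂ) r, AnalyticAt ℂ F z) →
    ContinuousOn F (Metric.closedBall (0 : ℂ) r) := fun h z hz => (h z hz).continuousAt.continuousWithinAt
  have c2 : ∀ {F : ℂ → ℂ} {r : ℝ}, (∀ z ∈ Metric.closedBall (0 : ℂ) r, AnalyticAt ℂ F z) →
    ContinuousOn F (Metric.closedBall (0 : ℂ) r) := fun h z hz => (h z hz).continuousAt.continuousWithinAt
  have hΦc : ContinuousOn Φ D := by
    have m1 : MapsTo Prod.fst D (Metric.closedBall (0 : ℂ) r₁) := fun q hq => hq.1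
    have m2 : MapsTo Prod.snd D (Metric.closedBall (0 : ℂ) r₂) := fun q hq => hq.2
    have k1 := (c1 hX).comp continuousOn_fst m1
    have k2 := (c1 hY).comp continuousOn_snd m2
    have k3 := Complex.continuous_re.comp_continuousOn ((c2 hA).comp continuousOn_fst m1)
    have k4 := Complex.continuous_re.comp_continuousOn ((c2 hB).comp continuousOn_snd m2)
    refine ((ContinuousOn.log (k1.sub k2).norm ?_).sub k3).sub k4
    intro q hq
    exact norm_ne_zero_iff.2 (sub_ne_zero.2 (hne _ hq.1 _ hq.2))
  set ε : ℝ := (m - Φ (z1, t1)) / (2 * (r₁ ^ 2 + r₂ ^ 2 + 1)) with hε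
  have hgap : 0 < m - Φ (z1, t1) := by rw [hΦ]; simp only; linarith
  have hε0 : 0 < ε := by positivity
  have hε1 : ε * (r₁ ^ 2 + r₂ ^ 2) < m - Φ (z1, t1) := by
    have : ε * (2 * (r₁ ^ 2 + r₂ ^ 2 + 1)) = m - Φ (z1, t1) := by rw [hε]; field_simp
    have h1 := mul_nonneg hε0.le (add_nonneg (sq_nonneg r₁) (sq_nonneg r₂))
    nlinarith
  obtain ⟨⟨z0, t0⟩, h0D, hmin⟩ := hDc.exists_isMinOn (f := fun q => Φ q - ε * (‖q.1‖ ^ 2 + ‖q.2‖ ^ 2))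
    ⟨(z1, t1), hz1, ht1⟩ (hΦc.sub (Continuous.continuousOn (by fun_prop)))
  have hmin' : ∀ z t, z ∈ Metric.closedBall (0 : ℂ) r₁ → t ∈ Metric.closedBall (0 : ℂ) r₂ →
      Φ (z0, t0) - ε * (‖z0‖ ^ 2 + ‖t0‖ ^ 2) ≤ Φ (z, t) - ε * (‖z‖ ^ 2 + ‖t‖ ^ 2) :=
    fun z t hz ht => hmin (show (z, t) ∈ D from ⟨hz, ht⟩)
  have hz0 : ‖z0‖ ≤ r₁ := mem_closedBall_zero_iff.1 h0D.1
  have ht0 : ‖t0‖ ≤ r₂ := mem_closedBall_zero_iff.1 h0D.2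
  have hintr : ¬ (‖z0‖ = r₁ ∨ ‖t0‖ = r₂) := by
    intro hb
    have h1 : m ≤ Φ (z0, t0) := hbd z0 h0D.1 t0 h0D.2 hb
    have h2 := hmin' z1 t1 hz1 ht1
    have h3 : ‖z0‖ ^ 2 ≤ r₁ ^ 2 := pow_le_pow_left₀ (norm_nonneg _) hz0 2
    have h4 : ‖t0‖ ^ 2 ≤ r₂ ^ 2 := pow_le_pow_left₀ (norm_nonneg _) ht0 2
    have h5 : ε * (‖z0‖ ^ 2 + ‖t0‖ ^ 2) ≤ ε * (r₁ ^ 2 + r₂ ^ 2) := by gcongr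
    have h6 : 0 ≤ ε * (‖z1‖ ^ 2 + ‖t1‖ ^ 2) := by positivity
    linarith
  push Not at hintr
  have hz0' : z0 ∈ Metric.ball (0 : ℂ) r₁ := mem_ball_zero_iff.2 (lt_of_le_of_ne hz0 hintr.1)
  have ht0' : t0 ∈ Metric.ball (0 : ℂ) r₂ := mem_ball_zero_iff.2 (lt_of_le_of_ne ht0 hintr.2)
  set e := X z0 - Y t0 with he
  have he0 : e ≠ 0 := sub_ne_zero.2 (hne _ h0D.1 _ h0D.2)
  have fa : ∀ {F : ℂ → ℂ × ℂ} {z : ℂ}, AnalyticAt ℂ F z → AnalyticAt ℂ (fun w => (F w).1) z :=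
    fun h => analyticAt_fst.comp h
  have sa : ∀ {F : ℂ → ℂ × ℂ} {z : ℂ}, AnalyticAt ℂ F z → AnalyticAt ℂ (fun w => (F w).2) z :=
    fun h => analyticAt_snd.comp h
  have hXa := hX z0 h0D.1
  have hYa := hY t0 h0D.2
  obtain ⟨z, t, hz, ht, hzz, htt, heq, hnc⟩ := disc_exists
    (a := fun w => e.1 * (X w).2 - e.2 * (X w).1) (b := fun w => e.1 * (Y w).2 - e.2 * (Y w).1)
    (z0 := z0) (t0 := t0)
    ((analyticAt_const.mul (sa hXa)).sub (analyticAt_const.mul (fa hXa)))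
    ((analyticAt_const.mul (sa hYa)).sub (analyticAt_const.mul (fa hYa))) (by
      have h1 : (X z0).1 = (Y t0).1 + e.1 := by rw [he]; simp
      have h2 : (X z0).2 = (Y t0).2 + e.2 := by rw [he]; simp
      rw [h1, h2]; ring)
  have hXz : AnalyticAt ℂ (fun s => X (z s)) 0 := AnalyticAt.comp' (by rwa [hzz]) hz
  have hYt : AnalyticAt ℂ (fun s => Y (t s)) 0 := AnalyticAt.comp' (by rwa [htt]) ht
  have hAz : AnalyticAt ℂ (fun s => A (z s)) 0 := AnalyticAt.comp' (by rw [hzz]; exact hA z0 h0D.1) hz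
  have hBt : AnalyticAt ℂ (fun s => B (t s)) 0 := AnalyticAt.comp' (by rw [htt]; exact hB t0 h0D.2) ht
  obtain ⟨φ, hφ, hφe, hφ1⟩ : ∃ φ : ℂ → ℂ, AnalyticAt ℂ φ 0 ∧
      (∀ᶠ s in 𝓝 0, X (z s) - Y (t s) = φ s • e) ∧ φ 0 = 1 := by
    by_cases h1 : e.1 = 0
    · have h2 : e.2 ≠ 0 := fun h => he0 (Prod.ext h1 h)
      refine ⟨fun s => ((X (z s)).2 - (Y (t s)).2) / e.2, ((sa hXz).sub (sa hYt)).div_const, ?_, ?_⟩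
      · filter_upwards [heq] with s hs
        rw [h1] at hs
        have h3 : (X (z s)).1 = (Y (t s)).1 := by
          apply mul_left_cancel₀ h2
          linear_combination -hs
        apply Prod.ext
        · simp [h1, h3]
        · simp; field_simp
      · simp only
        rw [hzz, htt, div_eq_one_iff_eq h2, he, Prod.snd_sub]
    · refine ⟨fun s => ((X (z s)).1 - (Y (t s)).1) / e.1, ((fa hXz).sub (fa hYt)).div_const, ?_, ?_⟩
      · filter_upwards [heq] with s hs
        apply Prod.ext
        · simp; field_simp
        · simp; field_simp
          linear_combination hs
      · simp only
        rw [hzz, htt, div_eq_one_iff_eq h1, he, Prod.fst_sub]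
  have hφ0 : φ 0 ≠ 0 := by rw [hφ1]; exact one_ne_zero
  set u : ℂ → ℝ := fun s => Real.log ‖φ s‖ + Real.log ‖e‖ - (A (z s)).re - (B (t s)).re
    - 2 * ε * ((starRingEnd ℂ z0) * (z s - z0) + (starRingEnd ℂ t0) * (t s - t0)).re with hu
  have huH : HA u 0 := by
    refine ((((HA_log_norm hφ hφ0).add (HA_const _ _)).sub (HA_re hAz)).sub (HA_re hBt)).sub
      (HA.const_mul (HA_re ?_) _)
    exact (analyticAt_const.mul (hz.sub analyticAt_const)).add (analyticAt_const.mul (ht.sub analyticAt_const))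
  have hev : ∀ᶠ s in 𝓝 (0 : ℂ), ε * (‖z s - z0‖ ^ 2 + ‖t s - t0‖ ^ 2) ≤ u s - u 0 := by
    have m1 : ∀ᶠ s in 𝓝 (0 : ℂ), z s ∈ Metric.ball (0 : ℂ) r₁ :=
      hz.continuousAt.eventually_mem (Metric.isOpen_ball.mem_nhds (by rwa [hzz]))
    have m2 : ∀ᶠ s in 𝓝 (0 : ℂ), t s ∈ Metric.ball (0 : ℂ) r₂ :=
      ht.continuousAt.eventually_mem (Metric.isOpen_ball.mem_nhds (by rwa [htt]))
    filter_upwards [m1, m2, hφe, hφ.continuousAt.eventually_ne hφ0] with s h1 h2 h3 h4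
    have h5 := hmin' (z s) (t s) (Metric.ball_subset_closedBall h1) (Metric.ball_subset_closedBall h2)
    have h6 : Φ (z s, t s) = Real.log ‖φ s‖ + Real.log ‖e‖ - (A (z s)).re - (B (t s)).re := by
      rw [hΦ]; simp only
      rw [h3, norm_smul, Real.log_mul (norm_ne_zero_iff.2 h4) (norm_ne_zero_iff.2 he0)]
    have h7 : Φ (z0, t0) = u 0 := by
      rw [hΦ, hu]; simp only
      rw [hφ1, hzz, htt, ← he]; simp
    rw [h6, h7, normSq_expand (z s) z0, normSq_expand (t s) t0] at h5
    rw [hu] at h5 ⊢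
    simp only [Complex.add_re] at h5 ⊢
    linarith
  have hmn : ∀ᶠ s in 𝓝 (0 : ℂ), u 0 ≤ u s := by
    filter_upwards [hev] with s hs
    have : 0 ≤ ε * (‖z s - z0‖ ^ 2 + ‖t s - t0‖ ^ 2) := by positivity
    linarith
  apply hnc
  filter_upwards [huH.localmin hmn, hev] with s h1 h2
  rw [h1, sub_self] at h2
  have h3 := sq_nonneg ‖z s - z0‖
  have h4 := sq_nonneg ‖t s - t0‖
  have h5 : ‖z s - z0‖ ^ 2 + ‖t s - t0‖ ^ 2 ≤ 0 := by
    by_contra hh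
    push Not at hh
    have := mul_pos hε0 hh
    linarith
  have h6 : ‖z s - z0‖ ^ 2 = 0 := by linarith
  have h7 : ‖t s - t0‖ ^ 2 = 0 := by linarith
  rw [sq_eq_zero_iff, norm_eq_zero, sub_eq_zero] at h6 h7
  exact ⟨h6, h7⟩


theorem HComp.inv_good {h : ℂ × ℂ → ℂ × ℂ} (hh : HComp h) : ∃ k d c R C c' R' C', Good h d c R C ∧
    Good k d c' R' C' ∧
    (∀ z, (k (h z).swap) = z.swap) ∧ (∀ z, h ((k z).swap) = z.swap) := by
  have single : ∀ h, IsHenon h → ∃ k d c R C c' R' C', Good h d c R C ∧ Good k d c' R' C' ∧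
    (∀ z, (k (h z).swap) = z.swap) ∧ (∀ z, h ((k z).swap) = z.swap) := by
    rintro h ⟨p, a, ha, hp, hz⟩
    have hdeg : (Polynomial.C a⁻¹ * p).natDegree = p.natDegree := by
      rw [Polynomial.natDegree_C_mul (inv_ne_zero ha)]
    obtain ⟨c, R, C, H⟩ := henon_good hp hz
    obtain ⟨c', R', C', H'⟩ := henon_good (p := Polynomial.C a⁻¹ * p) (a := a⁻¹) (by rwa [hdeg]) (fun z => rfl)
    rw [hdeg] at H'
    refine ⟨_, _, _, _, _, _, _, _, H, H', ?_, ?_⟩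
    · intro z
      rw [hz]
      apply Prod.ext
      · simp; field_simp; ring
      · simp
    · intro z
      rw [hz]
      apply Prod.ext
      · simp; field_simp; ring
      · simp
  induction hh with
  | single h1 => exact single _ h1
  | cons h1 _ ih =>
    obtain ⟨k, d, c, R, C, c', R', C', H, H', k1, k2⟩ := single _ h1
    obtain ⟨l, e, b, S, D, b', S', D', L, L', l1, l2⟩ := ih
    obtain ⟨_, _, A⟩ := H.comp L
    obtain ⟨_, _, B⟩ := L'.comp H'
    rw [mul_comm] at B
    refine ⟨l ∘ k, _, _, _, _, _, _, _, A, B, ?_, ?_⟩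
    · intro z
      rw [Function.comp_apply, Function.comp_apply]
      rw [k1, l1]
    · intro z
      rw [Function.comp_apply, Function.comp_apply]
      rw [l2, k2]

theorem Good.d_le {h : ℂ × ℂ → ℂ × ℂ} {d d' : ℕ} {c c' : ℂ} {R C R' C' : ℝ} (H : Good h d c R C)
    (H' : Good h d' c' R' C') : d ≤ d' := by
  by_contra! hlt
  set r : ℝ := max R R' with hr
  have hz : ((r : ℂ), (0 : ℂ)) ∈ Vp r := by
    have : 1 ≤ r := H.R1.trans (le_max_left _ _)
    constructor
    · simp [le_abs_self]
    · simp
  have H := H.mono (le_max_left R R')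
  have hpos : 0 < green h d (r, 0) := by
    refine lt_of_le_of_ne (H.green_nonneg _) fun h0 => ?_
    obtain ⟨B, hB⟩ := (H.kplus _).2 h0.symm
    have h2 : ∀ n : ℕ, (2 : ℝ) ^ n ≤ ‖(h^[n] ((r : ℂ), (0 : ℂ))).1‖ := by
      intro n
      induction n with
      | zero => simp; exact H.R1.trans (le_abs_self _)
      | succ n ih =>
        rw [iterate_succ_apply']
        have := H.grow _ (H.vp_iter n hz).1
        rw [pow_succ]; linarith
    obtain ⟨n, hn⟩ := pow_unbounded_of_one_lt B (one_lt_two (α := ℝ))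
    have := (norm_fst_le _).trans (hB n)
    have := h2 n
    linarith
  have hd := H'.dpos
  have t1 := H'.green_lim (r, 0)
  have t2 : Tendsto (fun n : ℕ => ((d' : ℝ) / d) ^ n) atTop (𝓝 0) := by
    apply tendsto_pow_atTop_nhds_zero_of_lt_one (by positivity)
    rw [div_lt_one (by have := H.dpos; linarith)]
    exact_mod_cast hlt
  have t3 := t1.mul t2
  rw [mul_zero] at t3
  have := tendsto_nhds_unique (H.green_lim (r, 0)) (t3.congr fun n => by
    have := H.dpos
    rw [div_pow]; field_simp)
  linarith

theorem Good.d_unique {h : ℂ × ℂ → ℂ × ℂ} {d d' : ℕ} {c c' : ℂ} {R C R' C' : ℝ} (H : Good h d c R C)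
    (H' : Good h d' c' R' C') : d = d' := le_antisymm (H.d_le H') (H'.d_le H)

theorem exp_low {K L : ℝ} (hL : 0 ≤ L) : ∃ S0 : ℝ, ∀ s, S0 ≤ s → ∀ A B : ℝ, 0 ≤ B →
    Real.exp (s - K) ≤ A → B ^ 2 ≤ L * Real.exp s → Real.exp (s - K) / 2 ≤ A - B := by
  refine ⟨Real.log (4 * (L + 1) * Real.exp (2 * K)), fun s hs A B hB hA hBs => ?_⟩
  have h1 : 4 * (L + 1) * Real.exp (2 * K) ≤ Real.exp s := by
    rw [← Real.log_le_iff_le_exp (by positivity)]; exact hs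
  have h2 : B ≤ Real.exp (s - K) / 2 := by
    apply le_of_sq_le_sq _ (by positivity)
    have e : (Real.exp (s - K) / 2) ^ 2 * (4 * Real.exp (2 * K)) = Real.exp s * Real.exp s := by
      rw [div_pow, ← Real.exp_nat_mul]
      have : Real.exp ((2 : ℕ) * (s - K)) = Real.exp s * Real.exp s / Real.exp (2 * K) := by
        rw [← Real.exp_add, ← Real.exp_sub]; congr 1; push_cast; ring
      rw [this]; field_simp; norm_num
    have hp : 0 < 4 * Real.exp (2 * K) := by positivity
    refine le_of_mul_le_mul_right ?_ hp
    rw [e]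
    calc B ^ 2 * (4 * Real.exp (2 * K)) ≤ L * Real.exp s * (4 * Real.exp (2 * K)) := by gcongr
      _ = (4 * L * Real.exp (2 * K)) * Real.exp s := by ring
      _ ≤ (4 * (L + 1) * Real.exp (2 * K)) * Real.exp s := by gcongr; linarith
      _ ≤ _ := by gcongr
  linarith

/-- lower bound of the distance between a forward image and a backward image -/
theorem dist_low {h k : ℂ × ℂ → ℂ × ℂ} {d : ℕ} {c c' : ℂ} {R C R' C' M : ℝ} (H : Good h d c R C)
    (H' : Good k d c' R' C') (hM : R ≤ M) (hM' : R' ≤ M) : ∃ S0 C0 : ℝ, ∀ X0 ∈ Om M, ∀ Y0 ∈ Om M,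
      S0 ≤ max (green h d (h X0)) (green k d (k Y0)) →
      max (green h d (h X0)) (green k d (k Y0)) - C0 ≤ Real.log ‖h X0 - (k Y0).swap‖ := by
  obtain ⟨K1, hK1, g1⟩ := H.green_sub hM
  obtain ⟨K2, hK2, g2⟩ := H'.green_sub hM'
  obtain ⟨L1, hL1, p1⟩ := H.par M hM
  obtain ⟨L2, hL2, p2⟩ := H'.par M hM'
  set K := max K1 K2
  have hK1' : K1 ≤ K := le_max_left _ _
  have hK2' : K2 ≤ K := le_max_right _ _
  have hK0 : 0 ≤ K := hK1.trans hK1'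
  set L := max L1 L2
  have hL1' : L1 ≤ L := le_max_left _ _
  have hL2' : L2 ≤ L := le_max_right _ _
  have hL0 : 0 ≤ L := hL1.trans hL1'
  obtain ⟨S0, hS⟩ := exp_low (K := K) (L := 2 * L * Real.exp K) (by positivity)
  refine ⟨max S0 (K + 1), K + Real.log 2, ?_⟩
  intro X0 hX0 Y0 hY0 hs
  set X := h X0
  set Y := k Y0
  have a1 := abs_le.1 (g1 X (H.om M hM _ hX0))
  have a2 := abs_le.1 (g2 Y (H'.om M hM' _ hY0))
  have b1 := p1 X0 hX0
  have b2 := p2 Y0 hY0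
  set s := max (green h d X) (green k d Y) with hsd
  have hsK : K + 1 ≤ s := (le_max_right _ _).trans hs
  have hsS : S0 ≤ s := (le_max_left _ _).trans hs
  have big : ∀ Z : ℂ × ℂ, s - K ≤ Lg Z → Real.exp (s - K) ≤ ‖Z.1‖ := by
    intro Z hZ
    have : 1 ≤ ‖Z.1‖ := by
      by_contra! hlt
      have : Lg Z = 0 := by rw [Lg, max_eq_left hlt.le, Real.log_one]
      linarith
    rw [Lg_eq this] at hZ
    rwa [Real.le_log_iff_exp_le (by linarith)] at hZ
  have small : ∀ Z : ℂ × ℂ, ∀ l, l ≤ L → ‖Z.2‖ ^ 2 ≤ l * (1 + ‖Z.1‖) → Lg Z ≤ s + K → ‖Z.2‖ ^ 2 ≤ 2 * L * Real.exp K * Real.exp s := by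
    intro Z l hl h1 h2
    have h3 := (Lg_norm Z).trans (Real.exp_le_exp.2 h2)
    have h4 : 1 ≤ Real.exp (s + K) := Real.one_le_exp (by linarith)
    calc _ ≤ l * (1 + ‖Z.1‖) := h1
      _ ≤ L * (2 * Real.exp (s + K)) := by gcongr; linarith
      _ = _ := by rw [Real.exp_add]; ring
  have key : Real.exp (s - K) / 2 ≤ ‖X - Y.swap‖ := by
    rcases le_total (green k d Y) (green h d X) with hc | hc
    · have hse : s = green h d X := max_eq_left hc
      have h1 := big X (by linarith)
      have h2 := small Y L2 hL2' b2 (by linarith)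
      have h3 := hS s hsS _ _ (norm_nonneg Y.2) h1 h2
      have h4 := norm_fst_le (X - Y.swap)
      have h5 := norm_sub_norm_le X.1 Y.2
      simp only [Prod.fst_sub, Prod.fst_swap] at h4
      linarith
    · have hse : s = green k d Y := max_eq_right hc
      have h1 := big Y (by linarith)
      have h2 := small X L1 hL1' b1 (by linarith)
      have h3 := hS s hsS _ _ (norm_nonneg X.2) h1 h2
      have h4 := norm_snd_le (X - Y.swap)
      have h5 := norm_sub_norm_le Y.1 X.2
      rw [norm_sub_rev] at h5
      simp only [Prod.snd_sub, Prod.snd_swap] at h4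
      linarith
  have hpos : 0 < Real.exp (s - K) / 2 := by positivity
  have := Real.log_le_log hpos key
  rw [Real.log_div (by positivity) (by norm_num), Real.log_exp] at this
  linarith

theorem peak {g : ℂ → ℝ} {r : ℝ} {ζ₁ : ℂ} (hr : 0 < r) (hgc : ContinuousOn g (Metric.closedBall 0 r))
    (hg0 : ∀ z ∈ Metric.closedBall (0 : ℂ) r, 0 ≤ g z) (h0 : g 0 = 0)
    (hH : ∀ z ∈ Metric.ball (0 : ℂ) r, 0 < g z → HA g z) (hζ : ‖ζ₁‖ = r) (hp : 0 < g ζ₁) :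
    ∃ A : ℂ → ℂ, ∃ m : ℝ, ∃ zs ∈ Metric.closedBall (0 : ℂ) r, 0 < m ∧
      (∀ z ∈ Metric.closedBall (0 : ℂ) r, AnalyticAt ℂ A z) ∧ g zs = 0 ∧ (A zs).re = m ∧
      (∀ z ∈ Metric.closedBall (0 : ℂ) r, ‖z‖ = r → (A z).re ≤ g z) ∧
      (∀ z ∈ Metric.closedBall (0 : ℂ) r, (A z).re ≤ g z + m) := by
  have hζm : ζ₁ ∈ Metric.closedBall (0 : ℂ) r := by simp [hζ]
  have hev : ∀ᶠ z in 𝓝[Metric.closedBall 0 r] ζ₁, g ζ₁ / 2 < g z :=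
    (hgc ζ₁ hζm).eventually (lt_mem_nhds (by linarith))
  obtain ⟨κ, hκ, hκg⟩ := Metric.mem_nhdsWithin_iff.1 hev
  obtain ⟨η, hη0, hη⟩ : ∃ η : ℝ, 0 < η ∧ (2 * η * r + η ^ 2) * 2 ≤ (κ - η) ^ 2 ∧ η ≤ κ := by
    have hc : Tendsto (fun η : ℝ => (κ - η) ^ 2 - (2 * η * r + η ^ 2) * 2) (𝓝[>] 0) (𝓝 (κ ^ 2)) := by
      have : Continuous fun η : ℝ => (κ - η) ^ 2 - (2 * η * r + η ^ 2) * 2 := by fun_prop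
      have := this.tendsto 0
      simp only [sub_zero, mul_zero, zero_mul, add_zero, ne_eq, OfNat.ofNat_ne_zero, not_false_eq_true, zero_pow] at this
      exact this.mono_left nhdsWithin_le_nhds
    have e1 := hc.eventually (lt_mem_nhds (show (0 : ℝ) < κ ^ 2 by positivity))
    have e2 : ∀ᶠ η in 𝓝[>] (0 : ℝ), η ≤ κ := nhdsWithin_le_nhds (Iic_mem_nhds hκ)
    obtain ⟨η, ⟨h1, h2⟩, h3⟩ := ((e1.and e2).and self_mem_nhdsWithin).exists
    exact ⟨η, h3, by linarith, h2⟩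
  set ζ₀ : ℂ := (1 + η / r : ℝ) * ζ₁ with hζ₀
  have hn0 : ‖ζ₀‖ = r + η := by
    rw [hζ₀, norm_mul, hζ, Complex.norm_real, Real.norm_of_nonneg (by positivity)]; field_simp
  have hd0 : ‖ζ₀ - ζ₁‖ = η := by
    have : ζ₀ - ζ₁ = (η / r : ℝ) * ζ₁ := by rw [hζ₀]; push_cast; ring
    rw [this, norm_mul, hζ, Complex.norm_real, Real.norm_of_nonneg (by positivity)]; field_simp
  have hlow : ∀ z ∈ Metric.closedBall (0 : ℂ) r, η ≤ ‖ζ₀ - z‖ := by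
    intro z hz
    have h1 := norm_sub_norm_le ζ₀ z
    have h2 : ‖z‖ ≤ r := by simpa using hz
    linarith
  have hne : ∀ z ∈ Metric.closedBall (0 : ℂ) r, ζ₀ - z ≠ 0 := by
    intro z hz
    rw [← norm_pos_iff]
    exact lt_of_lt_of_le hη0 (hlow z hz)
  have hQ : ∀ z, ζ₀ - z ≠ 0 → ((ζ₀ + z) / (ζ₀ - z)).re = (‖ζ₀‖ ^ 2 - ‖z‖ ^ 2) / ‖ζ₀ - z‖ ^ 2 := by
    intro z hz
    rw [Complex.div_re, ← Complex.normSq_eq_norm_sq, ← Complex.normSq_eq_norm_sq, ← Complex.normSq_eq_norm_sq, ← add_div]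
    congr 1
    simp [Complex.normSq_apply]; ring
  set s : ℝ := g ζ₁ / 2 * η ^ 2 / (r + η) ^ 2 with hs
  have hs0 : 0 < s := by positivity
  set A : ℂ → ℂ := fun z => s * ((ζ₀ + z) / (ζ₀ - z) - 1 / 2) with hA
  have hAr : ∀ z, ζ₀ - z ≠ 0 → (A z).re = s * ((‖ζ₀‖ ^ 2 - ‖z‖ ^ 2) / ‖ζ₀ - z‖ ^ 2 - 1 / 2) := by
    intro z hz
    rw [hA]; simp only
    rw [Complex.re_ofReal_mul, Complex.sub_re, hQ z hz]
    norm_num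
  have hAa : ∀ z ∈ Metric.closedBall (0 : ℂ) r, AnalyticAt ℂ A z := by
    intro z hz
    exact analyticAt_const.mul (((analyticAt_const.add analyticAt_id).div (analyticAt_const.sub analyticAt_id) (hne z hz)).sub analyticAt_const)
  have hAc : ContinuousOn (fun z => (A z).re) (Metric.closedBall 0 r) := fun z hz =>
    (Complex.continuous_re.continuousAt.comp (hAa z hz).continuousAt).continuousWithinAt
  have hsph : ∀ z ∈ Metric.closedBall (0 : ℂ) r, ‖z‖ = r → (A z).re ≤ g z := by
    intro z hz hzr
    rw [hAr z (hne z hz), hn0, hzr]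
    have hl := hlow z hz
    have hpos : 0 < ‖ζ₀ - z‖ := lt_of_lt_of_le hη0 hl
    by_cases hzk : dist z ζ₁ < κ
    · have h1 : g ζ₁ / 2 < g z := hκg ⟨hzk, hz⟩
      have h2 : ((r + η) ^ 2 - r ^ 2) / ‖ζ₀ - z‖ ^ 2 ≤ (r + η) ^ 2 / η ^ 2 := by
        gcongr
        nlinarith
      have h3 : s * ((r + η) ^ 2 / η ^ 2) = g ζ₁ / 2 := by rw [hs]; field_simp
      have h4 := mul_le_mul_of_nonneg_left h2 hs0.le
      linarith
    · have h1 : κ - η ≤ ‖ζ₀ - z‖ := by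
        have h2 : ‖z - ζ₁‖ ≤ ‖ζ₀ - ζ₁‖ + ‖ζ₀ - z‖ := by
          have : z - ζ₁ = (ζ₀ - ζ₁) - (ζ₀ - z) := by ring
          rw [this]; exact norm_sub_le _ _
        rw [dist_eq_norm] at hzk
        linarith
      have h2 : (κ - η) ^ 2 ≤ ‖ζ₀ - z‖ ^ 2 := pow_le_pow_left₀ (by linarith) h1 2
      have h3 : ((r + η) ^ 2 - r ^ 2) / ‖ζ₀ - z‖ ^ 2 ≤ 1 / 2 := by
        rw [div_le_iff₀ (by positivity)]
        linarith
      have h4 : s * (((r + η) ^ 2 - r ^ 2) / ‖ζ₀ - z‖ ^ 2 - 1 / 2) ≤ 0 :=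
        mul_nonpos_of_nonneg_of_nonpos hs0.le (by linarith)
      exact h4.trans (hg0 z hz)
  have hZc : IsCompact (Metric.closedBall (0 : ℂ) r ∩ g ⁻¹' {0}) :=
    (isCompact_closedBall _ _).of_isClosed_subset
      (hgc.preimage_isClosed_of_isClosed Metric.isClosed_closedBall isClosed_singleton) inter_subset_left
  have h0m : (0 : ℂ) ∈ Metric.closedBall (0 : ℂ) r ∩ g ⁻¹' {0} := ⟨by simp [hr.le], h0⟩
  obtain ⟨zs, hzs, hmax⟩ := hZc.exists_isMaxOn ⟨0, h0m⟩ (hAc.mono inter_subset_left)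
  have hA0 : (A 0).re = s / 2 := by
    rw [hAr 0 (hne 0 h0m.1), sub_zero, hn0]
    have : (r + η) ^ 2 ≠ 0 := by positivity
    simp only [norm_zero]; field_simp; ring
  have hm := hmax h0m
  simp only [mem_setOf_eq] at hm
  refine ⟨A, (A zs).re, zs, hzs.1, by linarith, hAa, hzs.2, rfl, hsph, ?_⟩
  have hms : 0 < (A zs).re := by linarith
  have := maxP (isCompact_closedBall (0 : ℂ) r) (v := fun z => (A z).re - g z) (m := (A zs).re) (hAc.sub hgc) (by
    intro z hz
    by_cases hz0 : g z = 0
    · left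
      have := hmax (show z ∈ Metric.closedBall (0 : ℂ) r ∩ g ⁻¹' {0} from ⟨hz, hz0⟩)
      simp only [mem_setOf_eq] at this
      simp only [hz0]; linarith
    · by_cases hzr : ‖z‖ = r
      · left
        have := hsph z hz hzr
        linarith
      · right
        have hzb : z ∈ Metric.ball (0 : ℂ) r := by
          rw [mem_ball_zero_iff]
          exact lt_of_le_of_ne (by simpa using hz) hzr
        exact ⟨mem_of_superset (Metric.isOpen_ball.mem_nhds hzb) Metric.ball_subset_closedBall,
          (HA_re (hAa z hz)).sub (hH z hzb (lt_of_le_of_ne (hg0 z hz) (Ne.symm hz0)))⟩)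
  intro z hz
  have := this z hz
  linarith


theorem norm_swap' (z : ℂ × ℂ) : ‖z.swap‖ = ‖z‖ := by
  rw [Prod.norm_def, Prod.norm_def, max_comm]; rfl

theorem HComp.contDiff {h : ℂ × ℂ → ℂ × ℂ} (hh : HComp h) : ContDiff ℂ 1 h := by
  have single : ∀ h, IsHenon h → ContDiff ℂ 1 h := by
    rintro h ⟨p, a, -, -, hz⟩
    have : h = fun z => (Polynomial.eval z.1 p - a * z.2, z.1) := funext hz
    rw [this]
    have h1 : ContDiff ℂ 1 fun x => Polynomial.eval x p := by
      have := p.contDiff_aeval (𝕜 := ℂ) (R := ℂ) 1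
      simpa [Polynomial.aeval_def] using this
    exact ((h1.comp contDiff_fst).sub (contDiff_const.mul contDiff_snd)).prodMk contDiff_fst
  induction hh with
  | single h1 => exact single _ h1
  | cons h1 _ ih => exact (single _ h1).comp ih

theorem lin_exp_absurd {c C D : ℝ} (hc : 0 < c) : ∃ a : ℕ, C * (a + 2) + D < 2 ^ (a + 1) * c := by
  have h1 := tendsto_pow_const_div_const_pow_of_one_lt 1 (one_lt_two (α := ℝ))
  have h2 : Tendsto (fun n : ℕ => ((2 : ℝ) ^ n)⁻¹) atTop (𝓝 0) :=
    (tendsto_pow_atTop_atTop_of_one_lt (one_lt_two (α := ℝ))).inv_tendsto_atTop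
  have h3 := (h1.const_mul C).add (h2.const_mul (2 * C + D))
  simp only [mul_zero, add_zero, pow_one] at h3
  obtain ⟨n, hn⟩ := (h3.eventually (gt_mem_nhds hc)).exists
  refine ⟨n, ?_⟩
  have hp : (0 : ℝ) < 2 ^ n := by positivity
  have : C * (n / 2 ^ n) + (2 * C + D) * (2 ^ n)⁻¹ = (C * (n + 2) + D) / 2 ^ n := by field_simp; ring
  rw [this, div_lt_iff₀ hp] at hn
  rw [pow_succ]
  nlinarith

theorem hit0 {h k : ℂ × ℂ → ℂ × ℂ} {d : ℕ} {c c' : ℂ} {R C R' C' : ℝ} (H : Good h d c R C)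
    (H' : Good k d c' R' C') (hh : ContDiff ℂ 1 h) (i2 : ∀ z, h ((k z).swap) = z.swap) {p : ℂ × ℂ}
    (hp : green k d p.swap = 0) (hw : ∀ δ > 0, ∃ w ∈ Metric.ball p δ, 0 < green k d w.swap)
    {γ : ℂ → ℂ × ℂ} {ρ : ℝ} (hγ : DifferentiableOn ℂ γ (Metric.ball 0 ρ)) (h0 : green h d (γ 0) = 0)
    (hne : ∃ ζ ∈ Metric.ball (0 : ℂ) ρ, 0 < green h d (γ ζ)) {δ : ℝ} (hδ : 0 < δ) :
    ∃ m, ∃ z ∈ Metric.ball (0 : ℂ) ρ, h^[m] (γ z) ∈ Metric.ball p δ := by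
  by_contra! hno
  have hd2 := H.dpos
  obtain ⟨w, hwb, hwp⟩ := hw (δ / 2) (by positivity)
  obtain ⟨ζ₁, hζ, hgζ⟩ := hne
  set r := ‖ζ₁‖ with hr
  have hr0 : 0 < r := by
    rw [hr, norm_pos_iff]; rintro rfl; linarith
  have hrρ : r < ρ := by simpa using hζ
  have hsub : Metric.closedBall (0 : ℂ) r ⊆ Metric.ball 0 ρ := Metric.closedBall_subset_ball hrρ
  have hγa : ∀ z ∈ Metric.ball (0 : ℂ) ρ, AnalyticAt ℂ γ z := fun z hz =>
    hγ.analyticAt (Metric.isOpen_ball.mem_nhds hz)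
  have hγc : ContinuousOn γ (Metric.closedBall 0 r) := hγ.continuousOn.mono hsub
  set W : ℂ → ℂ × ℂ := fun t => p + t • (w - p) with hW
  have hWd : Differentiable ℂ W := by rw [hW]; fun_prop
  set Y0 : ℂ → ℂ × ℂ := fun t => (W t).swap with hY0
  have hswap : Differentiable ℂ (Prod.swap : ℂ × ℂ → ℂ × ℂ) := differentiable_snd.prodMk differentiable_fst
  have hY0d : Differentiable ℂ Y0 := hswap.comp hWd
  obtain ⟨A, m1, z1, hz1, hm1, hAa, hgz1, hAz1, hAs, hAb⟩ := peak (g := fun z => green h d (γ z)) (ζ₁ := ζ₁) hr0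
    (H.green_cont.comp_continuousOn hγc) (fun z _ => H.green_nonneg _) h0
    (fun z hz hg => H.green_harm Metric.isOpen_ball hγ (hsub (Metric.ball_subset_closedBall hz)) hg) rfl hgζ
  obtain ⟨B, m2, t1, ht1, hm2, hBa, hgt1, hBt1, hBs, hBb⟩ := peak (g := fun t => green k d (Y0 t)) (r := 1) (ζ₁ := 1)
    one_pos (H'.green_cont.comp hY0d.continuous).continuousOn (fun z _ => H'.green_nonneg _)
    (by simpa [hY0, hW] using hp)
    (fun z _ hg => H'.green_harm isOpen_univ hY0d.differentiableOn (mem_univ z) hg) (by simp)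
    (by simpa [hY0, hW] using hwp)
  obtain ⟨Bγ, hBγ⟩ := (isCompact_closedBall (0 : ℂ) r).exists_bound_of_continuousOn hγc
  obtain ⟨BY, hBY⟩ := (isCompact_closedBall (0 : ℂ) 1).exists_bound_of_continuousOn hY0d.continuous.continuousOn
  set M := max (max R R') (max Bγ BY) with hM
  have hMR : R ≤ M := (le_max_left _ _).trans (le_max_left _ _)
  have hMR' : R' ≤ M := (le_max_right _ _).trans (le_max_left _ _)
  have hOγ : ∀ z ∈ Metric.closedBall (0 : ℂ) r, γ z ∈ Om M := fun z hz =>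
    ((norm_snd_le _).trans ((hBγ z hz).trans ((le_max_left _ _).trans (le_max_right _ _)))).trans (le_max_right _ _)
  have hOY : ∀ z ∈ Metric.closedBall (0 : ℂ) 1, Y0 z ∈ Om M := fun z hz =>
    ((norm_snd_le _).trans ((hBY z hz).trans ((le_max_right _ _).trans (le_max_right _ _)))).trans (le_max_right _ _)
  obtain ⟨S0, C0, hlow⟩ := dist_low H H' hMR hMR'
  obtain ⟨BB, hBB0, hBB⟩ := H'.green_bd hMR' (max S0 0)
  obtain ⟨BX, hBX0, hBX⟩ := H.green_bd hMR 0
  obtain ⟨L0, hL0⟩ := (hh.restrict_scalars ℝ).contDiffOn.exists_lipschitzOnWith one_ne_zero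
    (convex_closedBall (0 : ℂ × ℂ) (BB + 1)) (isCompact_closedBall _ _)
  set L : ℝ := max L0 1 with hL
  have hL1 : 1 ≤ L := le_max_right _ _
  have hLip : ∀ x y : ℂ × ℂ, ‖x‖ ≤ BB + 1 → ‖y‖ ≤ BB + 1 → ‖h x - h y‖ ≤ L * ‖x - y‖ := by
    intro x y hx hy
    have := hL0.norm_sub_le (mem_closedBall_zero_iff.2 hx) (mem_closedBall_zero_iff.2 hy)
    exact this.trans (by gcongr; exact le_max_left _ _)
  have hback : ∀ (a : ℕ) (t : ℂ), h (k^[a + 1] (Y0 t)).swap = (k^[a] (Y0 t)).swap := by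
    intro a t
    rw [iterate_succ_apply', i2]
  have hback' : ∀ (j b : ℕ) (t : ℂ), h^[j] (k^[b + j] (Y0 t)).swap = (k^[b] (Y0 t)).swap := by
    intro j
    induction j with
    | zero => intro b t; rfl
    | succ j ih =>
      intro b t
      rw [iterate_succ_apply, ← add_assoc, hback, ih]
  have hWp : ∀ t ∈ Metric.closedBall (0 : ℂ) 1, ‖W t - p‖ < δ / 2 := by
    intro t ht
    rw [hW]; simp only [add_sub_cancel_left]
    rw [norm_smul]
    have h1 : ‖t‖ ≤ 1 := by simpa using ht
    have h2 : ‖w - p‖ < δ / 2 := by rw [← dist_eq_norm]; exact hwb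
    nlinarith [norm_nonneg (w - p)]
  have hno' : ∀ m, ∀ z ∈ Metric.closedBall (0 : ℂ) r, δ ≤ ‖h^[m] (γ z) - p‖ := by
    intro m z hz
    have := hno m z (hsub hz)
    rw [Metric.mem_ball, not_lt, dist_eq_norm] at this
    exact this
  set ν := min 1 (δ / 2) with hν
  have hν0 : 0 < ν := lt_min one_pos (by positivity)
  have hclose : ∀ (a : ℕ), ∀ z ∈ Metric.closedBall (0 : ℂ) r, ∀ t ∈ Metric.closedBall (0 : ℂ) 1,
      (d : ℝ) ^ a * green k d (Y0 t) ≤ max S0 0 → ν ≤ L ^ a * ‖h^[a] (γ z) - (k^[a] (Y0 t)).swap‖ := by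
    intro a z hz t ht hs
    by_contra! hlt
    have hb : ∀ b ≤ a, ‖(k^[b] (Y0 t)).swap‖ ≤ BB := by
      intro b hba
      rw [norm_swap']
      refine hBB _ (H'.om_iter hMR' b (hOY t ht)) ?_
      rw [H'.green_iter]
      refine le_trans ?_ hs
      have := H'.green_nonneg (Y0 t)
      gcongr
      linarith
    set e := ‖h^[a] (γ z) - (k^[a] (Y0 t)).swap‖ with he
    have ind : ∀ j ≤ a, ‖h^[j] (h^[a] (γ z)) - (k^[a - j] (Y0 t)).swap‖ ≤ L ^ j * e := by
      intro j
      induction j with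
      | zero => intro _; simp [he]
      | succ j ih =>
        intro hj
        have h1 := ih (by omega)
        have h2 : L ^ j * e < 1 := by
          refine lt_of_le_of_lt ?_ (hlt.trans_le (min_le_left _ _))
          gcongr
          omega
        have h3 := hb (a - j) (by omega)
        have h4 : a - j = (a - (j + 1)) + 1 := by omega
        have h5 : ‖h^[j] (h^[a] (γ z))‖ ≤ BB + 1 := by
          have := norm_sub_norm_le (h^[j] (h^[a] (γ z))) (k^[a - j] (Y0 t)).swap
          linarith
        rw [iterate_succ_apply', ← hback, ← h4, pow_succ', mul_assoc]
        refine (hLip _ _ h5 (by linarith)).trans ?_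
        gcongr
    have h1 := ind a le_rfl
    rw [Nat.sub_self, ← iterate_add_apply] at h1
    have h2 := hno' (a + a) z hz
    have h3 := hWp t ht
    have h4 : (k^[0] (Y0 t)).swap = W t := by simp [hY0]
    rw [h4] at h1
    have h5 := norm_sub_le_norm_sub_add_norm_sub (h^[a + a] (γ z)) (W t) p
    have h6 := min_le_right 1 (δ / 2)
    linarith
  set C1 : ℝ := |C0| + |S0| + |Real.log ν| + Real.log L with hC1
  have hlogL : 0 ≤ Real.log L := Real.log_nonneg hL1
  have hC1' : 0 ≤ C1 := by positivity
  have hXY : ∀ (a : ℕ), ∀ z ∈ Metric.closedBall (0 : ℂ) r, ∀ t ∈ Metric.closedBall (0 : ℂ) 1,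
      h^[a] (γ z) ≠ (k^[a] (Y0 t)).swap := by
    intro a z hz t ht he
    have h1 := hno' (a + a) z hz
    have h2 := hback' a 0 t
    rw [zero_add] at h2
    rw [iterate_add_apply, he, h2] at h1
    have h3 := hWp t ht
    have h4 : (k^[0] (Y0 t)).swap = W t := by simp [hY0]
    rw [h4] at h1
    linarith
  have hlower : ∀ (a : ℕ), ∀ z ∈ Metric.closedBall (0 : ℂ) r, ∀ t ∈ Metric.closedBall (0 : ℂ) 1,
      (d : ℝ) ^ (a + 1) * max (green h d (γ z)) (green k d (Y0 t)) - C1 * (a + 2) ≤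
        Real.log ‖h^[a + 1] (γ z) - (k^[a + 1] (Y0 t)).swap‖ := by
    intro a z hz t ht
    have e1 : (d : ℝ) ^ (a + 1) * max (green h d (γ z)) (green k d (Y0 t)) =
        max (green h d (h^[a + 1] (γ z))) (green k d (k^[a + 1] (Y0 t))) := by
      rw [H.green_iter, H'.green_iter, mul_max_of_nonneg _ _ (by positivity)]
    rw [e1]
    have ha : (0 : ℝ) ≤ a := Nat.cast_nonneg a
    have hCa : C1 * 2 ≤ C1 * (a + 2) := by gcongr; linarith
    rcases le_or_gt S0 (max (green h d (h^[a + 1] (γ z))) (green k d (k^[a + 1] (Y0 t)))) with hs | hs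
    · have := hlow (h^[a] (γ z)) (H.om_iter hMR a (hOγ z hz)) (k^[a] (Y0 t)) (H'.om_iter hMR' a (hOY t ht))
      rw [← iterate_succ_apply' h, ← iterate_succ_apply' k] at this
      have := this hs
      have h1 := le_abs_self C0
      have h2 := abs_nonneg S0
      have h3 := abs_nonneg (Real.log ν)
      rw [hC1] at hCa ⊢
      linarith
    · have h1 := hclose (a + 1) z hz t ht (by
        rw [← H'.green_iter]
        exact (le_max_right _ _).trans (hs.le.trans (le_max_left _ _)))
      have hpos : 0 < ‖h^[a + 1] (γ z) - (k^[a + 1] (Y0 t)).swap‖ :=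
        norm_pos_iff.2 (sub_ne_zero.2 (hXY _ z hz t ht))
      have h2 := Real.log_le_log hν0 h1
      rw [Real.log_mul (by positivity) hpos.ne', Real.log_pow] at h2
      push_cast at h2
      have h3 := le_abs_self S0
      have h4 := neg_abs_le (Real.log ν)
      have h5 := abs_nonneg C0
      have h6 : C1 * (a + 2) = (|C0| + |S0| + |Real.log ν|) * (a + 2) + Real.log L * (a + 1) + Real.log L := by
        rw [hC1]; ring
      have h7 : (|C0| + |S0| + |Real.log ν|) * 2 ≤ (|C0| + |S0| + |Real.log ν|) * (a + 2) := by
        gcongr; linarith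
      have h8 := abs_nonneg S0
      have h9 := abs_nonneg (Real.log ν)
      linarith
  set cc := m1 * m2 / (m1 + m2) with hcc
  have hcc0 : 0 < cc := by positivity
  set ϑ := m2 / (m1 + m2) with hϑ
  set ϑ' := m1 / (m1 + m2) with hϑ'
  have hϑ0 : 0 ≤ ϑ := by positivity
  have hϑ0' : 0 ≤ ϑ' := by positivity
  have hϑ1 : ϑ + ϑ' = 1 := by rw [hϑ, hϑ', ← add_div, add_comm, div_self (by positivity)]
  have hϑm : ϑ * m1 = cc := by rw [hϑ, hcc]; ring
  have hϑm' : ϑ' * m2 = cc := by rw [hϑ', hcc]; ring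
  obtain ⟨a, ha⟩ := lin_exp_absurd (C := C1) (D := Real.log (BX + BB + 1)) hcc0
  set N : ℝ := (d : ℝ) ^ (a + 1) with hN
  have hN0 : 0 ≤ N := by positivity
  have hNb : 2 ^ (a + 1) ≤ N := by rw [hN]; gcongr
  have key := min_principle (X := fun z => h^[a + 1] (γ z)) (Y := fun t => (k^[a + 1] (Y0 t)).swap)
    (A := fun z => ((N * ϑ : ℝ) : ℂ) * A z) (B := fun t => ((N * ϑ' : ℝ) : ℂ) * B t) (r₁ := r) (r₂ := 1)
    (m := -(N * cc) - C1 * (a + 2)) (by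
      intro z hz
      have : DifferentiableOn ℂ (fun z => h^[a + 1] (γ z)) (Metric.ball 0 ρ) :=
        (H.iter_diff _).comp_differentiableOn hγ
      exact this.analyticAt (Metric.isOpen_ball.mem_nhds (hsub hz)))
    (fun z hz => analyticAt_const.mul (hAa z hz)) (by
      intro z hz
      have : Differentiable ℂ (fun t => (k^[a + 1] (Y0 t)).swap) := hswap.comp ((H'.iter_diff _).comp hY0d)
      exact this.analyticAt z)
    (fun z hz => analyticAt_const.mul (hBa z hz)) (hXY (a + 1)) (by
      intro z hz t ht hb
      have h1 := hlower a z hz t ht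
      simp only [Complex.re_ofReal_mul]
      set gz := green h d (γ z)
      set gt := green k d (Y0 t)
      have m1' : gz ≤ max gz gt := le_max_left _ _
      have m2' : gt ≤ max gz gt := le_max_right _ _
      have h2 : ϑ * (A z).re + ϑ' * (B t).re ≤ max gz gt + cc := by
        have e : max gz gt = ϑ * max gz gt + ϑ' * max gz gt := by rw [← add_mul, hϑ1, one_mul]
        rcases hb with hb | hb
        · have k1 : ϑ * (A z).re ≤ ϑ * max gz gt := by gcongr; exact (hAs z hz hb).trans m1'
          have k2 : ϑ' * (B t).re ≤ ϑ' * (max gz gt + m2) := by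
            gcongr; exact (hBb t ht).trans (by gcongr)
          rw [mul_add, hϑm'] at k2
          linarith
        · have k1 : ϑ * (A z).re ≤ ϑ * (max gz gt + m1) := by
            gcongr; exact (hAb z hz).trans (by gcongr)
          have k2 : ϑ' * (B t).re ≤ ϑ' * max gz gt := by gcongr; exact (hBs t ht hb).trans m2'
          rw [mul_add, hϑm] at k1
          linarith
      have h3 := mul_le_mul_of_nonneg_left h2 hN0
      rw [mul_add, mul_add] at h3
      linarith)
  have hfin := key z1 hz1 t1 ht1
  simp only [Complex.re_ofReal_mul] at hfin
  rw [hAz1, hBt1, mul_assoc, mul_assoc, hϑm, hϑm'] at hfin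
  have b1 : ‖h^[a + 1] (γ z1)‖ ≤ BX := hBX _ (H.om_iter hMR _ (hOγ z1 hz1)) (by
    rw [H.green_iter]
    have : green h d (γ z1) = 0 := hgz1
    rw [this, mul_zero])
  have b2 : ‖(k^[a + 1] (Y0 t1)).swap‖ ≤ BB := by
    rw [norm_swap']
    refine hBB _ (H'.om_iter hMR' _ (hOY t1 ht1)) ?_
    rw [H'.green_iter]
    have : green k d (Y0 t1) = 0 := hgt1
    rw [this, mul_zero]
    exact le_max_right _ _
  have b3 : Real.log ‖h^[a + 1] (γ z1) - (k^[a + 1] (Y0 t1)).swap‖ ≤ Real.log (BX + BB + 1) := by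
    refine Real.log_le_log (norm_pos_iff.2 (sub_ne_zero.2 (hXY _ z1 hz1 t1 ht1))) ?_
    have := norm_sub_le (h^[a + 1] (γ z1)) (k^[a + 1] (Y0 t1)).swap
    linarith
  have b4 : 2 ^ (a + 1) * cc ≤ N * cc := by gcongr
  linarith

theorem hit {h k : ℂ × ℂ → ℂ × ℂ} {d : ℕ} {c c' : ℂ} {R C R' C' : ℝ} (H : Good h d c R C)
    (H' : Good k d c' R' C') (hh : ContDiff ℂ 1 h) (i2 : ∀ z, h ((k z).swap) = z.swap) {p : ℂ × ℂ}
    (hp : green k d p.swap = 0) (hw : ∀ δ > 0, ∃ w ∈ Metric.ball p δ, 0 < green k d w.swap)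
    {γ : ℂ → ℂ × ℂ} {ρ : ℝ} (hγ : DifferentiableOn ℂ γ (Metric.ball 0 ρ)) (h0 : green h d (γ 0) = 0)
    (hne : ∃ ζ ∈ Metric.ball (0 : ℂ) ρ, 0 < green h d (γ ζ)) {δ : ℝ} (hδ : 0 < δ) (m0 : ℕ) :
    ∃ m ≥ m0, ∃ z ∈ Metric.ball (0 : ℂ) ρ, h^[m] (γ z) ∈ Metric.ball p δ := by
  obtain ⟨ζ, hζ, hζ1⟩ := hne
  obtain ⟨m, z, hz, hm⟩ := hit0 H H' hh i2 hp hw (γ := fun z => h^[m0] (γ z)) (ρ := ρ)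
    ((H.iter_diff _).comp_differentiableOn hγ) (by rw [H.green_iter, h0, mul_zero])
    ⟨ζ, hζ, by rw [H.green_iter]; have := H.dpos; positivity⟩ hδ
  exact ⟨m + m0, by omega, z, hz, by rwa [iterate_add_apply]⟩


theorem det2 (T : ℂ × ℂ →ₗ[ℂ] ℂ × ℂ) : LinearMap.det T =
    (T (1, 0)).1 * (T (0, 1)).2 - (T (0, 1)).1 * (T (1, 0)).2 := by
  rw [← LinearMap.det_toMatrix (Module.Basis.finTwoProd ℂ), Matrix.det_fin_two]
  simp [LinearMap.toMatrix_apply]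

theorem back_green {h k : ℂ × ℂ → ℂ × ℂ} {d : ℕ} {c' : ℂ} {R' C' : ℝ}
    (H' : Good k d c' R' C') (i1 : ∀ z, k (h z).swap = z.swap) {p : ℂ × ℂ} {n : ℕ} (hn : 1 ≤ n)
    (hp : h^[n] p = p) : green k d p.swap = 0 := by
  have h1 : ∀ m z, k^[m] (h^[m] z).swap = z.swap := by
    intro m
    induction m with
    | zero => intro z; rfl
    | succ m ih => intro z; rw [iterate_succ_apply, iterate_succ_apply', i1, ih]
  have h2 := h1 n p
  rw [hp] at h2
  have h3 := H'.green_iter n p.swap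
  rw [h2] at h3
  have h4 := H'.green_nonneg p.swap
  have h5 : (2 : ℝ) ≤ (d : ℝ) ^ n := H'.dpos.trans (le_self_pow₀ (by linarith [H'.dpos]) (by omega))
  nlinarith

theorem back_pos {h k : ℂ × ℂ → ℂ × ℂ} {d : ℕ} {c c' : ℂ} {R C R' C' : ℝ} (H : Good h d c R C)
    (H' : Good k d c' R' C') (i1 : ∀ z, k (h z).swap = z.swap) {p : ℂ × ℂ} {n : ℕ}
    (hp : h^[n] p = p) (hdet : ‖LinearMap.det (fderiv ℂ (h^[n]) p).toLinearMap‖ < 1) :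
    ∀ δ > 0, ∃ w ∈ Metric.ball p δ, 0 < green k d w.swap := by
  by_contra! hcon
  obtain ⟨δ, hδ, hz⟩ := hcon
  have h1 : ∀ m z, k^[m] (h^[m] z).swap = z.swap := by
    intro m
    induction m with
    | zero => intro z; rfl
    | succ m ih => intro z; rw [iterate_succ_apply, iterate_succ_apply', i1, ih]
  have hswap : Differentiable ℂ (Prod.swap : ℂ × ℂ → ℂ × ℂ) := differentiable_snd.prodMk differentiable_fst
  set F : ℂ × ℂ → ℂ × ℂ := fun z => (k^[n] z.swap).swap with hF
  have hFd : Differentiable ℂ F := hswap.comp ((H'.iter_diff n).comp hswap)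
  have hFh : ∀ z, F (h^[n] z) = z := by intro z; rw [hF]; simp only; rw [h1]; simp
  have hFp : F p = p := by have := hFh p; rwa [hp] at this
  have hFm : ∀ m z, F^[m] z = (k^[n * m] z.swap).swap := by
    intro m
    induction m with
    | zero => intro z; simp
    | succ m ih =>
      intro z
      rw [iterate_succ_apply', ih, hF]
      simp only [Prod.swap_swap]
      rw [← iterate_add_apply]; congr 2; ring
  set T := fderiv ℂ F p with hT
  set S := fderiv ℂ (h^[n]) p with hS
  have hTS : T.comp S = ContinuousLinearMap.id ℂ (ℂ × ℂ) := by
    have e1 : HasFDerivAt F T (h^[n] p) := by rw [hp]; exact (hFd p).hasFDerivAt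
    have e2 := e1.comp p ((H.iter_diff n) p).hasFDerivAt
    have e3 : F ∘ h^[n] = id := funext hFh
    rw [e3] at e2
    exact e2.unique (hasFDerivAt_id p)
  have hdd : LinearMap.det T.toLinearMap * LinearMap.det S.toLinearMap = 1 := by
    rw [← LinearMap.det_comp, ← ContinuousLinearMap.toLinearMap_comp, hTS]
    simp
  have hT1 : 1 < ‖LinearMap.det T.toLinearMap‖ := by
    have e := congrArg norm hdd
    rw [norm_mul, norm_one] at e
    by_contra! hle
    have := mul_le_mul_of_nonneg_right hle (norm_nonneg (LinearMap.det S.toLinearMap))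
    linarith
  set M := max R' (‖p‖ + δ)
  obtain ⟨B, hB0, hB⟩ := H'.green_bd (le_max_left R' (‖p‖ + δ)) 0
  have hbd : ∀ m, ∀ z ∈ Metric.ball p δ, ‖F^[m] z‖ ≤ B := by
    intro m z hzb
    rw [hFm, norm_swap']
    refine hB _ (H'.om_iter (le_max_left _ _) _ ?_) ?_
    · refine le_trans ?_ ((le_max_right R' _).trans (le_max_right _ _))
      rw [Prod.snd_swap]
      have e1 := norm_fst_le z
      have e2 := norm_sub_norm_le z p
      rw [Metric.mem_ball, dist_eq_norm] at hzb
      linarith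
    · rw [H'.green_iter]
      exact mul_nonpos_of_nonneg_of_nonpos (by positivity) (hz z hzb)
  have hTm : ∀ m, ∀ v : ℂ × ℂ, ‖v‖ ≤ 1 → ‖(T ^ m) v‖ ≤ B / (δ / 2) := by
    intro m v hv
    have e1 : HasFDerivAt F^[m] (T ^ m) p := HasFDerivAt.iterate (hFd p).hasFDerivAt hFp m
    have e2 : HasDerivAt (fun t : ℂ => p + t • v) v 0 := by
      have := ((hasDerivAt_id (0 : ℂ)).smul_const v).const_add p
      simpa using this
    have e3 : HasDerivAt (fun t : ℂ => F^[m] (p + t • v)) ((T ^ m) v) 0 := by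
      have : HasFDerivAt F^[m] (T ^ m) (p + (0 : ℂ) • v) := by simpa using e1
      exact this.comp_hasDerivAt (0 : ℂ) e2
    rw [← e3.deriv]
    have hdF : Differentiable ℂ (F^[m]) := hFd.iterate m
    refine Complex.norm_deriv_le_of_forall_mem_sphere_norm_le (by positivity) ?_ ?_
    · apply Differentiable.diffContOnCl
      exact hdF.comp (by fun_prop)
    · intro t ht
      apply hbd
      rw [Metric.mem_ball, dist_eq_norm, add_sub_cancel_left, norm_smul]
      have : ‖t‖ = δ / 2 := by simpa using ht
      rw [this]
      nlinarith
  set Q := B / (δ / 2)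
  have hQ0 : 0 ≤ Q := by positivity
  have hle : ∀ m : ℕ, ‖LinearMap.det T.toLinearMap‖ ^ m ≤ 2 * Q ^ 2 := by
    intro m
    have e : LinearMap.det (T ^ m).toLinearMap = LinearMap.det T.toLinearMap ^ m := by
      rw [ContinuousLinearMap.toLinearMap_pow, map_pow]
    rw [← norm_pow, ← e, det2]
    have a1 := hTm m (1, 0) (by simp)
    have a2 := hTm m (0, 1) (by simp)
    refine (norm_sub_le _ _).trans ?_
    rw [norm_mul, norm_mul]
    have b1 := (norm_fst_le _).trans a1
    have b2 := (norm_snd_le _).trans a1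
    have b3 := (norm_fst_le _).trans a2
    have b4 := (norm_snd_le _).trans a2
    have k1 := mul_le_mul b1 b4 (norm_nonneg _) hQ0
    have k2 := mul_le_mul b3 b2 (norm_nonneg _) hQ0
    have : 2 * Q ^ 2 = Q * Q + Q * Q := by ring
    rw [this]
    exact add_le_add k1 k2
  obtain ⟨m, hm⟩ := pow_unbounded_of_one_lt (2 * Q ^ 2) hT1
  linarith [hle m]


/-- a locally closed subset of a regular arc is, near some point, a graph with small slope -/
theorem arc_local {E : Set ℂ} (hE : IsLocallyClosed E) (hne : E.Nonempty) {I : Set ℝ} {η : ℝ → ℂ} (hI : IsOpen I)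
    (hinj : InjOn η I) (hη : ContDiffOn ℝ 1 η I) (hd : ∀ t ∈ I, deriv η t ≠ 0) (hsub : E ⊆ η '' I) :
    ∃ z0 ∈ E, ∃ e : ℂ, ‖e‖ = 1 ∧ ∀ ε > 0, ∃ ρ > 0, ∀ z ∈ E, ∀ z' ∈ E, dist z z0 < ρ → dist z' z0 < ρ →
      |((z - z') / e).im| ≤ ε * |((z - z') / e).re| := by
  haveI := hE.locallyCompactSpace
  haveI : Nonempty E := hne.to_subtype
  have hηc : ContinuousOn η I := hη.continuousOn
  obtain ⟨⟨q, hq⟩, hintr⟩ := nonempty_interior_of_iUnion_of_closed (X := E)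
    (ι := {q : ℚ × ℚ // Icc (q.1 : ℝ) q.2 ⊆ I})
    (f := fun q => (Subtype.val : E → ℂ) ⁻¹' (η '' Icc (q.1.1 : ℝ) q.1.2))
    (fun q => (isCompact_Icc.image_of_continuousOn (hηc.mono q.2)).isClosed.preimage continuous_subtype_val) (by
      rw [eq_univ_iff_forall]
      rintro ⟨z, hz⟩
      obtain ⟨t, ht, rfl⟩ := hsub hz
      obtain ⟨ε, hε, hb⟩ := Metric.isOpen_iff.1 hI t ht
      obtain ⟨a, ha1, ha2⟩ := exists_rat_btwn (show t - ε < t by linarith)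
      obtain ⟨b, hb1, hb2⟩ := exists_rat_btwn (show t < t + ε by linarith)
      refine mem_iUnion.2 ⟨⟨(a, b), fun s hs => hb ?_⟩, t, ⟨ha2.le, hb1.le⟩, rfl⟩
      rw [Metric.mem_ball, Real.dist_eq, abs_lt]
      have h1 : (a : ℝ) ≤ s := hs.1
      have h2 : s ≤ (b : ℝ) := hs.2
      constructor <;> linarith)
  obtain ⟨⟨z0, hz0⟩, hzi⟩ := hintr
  rw [mem_interior_iff_mem_nhds, Metric.mem_nhds_iff] at hzi
  obtain ⟨ρ0, hρ0, hρs⟩ := hzi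
  have hloc : ∀ z ∈ E, dist z z0 < ρ0 → ∃ t ∈ Icc (q.1 : ℝ) q.2, η t = z := fun z hz hdz =>
    hρs (show (⟨z, hz⟩ : E) ∈ Metric.ball ⟨z0, hz0⟩ ρ0 from hdz)
  obtain ⟨t0, ht0, htz⟩ := hloc z0 hz0 (by simpa using hρ0)
  have ht0I := hq ht0
  have hat : ContDiffAt ℝ 1 η t0 := hη.contDiffAt (hI.mem_nhds ht0I)
  have hst : HasStrictDerivAt η (deriv η t0) t0 := hat.hasStrictDerivAt one_ne_zero
  set v := deriv η t0 with hv
  have hv0 : 0 < ‖v‖ := norm_pos_iff.2 (hd t0 ht0I)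
  refine ⟨z0, hz0, v / ‖v‖, ?_, ?_⟩
  · rw [norm_div, Complex.norm_real, norm_norm, div_self hv0.ne']
  intro ε hε
  set ε' := ε * ‖v‖ / (1 + ε) with hε'
  have hε0 : 0 < ε' := by positivity
  have hev := hst.isLittleO.def hε0
  obtain ⟨τ, hτ, hτs⟩ := Metric.mem_nhds_iff.1 hev
  have hev2 : ∀ t s, |t - t0| < τ → |s - t0| < τ → ‖η t - η s - (t - s : ℝ) * v‖ ≤ ε' * |t - s| := by
    intro t s ht hs
    have : (t, s) ∈ Metric.ball (t0, t0) τ := by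
      rw [Metric.mem_ball, Prod.dist_eq, max_lt_iff]; exact ⟨ht, hs⟩
    have := hτs this
    simpa using this
  have hcomp : IsCompact (Icc (q.1 : ℝ) q.2 ∩ {t | τ ≤ |t - t0|}) :=
    isCompact_Icc.inter_right (isClosed_le continuous_const (by fun_prop))
  obtain ⟨ρ1, hρ1, hrho1s⟩ : ∃ ρ1 > 0, ∀ t ∈ Icc (q.1 : ℝ) q.2, dist (η t) z0 < ρ1 → |t - t0| < τ := by
    rcases eq_empty_or_nonempty (Icc (q.1 : ℝ) q.2 ∩ {t | τ ≤ |t - t0|}) with hem | hne'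
    · refine ⟨1, one_pos, fun t ht _ => ?_⟩
      by_contra! hcon
      have : t ∈ Icc (q.1 : ℝ) q.2 ∩ {t | τ ≤ |t - t0|} := ⟨ht, hcon⟩
      rw [hem] at this
      exact this
    · obtain ⟨t1, ht1, hmin⟩ := hcomp.exists_isMinOn hne' (f := fun t => dist (η t) z0)
        ((continuous_id.dist continuous_const).comp_continuousOn (hηc.mono (fun t ht => hq ht.1)))
      refine ⟨dist (η t1) z0, ?_, ?_⟩
      · rw [gt_iff_lt, dist_pos, ← htz]
        intro h
        have h1 := hinj (hq ht1.1) ht0I h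
        have h2 := ht1.2
        simp only [h1, mem_setOf_eq, sub_self, abs_zero] at h2
        linarith
      · intro t ht hlt
        by_contra! hcon
        have := hmin (show t ∈ Icc (q.1 : ℝ) q.2 ∩ {t | τ ≤ |t - t0|} from ⟨ht, hcon⟩)
        simp only [mem_setOf_eq] at this
        linarith
  refine ⟨min ρ0 ρ1, lt_min hρ0 hρ1, ?_⟩
  intro z hz z' hz' hdz hdz'
  obtain ⟨t, ht, rfl⟩ := hloc z hz (hdz.trans_le (min_le_left _ _))
  obtain ⟨s, hs, rfl⟩ := hloc z' hz' (hdz'.trans_le (min_le_left _ _))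
  have h1 := hev2 t s (hrho1s t ht (hdz.trans_le (min_le_right _ _))) (hrho1s s hs (hdz'.trans_le (min_le_right _ _)))
  have hvc : (‖v‖ : ℂ) ≠ 0 := by exact_mod_cast hv0.ne'
  have hvv : v ≠ 0 := norm_pos_iff.1 hv0
  set q' := (η t - η s) / (v / ‖v‖) with hq'
  have h2 : q' - ((t - s) * ‖v‖ : ℝ) = (η t - η s - (t - s : ℝ) * v) / (v / ‖v‖) := by
    rw [hq']; push_cast; field_simp
  have h3 : ‖q' - ((t - s) * ‖v‖ : ℝ)‖ ≤ ε' * |t - s| := by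
    rw [h2, norm_div, norm_div, Complex.norm_real, norm_norm, div_self hv0.ne', div_one]; exact h1
  have h4 := (Complex.abs_re_le_norm _).trans h3
  have h5 := (Complex.abs_im_le_norm _).trans h3
  rw [Complex.sub_re, Complex.ofReal_re] at h4
  rw [Complex.sub_im, Complex.ofReal_im, sub_zero] at h5
  have h6 : (‖v‖ - ε') * |t - s| ≤ |q'.re| := by
    have := abs_sub_abs_le_abs_sub ((t - s) * ‖v‖) q'.re
    rw [abs_sub_comm, abs_mul, abs_of_pos hv0] at this
    linarith
  have h7 : ε' = ε * (‖v‖ - ε') := by rw [hε']; field_simp; ring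
  calc |q'.im| ≤ ε' * |t - s| := h5
    _ = ε * ((‖v‖ - ε') * |t - s|) := by rw [← mul_assoc, ← h7]
    _ ≤ _ := by gcongr

theorem local_setup {h : ℂ × ℂ → ℂ × ℂ} {d : ℕ} {c : ℂ} {R C : ℝ} (H : Good h d c R C)
    {γ : ℂ → ℂ × ℂ} (hγ : DifferentiableOn ℂ γ unitDisk) (h1 : ∃ z ∈ unitDisk, γ z ∈ Kplus h)
    (h2 : ¬ ∀ z ∈ unitDisk, γ z ∈ Kplus h) {I : Set ℝ} {η : ℝ → ℂ} (hI : IsOpen I)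
    (hinj : InjOn η I) (hη : ContDiffOn ℝ 1 η I) (hd : ∀ t ∈ I, deriv η t ≠ 0)
    (hsub : juliaSlice h γ ⊆ η '' I) : ∃ γ0 : ℂ → ℂ × ℂ, ∃ ρ0 > 0, DifferentiableOn ℂ γ0 (Metric.ball 0 ρ0) ∧
      green h d (γ0 0) = 0 ∧ (∀ ρ > 0, ∃ ζ ∈ Metric.ball (0 : ℂ) ρ, 0 < green h d (γ0 ζ)) ∧
      ∀ ε > 0, ∃ ρ > 0, ρ ≤ ρ0 ∧ ∃ φ : ℝ → ℝ, (∀ x y, |φ x - φ y| ≤ ε * |x - y|) ∧ φ 0 = 0 ∧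
        Adm (fun z => green h d (γ0 z)) φ (Metric.ball 0 ρ) := by
  set K : Set ℂ := {z | z ∈ unitDisk ∧ γ z ∈ Kplus h} with hK
  have hopen : IsOpen unitDisk := Metric.isOpen_ball
  have hE : IsLocallyClosed (juliaSlice h γ) := hopen.isLocallyClosed.inter isClosed_frontier.isLocallyClosed
  have hne : (juliaSlice h γ).Nonempty := by
    obtain ⟨z, hz, hzK⟩ := h1
    push Not at h2
    obtain ⟨w, hw, hwK⟩ := h2
    have hpc : IsPreconnected unitDisk := (convex_ball (0 : ℂ) 1).isPreconnected
    by_contra hem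
    rw [not_nonempty_iff_eq_empty] at hem
    have := hpc.subset_or_subset (u := interior K) (v := (closure K)ᶜ) isOpen_interior isClosed_closure.isOpen_compl
      (disjoint_left.2 fun x hx hx' => hx' (interior_subset_closure hx)) (by
        intro x hx
        by_contra hcon
        rw [mem_union, not_or, notMem_compl_iff] at hcon
        have : x ∈ juliaSlice h γ := ⟨hx, hcon.2, hcon.1⟩
        rw [hem] at this
        exact this)
    rcases this with h3 | h3
    · exact hwK (interior_subset (h3 hw)).2
    · exact h3 hz (subset_closure ⟨hz, hzK⟩)
  obtain ⟨z0, hz0, e, he, hloc⟩ := arc_local hE hne hI hinj hη hd hsub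
  have he0 : e ≠ 0 := by rw [← norm_pos_iff, he]; exact one_pos
  have hgc : ContinuousOn (fun z => green h d (γ z)) unitDisk := H.green_cont.comp_continuousOn hγ.continuousOn
  have hz0D : z0 ∈ unitDisk := hz0.1
  have hg0 : green h d (γ z0) = 0 := by
    by_contra hne0
    have hev : ∀ᶠ z in 𝓝 z0, green h d (γ z) ≠ 0 :=
      (hgc.continuousAt (hopen.mem_nhds hz0D)).eventually_ne hne0
    have hfr := mem_closure_iff_frequently.1 hz0.2.1
    obtain ⟨z, hz, hz'⟩ := (hfr.and_eventually hev).exists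
    exact hz' ((H.kplus _).1 hz.2)
  obtain ⟨ρ0, hρ0, hrho0s⟩ := Metric.isOpen_iff.1 hopen z0 hz0D
  have hm : ∀ ρ, MapsTo (fun ζ : ℂ => z0 + e * ζ) (Metric.ball 0 ρ) (Metric.ball z0 ρ) := by
    intro ρ ζ hζ
    rw [Metric.mem_ball, dist_eq_norm, add_sub_cancel_left, norm_mul, he, one_mul]
    simpa using hζ
  have hmD := (hm ρ0).mono_right hrho0s
  have hdiff : DifferentiableOn ℂ (fun ζ => γ (z0 + e * ζ)) (Metric.ball 0 ρ0) :=
    hγ.comp (Differentiable.differentiableOn (by fun_prop)) hmD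
  refine ⟨fun ζ => γ (z0 + e * ζ), ρ0, hρ0, hdiff, by simpa using hg0, ?_, ?_⟩
  · intro ρ hρ
    by_contra! hcon
    apply hz0.2.2
    rw [mem_interior_iff_mem_nhds, Metric.mem_nhds_iff]
    refine ⟨min ρ ρ0, lt_min hρ hρ0, fun z hz => ?_⟩
    have hzD : z ∈ unitDisk := hrho0s (Metric.ball_subset_ball (min_le_right _ _) hz)
    have h3 := hcon ((z - z0) / e) (by
      rw [mem_ball_zero_iff, norm_div, he, div_one, ← dist_eq_norm]
      exact Metric.ball_subset_ball (min_le_left _ _) hz)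
    rw [mul_div_cancel₀ _ he0, add_sub_cancel] at h3
    exact ⟨hzD, (H.kplus _).2 (le_antisymm h3 (H.green_nonneg _))⟩
  · intro ε hε
    obtain ⟨ρ1, hρ1, hgr⟩ := hloc ε hε
    set ρ := min ρ0 ρ1 with hρ
    set S : Set ℂ := {w | z0 + e * w ∈ juliaSlice h γ ∧ ‖w‖ < ρ1} with hS
    have hSl : ∀ w ∈ S, ∀ w' ∈ S, |w.im - w'.im| ≤ ε * |w.re - w'.re| := by
      intro w hw w' hw'
      have dd : ∀ w : ℂ, dist (z0 + e * w) z0 = ‖w‖ := by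
        intro w; rw [dist_eq_norm, add_sub_cancel_left, norm_mul, he, one_mul]
      have := hgr _ hw.1 _ hw'.1 (by rw [dd]; exact hw.2) (by rw [dd]; exact hw'.2)
      have e1 : (z0 + e * w - (z0 + e * w')) / e = w - w' := by field_simp; ring
      rwa [e1, Complex.sub_im, Complex.sub_re] at this
    have h0S : (0 : ℂ) ∈ S := ⟨by simpa using hz0, by simpa using hρ1⟩
    choose! pick hpick using fun (x : ℝ) (hx : x ∈ Complex.re '' S) => hx
    have hLip : LipschitzOnWith ⟨ε, hε.le⟩ (fun x => (pick x).im) (Complex.re '' S) := by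
      apply LipschitzOnWith.of_dist_le_mul
      intro x hx y hy
      have := hSl _ (hpick x hx).1 _ (hpick y hy).1
      rw [(hpick x hx).2, (hpick y hy).2] at this
      exact this
    obtain ⟨φ, hφ, hφe⟩ := hLip.extend_real
    have hgraph : ∀ w ∈ S, w.im = φ w.re := by
      intro w hw
      have hx : w.re ∈ Complex.re '' S := ⟨w, hw, rfl⟩
      rw [← hφe hx]
      have := hSl _ hw _ (hpick _ hx).1
      rw [(hpick _ hx).2, sub_self, abs_zero, mul_zero] at this
      have := abs_nonpos_iff.1 this
      simp only
      linarith
    refine ⟨ρ, lt_min hρ0 hρ1, min_le_left _ _, φ, fun x y => hφ.dist_le_mul x y, ?_, ?_, ?_, ?_⟩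
    · have := hgraph 0 h0S; simpa using this.symm
    · exact fun z _ => H.green_nonneg _
    · exact (H.green_cont.comp_continuousOn hdiff.continuousOn).mono (Metric.ball_subset_ball (min_le_left _ _))
    · intro z hz
      have hz0' : z ∈ Metric.ball (0 : ℂ) ρ0 := Metric.ball_subset_ball (min_le_left _ _) hz
      rcases (H.green_nonneg (γ (z0 + e * z))).lt_or_eq with hpos | hzero
      · left
        exact H.green_harm Metric.isOpen_ball hdiff hz0' hpos
      · by_cases hintr : z0 + e * z ∈ interior K
        · left
          refine (HA_const 0 z).congr ?_
          have hcont : ContinuousAt (fun w : ℂ => z0 + e * w) z := by fun_prop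
          filter_upwards [hcont.eventually_mem (isOpen_interior.mem_nhds hintr)] with w hw
          exact (H.kplus _).1 (interior_subset hw).2
        · right
          refine ⟨hzero.symm, hgraph z ⟨⟨hmD hz0', subset_closure ⟨hmD hz0', (H.kplus _).2 hzero.symm⟩, hintr⟩, ?_⟩⟩
          have := Metric.ball_subset_ball (min_le_right ρ0 ρ1) hz
          simpa using this


theorem Adm.scale {u : ℂ → ℝ} {φ : ℝ → ℝ} {U : Set ℂ} (h : Adm u φ U) {z : ℂ} {r K A : ℝ} (hr : 0 < r)
    (hA : 0 ≤ A) (hU : ∀ ζ ∈ Metric.ball (0 : ℂ) K, z + r * ζ ∈ U) :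
    Adm (fun ζ => A * u (z + r * ζ)) (fun x => (φ (z.re + r * x) - z.im) / r) (Metric.ball 0 K) := by
  refine ⟨fun ζ hζ => mul_nonneg hA (h.nonneg _ (hU ζ hζ)), ?_, ?_⟩
  · refine continuousOn_const.mul (h.cont.comp (Continuous.continuousOn (by fun_prop)) hU)
  · intro ζ hζ
    rcases h.harm _ (hU ζ hζ) with h1 | ⟨h1, h2⟩
    · left
      exact (h1.comp_analytic (g := fun ζ => z + r * ζ) (by fun_prop)).const_mul A
    · right
      refine ⟨by simp only [h1, mul_zero], ?_⟩
      simp only [Complex.add_im, Complex.re_ofReal_mul, Complex.im_ofReal_mul, Complex.add_re] at h2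
      simp only [← h2]
      field_simp
      ring

theorem lip_scale {φ : ℝ → ℝ} {ε : ℝ} (hφ : ∀ x y, |φ x - φ y| ≤ ε * |x - y|) (z : ℂ) {r : ℝ} (hr : 0 < r) :
    ∀ x y, |(φ (z.re + r * x) - z.im) / r - (φ (z.re + r * y) - z.im) / r| ≤ ε * |x - y| := by
  intro x y
  have := hφ (z.re + r * x) (z.re + r * y)
  rw [← sub_div, abs_div, abs_of_pos hr, div_le_iff₀ hr]
  calc _ = |φ (z.re + r * x) - φ (z.re + r * y)| := by congr 1; ring
    _ ≤ _ := this
    _ = ε * (|r * (x - y)|) := by congr 2; ring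
    _ = _ := by rw [abs_mul, abs_of_pos hr]; ring

theorem select {h k : ℂ × ℂ → ℂ × ℂ} {d : ℕ} {c c' : ℂ} {R C R' C' : ℝ} (H : Good h d c R C)
    (H' : Good k d c' R' C') (hh : ContDiff ℂ 1 h) (i2 : ∀ z, h ((k z).swap) = z.swap) {p : ℂ × ℂ}
    (hp : green k d p.swap = 0) (hw : ∀ δ > 0, ∃ w ∈ Metric.ball p δ, 0 < green k d w.swap)
    (hpg : green h d p = 0)
    {γ : ℂ → ℂ × ℂ} {ρ0 : ℝ} (hρ0 : 0 < ρ0) (hγ : DifferentiableOn ℂ γ (Metric.ball 0 ρ0)) (h0 : green h d (γ 0) = 0)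
    (hne : ∀ ρ > 0, ∃ ζ ∈ Metric.ball (0 : ℂ) ρ, 0 < green h d (γ ζ))
    (hadm : ∀ ε > 0, ∃ ρ > 0, ρ ≤ ρ0 ∧ ∃ φ : ℝ → ℝ, (∀ x y, |φ x - φ y| ≤ ε * |x - y|) ∧ φ 0 = 0 ∧
        Adm (fun z => green h d (γ z)) φ (Metric.ball 0 ρ))
    {M : ℝ} (hMR : R ≤ M) (hM : ‖γ 0‖ < M) {ε : ℝ} (hε : 0 < ε) (hε1 : ε ≤ 0.1) {δ : ℝ} (hδ : 0 < δ) (hδle : δ ≤ 1) {K : ℝ} (hK : 20 ≤ K) :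
    ∃ (ψ ξ : ℂ → ℂ × ℂ) (φ : ℝ → ℝ) (w : ℝ), DifferentiableOn ℂ ψ (Metric.ball 0 K) ∧
      (∀ ζ ∈ Metric.ball (0 : ℂ) K, ψ ζ = h (ξ ζ) ∧ ψ ζ ∈ Om M ∧ ξ ζ ∈ Om M) ∧
      (∀ x y, |φ x - φ y| ≤ ε * |x - y|) ∧ φ 0 = 0 ∧
      Adm (fun z => green h d (ψ z)) φ (Metric.ball 0 K) ∧
      1 ≤ max (green h d (ψ Complex.I)) (green h d (ψ (-Complex.I))) ∧
      green h d (ψ Complex.I) ≤ d ∧ green h d (ψ (-Complex.I)) ≤ d ∧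
      |w| ≤ 1 ∧ green h d (ψ (w * Complex.I)) ≤ δ ∧ (|w| = 1 ∨ ψ (w * Complex.I) ∈ Metric.ball p δ) := by
  have hd := H.dpos
  have hd0 : (0 : ℝ) < d := by linarith
  -- small ball
  obtain ⟨ρ2, hρ2, hrho2s⟩ : ∃ ρ2 > 0, ∀ z ∈ Metric.ball (0 : ℂ) ρ2, ‖γ z‖ < M ∧ green h d (γ z) < 1 := by
    have hc : ContinuousAt γ 0 := (hγ.continuousOn).continuousAt (Metric.ball_mem_nhds _ hρ0)
    have h1 : ∀ᶠ z in 𝓝 (0 : ℂ), ‖γ z‖ < M := hc.norm.eventually_lt_const hM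
    have h2 : ∀ᶠ z in 𝓝 (0 : ℂ), green h d (γ z) < 1 :=
      (H.green_cont.continuousAt.comp hc).eventually_lt_const (by simp [h0])
    exact Metric.eventually_nhds_iff_ball.1 (h1.and h2)
  obtain ⟨ρ1, hρ1, hρ10, φ, hφ, hφ0, hA1⟩ := hadm ε hε
  set u : ℂ → ℝ := fun z => green h d (γ z) with hu
  set ρ := min ρ1 ρ2 with hρ
  have hρp : 0 < ρ := lt_min hρ1 hρ2
  have hA : Adm u φ (Metric.ball 0 ρ) := hA1.mono (Metric.ball_subset_ball (min_le_left _ _))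
  have hγ' : DifferentiableOn ℂ γ (Metric.ball 0 ρ) := hγ.mono (Metric.ball_subset_ball ((min_le_left _ _).trans hρ10))
  have hsm : ∀ z ∈ Metric.ball (0 : ℂ) ρ, ‖γ z‖ < M ∧ u z < 1 := fun z hz =>
    hrho2s z (Metric.ball_subset_ball (min_le_right _ _) hz)
  have hφ1 : ∀ x y, |φ x - φ y| ≤ 0.1 * |x - y| := fun x y =>
    (hφ x y).trans (mul_le_mul_of_nonneg_right hε1 (abs_nonneg _))
  have hK0 : 0 < K := by linarith
  set r1 := ρ / (2 * K) with hr1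
  have hr1p : 0 < r1 := by positivity
  have hr1K : r1 * K = ρ / 2 := by rw [hr1]; field_simp
  -- domain inclusion
  have hdom : ∀ z : ℂ, ‖z‖ ≤ ρ / 2 → ∀ r : ℝ, 0 < r → r ≤ r1 → ∀ ζ ∈ Metric.ball (0 : ℂ) K, z + r * ζ ∈ Metric.ball (0 : ℂ) ρ := by
    intro z hz r hr hrr ζ hζ
    rw [mem_ball_zero_iff] at hζ ⊢
    have h1 := norm_add_le z (r * ζ)
    rw [norm_mul, Complex.norm_real, Real.norm_of_nonneg hr.le] at h1
    have h2 : r * ‖ζ‖ < r * K := by gcongr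
    have h3 : r * K ≤ r1 * K := by gcongr
    linarith
  have hI20 : ∀ σ : ℝ, |σ| ≤ 1 → (σ * Complex.I) ∈ Metric.ball (0 : ℂ) K := by
    intro σ hσ
    rw [mem_ball_zero_iff, norm_mul, Complex.norm_I, mul_one, Complex.norm_real, Real.norm_eq_abs]
    linarith
  -- positivity at r1
  set N : ℂ → ℝ → ℝ := fun z r => max (u (z + r * Complex.I)) (u (z + r * (-Complex.I))) with hN
  have hNpos : 0 < N 0 r1 := by
    by_contra! hcon
    have hA2 := (hA.scale (z := 0) (r := r1) (K := 20) (A := 1) hr1p zero_le_one (fun ζ hζ =>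
      hdom 0 (by simp; positivity) r1 hr1p le_rfl ζ (Metric.ball_subset_ball hK hζ)))
    have h1 : u (0 + r1 * Complex.I) ≤ 0 := (le_max_left _ _).trans hcon
    have h2 : u (0 + r1 * (-Complex.I)) ≤ 0 := (le_max_right _ _).trans hcon
    obtain ⟨ζ, hζ, hpos⟩ := hne r1 hr1p
    rw [mem_ball_zero_iff] at hζ
    have h3 : ∀ n : ℝ, 0 < n → u ζ ≤ 2 * 1.2 ^ 80 * n * 1.2 ^ 80 := by
      intro n hn
      have := hA2.N2 (lip_scale hφ1 0 hr1p) (by simp [hφ0]) hn (by linarith) (by linarith) (q := ζ / r1) (by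
        rw [norm_div, Complex.norm_real, Real.norm_of_nonneg hr1p.le, div_le_iff₀ hr1p]; linarith)
      have e : (r1 : ℂ) * (ζ / r1) = ζ := mul_div_cancel₀ _ (by exact_mod_cast hr1p.ne')
      simpa only [e, zero_add, one_mul] using this
    have h4 := h3 (u ζ / (2 * (2 * 1.2 ^ 80 * 1.2 ^ 80))) (by positivity)
    have h5 : 2 * 1.2 ^ 80 * (u ζ / (2 * (2 * 1.2 ^ 80 * 1.2 ^ 80))) * 1.2 ^ 80 = u ζ / 2 := by
      field_simp
    rw [h5] at h4
    have : 0 < u ζ := hpos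
    linarith
  have hNc : ∀ z : ℂ, ‖z‖ ≤ ρ / 2 → ContinuousOn (N z) (Icc 0 r1) := by
    intro z hz
    have aux : ∀ σ : ℂ, ‖σ‖ ≤ 1 → ContinuousOn (fun r : ℝ => u (z + r * σ)) (Icc 0 r1) := by
      intro σ hσ
      refine hA.cont.comp (Continuous.continuousOn (by fun_prop)) fun r hr => ?_
      rw [mem_ball_zero_iff]
      have h1 := norm_add_le z (r * σ)
      rw [norm_mul, Complex.norm_real, Real.norm_of_nonneg hr.1] at h1
      have h2 : r * ‖σ‖ ≤ r1 * 1 := mul_le_mul hr.2 hσ (norm_nonneg _) hr1p.le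
      have h3 : r1 * 20 ≤ r1 * K := by gcongr
      linarith
    exact (aux _ (by simp)).sup (aux _ (by simp))
  obtain ⟨η, hη, hηs⟩ : ∃ η > 0, ∀ z ∈ Metric.ball (0 : ℂ) η, N 0 r1 / 2 < N z r1 := by
    have aux : ∀ σ : ℂ, ‖σ‖ ≤ 1 → ContinuousAt (fun z : ℂ => u (z + r1 * σ)) 0 := by
      intro σ hσ
      have h2 : (0 : ℂ) + r1 * σ ∈ Metric.ball (0 : ℂ) ρ :=
        hdom 0 (by simp; positivity) r1 hr1p le_rfl σ (by rw [mem_ball_zero_iff]; linarith)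
      exact ContinuousAt.comp (x := (0 : ℂ)) (f := fun z : ℂ => z + r1 * σ)
        (hA.cont.continuousAt (Metric.isOpen_ball.mem_nhds h2)) (by fun_prop)
    have h1 : ContinuousAt (fun z => N z r1) 0 := (aux _ (by simp)).sup (aux _ (by simp))
    exact Metric.eventually_nhds_iff_ball.1 (h1.eventually_const_lt (half_lt_self hNpos))
  obtain ⟨m0, hm0⟩ := pow_unbounded_of_one_lt (2 / N 0 r1) (show (1 : ℝ) < d by linarith)
  obtain ⟨δ1, hδ1, hdel1s⟩ : ∃ δ1 > 0, ∀ z ∈ Metric.ball p δ1, green h d z < δ :=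
    Metric.eventually_nhds_iff_ball.1 (H.green_cont.continuousAt.eventually_lt_const (by rw [hpg]; exact hδ))
  set ρ3 := min (η / 2) (min (r1 / 2) (ρ / 4)) with hρ3
  have hrho3p : 0 < ρ3 := by positivity
  have hrho3r : ρ3 ≤ r1 / 2 := (min_le_right _ _).trans (min_le_left _ _)
  have hρ3ρ : ρ3 ≤ ρ / 4 := (min_le_right _ _).trans (min_le_right _ _)
  have hρ3η : ρ3 ≤ η / 2 := min_le_left _ _
  obtain ⟨m, hm, z, hz, hzp⟩ := hit H H' hh i2 hp hw (γ := γ) (ρ := ρ3)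
    (hγ'.mono (Metric.ball_subset_ball (by linarith))) h0 (hne ρ3 hrho3p) (lt_min hδ hδ1) (m0 + 1)
  rw [mem_ball_zero_iff] at hz
  set z' : ℂ := ⟨z.re, φ z.re⟩ with hz'
  set τ : ℝ := z.im - φ z.re with hτ
  have hre := Complex.abs_re_le_norm z
  have him := Complex.abs_im_le_norm z
  have hφz : |φ z.re| ≤ 0.1 * |z.re| := by simpa [hφ0] using hφ1 z.re 0
  have hz'n : ‖z'‖ ≤ 1.1 * ρ3 := by
    have := Complex.norm_le_abs_re_add_abs_im z'
    simp only [hz'] at this ⊢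
    linarith
  have hτn : |τ| ≤ 1.1 * ρ3 := by
    have := abs_sub z.im (φ z.re)
    rw [hτ]; linarith
  have hz'2 : ‖z'‖ ≤ ρ / 2 := by linarith
  have hzz : z' + τ * Complex.I = z := by
    apply Complex.ext <;> simp [hz', hτ]
  have huz : (d : ℝ) ^ m * u z < δ := by
    rw [hu]; simp only; rw [← H.green_iter]
    exact hdel1s _ (Metric.ball_subset_ball (min_le_right _ _) hzp)
  have hu0 : 0 ≤ u z := H.green_nonneg _
  -- packaging
  have fin : ∀ (r : ℝ) (m' : ℕ) (w : ℝ), 0 < r → r ≤ r1 → 1 ≤ m' → m' ≤ m → r * w = τ → |w| ≤ 1 →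
      1 ≤ (d : ℝ) ^ m' * N z' r → (d : ℝ) ^ m' * N z' r ≤ d → (|w| = 1 ∨ m' = m) → 
    ∃ (ψ ξ : ℂ → ℂ × ℂ) (φ : ℝ → ℝ) (w : ℝ), DifferentiableOn ℂ ψ (Metric.ball 0 K) ∧
      (∀ ζ ∈ Metric.ball (0 : ℂ) K, ψ ζ = h (ξ ζ) ∧ ψ ζ ∈ Om M ∧ ξ ζ ∈ Om M) ∧
      (∀ x y, |φ x - φ y| ≤ ε * |x - y|) ∧ φ 0 = 0 ∧
      Adm (fun z => green h d (ψ z)) φ (Metric.ball 0 K) ∧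
      1 ≤ max (green h d (ψ Complex.I)) (green h d (ψ (-Complex.I))) ∧
      green h d (ψ Complex.I) ≤ d ∧ green h d (ψ (-Complex.I)) ≤ d ∧
      |w| ≤ 1 ∧ green h d (ψ (w * Complex.I)) ≤ δ ∧ (|w| = 1 ∨ ψ (w * Complex.I) ∈ Metric.ball p δ) := by
    intro r m' w hr hrr1 hm1 hmm hrw hw1 hlow hup hor
    have hdm : (0 : ℝ) < (d : ℝ) ^ m' := by positivity
    have hdomr := hdom z' hz'2 r hr hrr1
    have hOm : ∀ ζ ∈ Metric.ball (0 : ℂ) K, γ (z' + r * ζ) ∈ Om M := by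
      intro ζ hζ
      have := (hsm _ (hdomr ζ hζ)).1
      exact ((norm_snd_le _).trans this.le).trans (le_max_right _ _)
    have hzw : z' + r * (w * Complex.I) = z := by
      rw [← hzz, ← hrw]; push_cast; ring
    have hG : ∀ ζ, green h d (h^[m'] (γ (z' + r * ζ))) = (d : ℝ) ^ m' * u (z' + r * ζ) := fun ζ => H.green_iter _ _
    have hn1 : u (z' + r * Complex.I) ≤ N z' r := le_max_left _ _
    have hn2 : u (z' + r * (-Complex.I)) ≤ N z' r := le_max_right _ _
    refine ⟨fun ζ => h^[m'] (γ (z' + r * ζ)), fun ζ => h^[m' - 1] (γ (z' + r * ζ)),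
      fun x => (φ (z'.re + r * x) - z'.im) / r, w, ?_, ?_, ?_, ?_, ?_, ?_, ?_, ?_, hw1, ?_, ?_⟩
    · exact (H.iter_diff _).comp_differentiableOn (hγ'.comp (Differentiable.differentiableOn (by fun_prop)) hdomr)
    · intro ζ hζ
      refine ⟨?_, H.om_iter hMR _ (hOm ζ hζ), H.om_iter hMR _ (hOm ζ hζ)⟩
      show _ = h (h^[m' - 1] _)
      rw [← iterate_succ_apply' h, Nat.succ_eq_add_one, Nat.sub_add_cancel hm1]
    · exact lip_scale hφ z' hr
    · simp [hz']
    · simp only [hG]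
      exact hA.scale hr hdm.le hdomr
    · simp only [hG]
      rw [← mul_max_of_nonneg _ _ hdm.le]; exact hlow
    · simp only [hG]
      exact (mul_le_mul_of_nonneg_left hn1 hdm.le).trans hup
    · simp only [hG]
      exact (mul_le_mul_of_nonneg_left hn2 hdm.le).trans hup
    · simp only [hG]
      rw [hzw]
      refine le_trans ?_ huz.le
      gcongr
      linarith
    · rcases hor with h1 | h1
      · exact .inl h1
      · right
        simp only [hzw, h1]
        exact Metric.ball_subset_ball (min_le_left _ _) hzp
  by_cases hcase : (d : ℝ) ^ m * N z' |τ| < 1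
  · have hτr : |τ| ≤ r1 := by linarith
    have hbig : 1 ≤ (d : ℝ) ^ m * N z' r1 := by
      have h1 := hηs z' (by rw [mem_ball_zero_iff]; linarith)
      have h2 : (d : ℝ) ^ m0 ≤ (d : ℝ) ^ m := pow_le_pow_right₀ (by linarith) (by omega)
      rw [div_lt_iff₀ hNpos] at hm0
      have h3 : (d : ℝ) ^ m0 * N 0 r1 ≤ (d : ℝ) ^ m * N 0 r1 := by gcongr
      have h4 : (d : ℝ) ^ m * (N 0 r1 / 2) ≤ (d : ℝ) ^ m * N z' r1 := by gcongr
      linarith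
    have hcont : ContinuousOn (fun r => (d : ℝ) ^ m * N z' r) (Icc |τ| r1) :=
      continuousOn_const.mul ((hNc z' hz'2).mono (Icc_subset_Icc (abs_nonneg _) le_rfl))
    obtain ⟨r, hr, hr1'⟩ := intermediate_value_Icc hτr hcont ⟨hcase.le, hbig⟩
    simp only at hr1'
    have hr0 : 0 < r := by
      rcases (abs_nonneg τ |>.trans hr.1).lt_or_eq with h | h
      · exact h
      · have : |τ| = r := le_antisymm hr.1 (by rw [← h]; exact abs_nonneg _)
        rw [this] at hcase
        linarith
    refine fin r m (τ / r) hr0 hr.2 (by omega) le_rfl (by field_simp) ?_ hr1'.ge (by linarith) (.inr rfl)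
    rw [abs_div, abs_of_pos hr0, div_le_one hr0]; exact hr.1
  · push Not at hcase
    have hex : ∃ m', 1 ≤ (d : ℝ) ^ m' * N z' |τ| := ⟨m, hcase⟩
    classical
    set m' := Nat.find hex with hm'
    have hspec := Nat.find_spec hex
    have hle : m' ≤ m := Nat.find_min' hex hcase
    have hτ0 : 0 < |τ| := by
      rw [abs_pos]
      intro h0'
      rw [h0'] at hcase hzz
      have e : N z' |0| = u z := by
        rw [← hzz]; simp [hN]
      rw [e] at hcase; linarith
    have hNlt : N z' |τ| < 1 := by
      have aux : ∀ σ : ℂ, ‖σ‖ ≤ 1 → u (z' + (|τ| : ℝ) * σ) < 1 := fun σ hσ =>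
        (hsm _ (hdom z' hz'2 _ hτ0 (by linarith) σ (by rw [mem_ball_zero_iff]; linarith))).2
      exact max_lt (aux _ (by simp)) (aux _ (by simp))
    have hm1 : 1 ≤ m' := by
      by_contra! hlt
      have : m' = 0 := by omega
      rw [← hm', this, pow_zero, one_mul] at hspec
      linarith
    have hprev : (d : ℝ) ^ (m' - 1) * N z' |τ| < 1 := by
      have := Nat.find_min hex (show m' - 1 < m' by omega)
      exact not_le.1 this
    refine fin |τ| m' (τ / |τ|) hτ0 (by linarith) hm1 hle (by field_simp) ?_ hspec ?_ (.inl ?_)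
    · rw [abs_div, abs_abs, div_self hτ0.ne']
    · have e : (d : ℝ) ^ m' = d * (d : ℝ) ^ (m' - 1) := by rw [← pow_succ', Nat.sub_add_cancel hm1]
      rw [e, mul_assoc]
      have := mul_le_mul_of_nonneg_left hprev.le hd0.le
      linarith
    · rw [abs_div, abs_abs, div_self hτ0.ne']


theorem montel {ψ : ℕ → ℂ → ℂ × ℂ} (F : Ultrafilter ℕ)
    (hb : ∀ r : ℝ, ∃ B : ℝ, ∀ᶠ j in (F : Filter ℕ), DifferentiableOn ℂ (ψ j) (Metric.ball 0 r) ∧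
      ∀ q ∈ Metric.ball (0 : ℂ) r, ‖ψ j q‖ ≤ B) :
    ∃ Ψ : ℂ → ℂ × ℂ, Differentiable ℂ Ψ ∧ ∀ (s : ℕ → ℂ) (ζ : ℂ), Tendsto s F (𝓝 ζ) →
      Tendsto (fun j => ψ j (s j)) F (𝓝 (Ψ ζ)) := by
  have hL : ∀ r : ℝ, ∃ L : ℝ, 0 < L ∧ ∀ᶠ j in (F : Filter ℕ), ∀ x ∈ Metric.ball (0 : ℂ) r,
      ∀ y ∈ Metric.ball (0 : ℂ) r, ‖ψ j x - ψ j y‖ ≤ L * ‖x - y‖ := by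
    intro r
    obtain ⟨B, hB⟩ := hb (r + 2)
    refine ⟨|B| + 1, by positivity, ?_⟩
    filter_upwards [hB] with j hj x hx y hy
    have hsub : ∀ z ∈ Metric.ball (0 : ℂ) r, Metric.closedBall z 1 ⊆ Metric.ball (0 : ℂ) (r + 2) := by
      intro z hz w hw
      rw [Metric.mem_ball] at hz ⊢
      rw [Metric.mem_closedBall] at hw
      linarith [dist_triangle w z 0]
    refine Convex.norm_image_sub_le_of_norm_deriv_le (s := Metric.ball (0 : ℂ) r) (𝕜 := ℂ) (f := ψ j) ?_ ?_
      (convex_ball 0 r) hy hx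
    · intro z hz
      exact (hj.1 z (hsub z hz (by simp))).differentiableAt
        (Metric.isOpen_ball.mem_nhds (hsub z hz (by simp)))
    · intro z hz
      have h1 := Complex.norm_deriv_le_of_forall_mem_sphere_norm_le (c := z) (R := 1) (C := |B| + 1) (f := ψ j) one_pos
        ((hj.1.mono (hsub z hz)).diffContOnCl_ball subset_rfl) (fun w hw => by
          have := hj.2 w (hsub z hz (Metric.sphere_subset_closedBall hw))
          linarith [le_abs_self B])
      simpa using h1
  have hlim : ∀ ζ : ℂ, ∃ x, Tendsto (fun j => ψ j ζ) F (𝓝 x) := by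
    intro ζ
    obtain ⟨B, hB⟩ := hb (‖ζ‖ + 1)
    have hmem : Metric.closedBall (0 : ℂ × ℂ) B ∈ F.map (fun j => ψ j ζ) := by
      rw [Ultrafilter.mem_map]
      filter_upwards [hB] with j hj
      simpa using hj.2 ζ (by simp)
    obtain ⟨x, _, hx⟩ := (isCompact_closedBall (0 : ℂ × ℂ) B).ultrafilter_le_nhds' _ hmem
    exact ⟨x, hx⟩
  choose Ψ hΨ using hlim
  have hΨL : ∀ r : ℝ, ∃ L : ℝ, 0 < L ∧ (∀ᶠ j in (F : Filter ℕ), ∀ x ∈ Metric.ball (0 : ℂ) r,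
      ∀ y ∈ Metric.ball (0 : ℂ) r, ‖ψ j x - ψ j y‖ ≤ L * ‖x - y‖) ∧ ∀ x ∈ Metric.ball (0 : ℂ) r,
      ∀ y ∈ Metric.ball (0 : ℂ) r, ‖Ψ x - Ψ y‖ ≤ L * ‖x - y‖ := by
    intro r
    obtain ⟨L, hL0, hLe⟩ := hL r
    refine ⟨L, hL0, hLe, fun x hx y hy => ?_⟩
    exact le_of_tendsto ((hΨ x).sub (hΨ y)).norm (hLe.mono fun j hj => hj x hx y hy)
  have hloc : TendstoLocallyUniformlyOn ψ Ψ F univ := by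
    rw [Metric.tendstoLocallyUniformlyOn_iff]
    intro ε hε x _
    obtain ⟨L, hL0, hLe, hLΨ⟩ := hΨL (‖x‖ + 1)
    have hmin : 0 < min 1 (ε / (3 * L)) := by positivity
    refine ⟨Metric.ball x (min 1 (ε / (3 * L))), mem_nhdsWithin_of_mem_nhds (Metric.ball_mem_nhds _ hmin), ?_⟩
    have h3 := (Metric.tendsto_nhds.1 (hΨ x)) (ε / 3) (by positivity)
    filter_upwards [hLe, h3] with j hj hj3 y hy
    have hyr : y ∈ Metric.ball (0 : ℂ) (‖x‖ + 1) := by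
      rw [Metric.mem_ball] at hy ⊢
      have := dist_triangle y x 0
      rw [dist_zero_right x] at this
      linarith [min_le_left 1 (ε / (3 * L))]
    have hxr : x ∈ Metric.ball (0 : ℂ) (‖x‖ + 1) := by simp
    have h1 := hLΨ y hyr x hxr
    have h2 := hj x hxr y hyr
    have h4 : L * ‖y - x‖ < ε / 3 := by
      have : ‖y - x‖ < ε / (3 * L) := by
        rw [← dist_eq_norm]; exact lt_of_lt_of_le hy (min_le_right _ _)
      calc L * ‖y - x‖ < L * (ε / (3 * L)) := by gcongr
        _ = ε / 3 := by field_simp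
    rw [norm_sub_rev x y] at h2
    rw [← dist_eq_norm] at h1 h2
    have := dist_triangle4 (Ψ y) (Ψ x) (ψ j x) (ψ j y)
    rw [dist_comm (Ψ x)] at this
    linarith
  have hdiff : Differentiable ℂ Ψ := by
    intro x
    obtain ⟨B, hB⟩ := hb (‖x‖ + 1)
    have hxr : x ∈ Metric.ball (0 : ℂ) (‖x‖ + 1) := by simp
    exact ((hloc.mono (subset_univ (Metric.ball (0 : ℂ) (‖x‖ + 1)))).differentiableOn (hB.mono fun j hj => hj.1)
      Metric.isOpen_ball x hxr).differentiableAt (Metric.isOpen_ball.mem_nhds hxr)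
  refine ⟨Ψ, hdiff, fun s ζ hs => ?_⟩
  obtain ⟨L, hL0, hLe, -⟩ := hΨL (‖ζ‖ + 1)
  have hsr : ∀ᶠ j in (F : Filter ℕ), s j ∈ Metric.ball (0 : ℂ) (‖ζ‖ + 1) :=
    hs.eventually_mem (Metric.isOpen_ball.mem_nhds (by simp))
  have hz : Tendsto (fun j => ψ j (s j) - ψ j ζ) F (𝓝 0) := by
    refine squeeze_zero_norm' (a := fun j => L * ‖s j - ζ‖) ?_ ?_
    · filter_upwards [hLe, hsr] with j h1 h2
      exact h1 _ h2 _ (by simp)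
    · have := ((tendsto_iff_norm_sub_tendsto_zero.1 hs).const_mul L)
      simpa using this
  have := hz.add (hΨ ζ)
  simpa using this


theorem limit_map {h : ℂ × ℂ → ℂ × ℂ} {d : ℕ} {c : ℂ} {R C : ℝ} (H : Good h d c R C) {p : ℂ × ℂ}
    {M : ℝ} (hMR : R ≤ M) {g : ℂ × ℂ → ℂ × ℂ} (hg : Continuous g) (hgO : ∀ z ∈ Om M, g (h z) ∈ Om M)
    {ψ ξ : ℕ → ℂ → ℂ × ℂ} {φ : ℕ → ℝ → ℝ} {w : ℕ → ℝ}
    (s1 : ∀ j, DifferentiableOn ℂ (ψ j) (Metric.ball 0 (20 / 0.92 ^ j)))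
    (s2 : ∀ j, ∀ ζ ∈ Metric.ball (0 : ℂ) (20 / 0.92 ^ j), ψ j ζ = h (ξ j ζ) ∧ ψ j ζ ∈ Om M ∧ ξ j ζ ∈ Om M)
    (s3 : ∀ j, ∀ x y, |φ j x - φ j y| ≤ (0.1 * (1 / ((j : ℝ) + 1))) * |x - y|) (s4 : ∀ j, φ j 0 = 0)
    (s5 : ∀ j, Adm (fun z => green h d (ψ j z)) (φ j) (Metric.ball 0 (20 / 0.92 ^ j)))
    (s6 : ∀ j, 1 ≤ max (green h d (ψ j Complex.I)) (green h d (ψ j (-Complex.I))))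
    (s7 : ∀ j, green h d (ψ j Complex.I) ≤ d) (s8 : ∀ j, green h d (ψ j (-Complex.I)) ≤ d)
    (s9 : ∀ j, |w j| ≤ 1) (s10 : ∀ j, green h d (ψ j (w j * Complex.I)) ≤ 1 / ((j : ℝ) + 1))
    (s11 : ∀ j, |w j| = 1 ∨ ψ j (w j * Complex.I) ∈ Metric.ball p (1 / ((j : ℝ) + 1))) :
    ∃ (Ψ : ℂ → ℂ × ℂ) (w : ℝ), Differentiable ℂ Ψ ∧ (∀ ζ, Ψ ζ ∈ Om M) ∧ (∀ ζ, g (Ψ ζ) ∈ Om M) ∧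
      1 ≤ max (green h d (Ψ Complex.I)) (green h d (Ψ (-Complex.I))) ∧
      (∀ z : ℂ, z.im ≠ 0 → HA (fun ζ => green h d (Ψ ζ)) z) ∧ green h d (Ψ (w * Complex.I)) = 0 ∧
      (|w| = 1 ∨ Ψ (w * Complex.I) = p) := by
  have hd := H.dpos
  set F : Ultrafilter ℕ := Filter.hyperfilter ℕ with hF
  have hFle : (F : Filter ℕ) ≤ atTop := Nat.hyperfilter_le_atTop
  have hOc : IsClosed (Om M) := by
    unfold Om
    exact isClosed_le (by fun_prop) (by fun_prop)
  have hdel : Tendsto (fun j : ℕ => 1 / ((j : ℝ) + 1)) F (𝓝 0) :=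
    tendsto_one_div_add_atTop_nhds_zero_nat.mono_left hFle
  have hlip : ∀ j, ∀ x y, |φ j x - φ j y| ≤ 0.1 * |x - y| := by
    intro j x y
    refine (s3 j x y).trans ?_
    gcongr
    have : 1 / ((j : ℝ) + 1) ≤ 1 := by
      rw [div_le_one (by positivity)]; linarith [(Nat.cast_nonneg j : (0 : ℝ) ≤ j)]
    linarith
  have hball : ∀ k j, k ≤ j → Metric.ball (0 : ℂ) (20 / 0.92 ^ k) ⊆ Metric.ball (0 : ℂ) (20 / 0.92 ^ j) := by
    intro k j hkj
    refine Metric.ball_subset_ball ?_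
    have : (0.92 : ℝ) ^ j ≤ 0.92 ^ k := pow_le_pow_of_le_one (by norm_num) (by norm_num) hkj
    gcongr
  have hk : ∀ r : ℝ, ∃ k : ℕ, r * 0.92 ^ k ≤ 2 := by
    intro r
    obtain ⟨k, hk⟩ := exists_pow_lt_of_lt_one (show (0 : ℝ) < 2 / (|r| + 1) by positivity) (show (0.92 : ℝ) < 1 by norm_num)
    refine ⟨k, ?_⟩
    rw [lt_div_iff₀ (by positivity)] at hk
    have : (0 : ℝ) < 0.92 ^ k := by positivity
    nlinarith [le_abs_self r]
  have hrb : ∀ (r : ℝ) (k : ℕ), r * 0.92 ^ k ≤ 2 → ∀ j, k ≤ j → Metric.ball (0 : ℂ) r ⊆ Metric.ball (0 : ℂ) (20 / 0.92 ^ j) := by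
    intro r k hrk j hkj
    refine (Metric.ball_subset_ball ?_).trans (hball k j hkj)
    rw [le_div_iff₀ (by positivity)]; linarith
  obtain ⟨Ψ, hΨ, hΨl⟩ := montel (ψ := ψ) F (by
    intro r
    obtain ⟨k, hkr⟩ := hk r
    obtain ⟨B, hB0, hB⟩ := H.green_bd hMR (cN * 1.2 ^ k * d)
    refine ⟨B, ?_⟩
    have hge : ∀ᶠ j in (F : Filter ℕ), k ≤ j := hFle (eventually_ge_atTop k)
    filter_upwards [hge] with j hj
    have hsub := hrb r k hkr j hj
    refine ⟨(s1 j).mono hsub, fun q hq => ?_⟩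
    refine hB _ (s2 j q (hsub hq)).2.1 ?_
    refine ((s5 j).mono (hball k j hj)).N3 (hlip j) (s4 j) (by linarith) (s7 j) (s8 j) ?_
    rw [mem_ball_zero_iff] at hq
    have : (0 : ℝ) < 0.92 ^ k := by positivity
    nlinarith)
  have hpt : ∀ ζ, Tendsto (fun j => ψ j ζ) F (𝓝 (Ψ ζ)) := fun ζ => hΨl (fun _ => ζ) ζ tendsto_const_nhds
  have hin : ∀ r : ℝ, ∀ᶠ j in (F : Filter ℕ), Metric.ball (0 : ℂ) r ⊆ Metric.ball (0 : ℂ) (20 / 0.92 ^ j) := by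
    intro r
    obtain ⟨k, hkr⟩ := hk r
    have hge : ∀ᶠ j in (F : Filter ℕ), k ≤ j := hFle (eventually_ge_atTop k)
    filter_upwards [hge] with j hj
    exact hrb r k hkr j hj
  have hin1 : ∀ ζ : ℂ, ∀ᶠ j in (F : Filter ℕ), ζ ∈ Metric.ball (0 : ℂ) (20 / 0.92 ^ j) := by
    intro ζ
    filter_upwards [hin (‖ζ‖ + 1)] with j hj
    exact hj (by simp)
  have hGl : ∀ ζ, Tendsto (fun j => green h d (ψ j ζ)) F (𝓝 (green h d (Ψ ζ))) := fun ζ =>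
    (H.green_cont.tendsto _).comp (hpt ζ)
  obtain ⟨w0, hw0⟩ : ∃ x, Tendsto w F (𝓝 x) := by
    have hmem : Metric.closedBall (0 : ℝ) 1 ∈ F.map w := by
      rw [Ultrafilter.mem_map]
      exact Filter.univ_mem' fun j => by simpa using s9 j
    obtain ⟨x, _, hx⟩ := (isCompact_closedBall (0 : ℝ) 1).ultrafilter_le_nhds' _ hmem
    exact ⟨x, hx⟩
  have hwI : Tendsto (fun j => ψ j (w j * Complex.I)) F (𝓝 (Ψ (w0 * Complex.I))) := by
    apply hΨl (fun j => w j * Complex.I)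
    have : Continuous fun x : ℝ => (x : ℂ) * Complex.I := by fun_prop
    exact (this.tendsto w0).comp hw0
  refine ⟨Ψ, w0, hΨ, ?_, ?_, ?_, ?_, ?_, ?_⟩
  · intro ζ
    refine hOc.mem_of_tendsto (hpt ζ) ?_
    filter_upwards [hin1 ζ] with j hj
    exact (s2 j ζ hj).2.1
  · intro ζ
    refine hOc.mem_of_tendsto ((hg.tendsto _).comp (hpt ζ)) ?_
    filter_upwards [hin1 ζ] with j hj
    have := s2 j ζ hj
    simp only [comp_apply]
    rw [this.1]
    exact hgO _ this.2.2
  · exact ge_of_tendsto' ((hGl _).max (hGl _)) s6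
  · intro z hz
    rcases (H.green_nonneg (Ψ z)).lt_or_eq with hpos | hzero
    · exact H.green_harm isOpen_univ hΨ.differentiableOn (mem_univ z) hpos
    · refine (HA_const 0 z).congr ?_
      have hs0 : 0 < |z.im| / 2 := by positivity
      set s := |z.im| / 2 with hs
      filter_upwards [Metric.closedBall_mem_nhds z (show 0 < 0.08 * s by positivity)] with y hy
      have hle : green h d (Ψ y) ≤ 1.2 * green h d (Ψ z) := by
        refine le_of_tendsto_of_tendsto (hGl y) ((hGl z).const_mul 1.2) ?_
        have hsm : ∀ᶠ j : ℕ in (F : Filter ℕ), 0.1 * (1 / ((j : ℝ) + 1)) * |z.re| < s := by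
          have : Tendsto (fun j : ℕ => 0.1 * (1 / ((j : ℝ) + 1)) * |z.re|) F (𝓝 (0.1 * 0 * |z.re|)) :=
            (hdel.const_mul 0.1).mul_const _
          exact this.eventually_lt_const (by simpa using hs0)
        filter_upwards [hsm, hin (‖z‖ + s)] with j h1 h2
        have h3 : |φ j z.re| ≤ s := by
          have := s3 j z.re 0
          rw [s4, sub_zero, sub_zero] at this
          linarith
        refine ((s5 j).step (hlip j) (z := z) (w := y) hs0 ?_ ?_ ?_).1
        · have := abs_sub_abs_le_abs_sub z.im (φ j z.re)
          have : |z.im| = 2 * s := by rw [hs]; ring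
          linarith
        · refine Subset.trans ?_ h2
          intro x hx
          rw [Metric.mem_ball] at hx ⊢
          have h4 := dist_triangle x z 0
          rw [dist_zero_right z] at h4
          have : s / 1.1 ≤ s := div_le_self hs0.le (by norm_num)
          linarith
        · rw [← dist_eq_norm]; exact hy
      rw [← hzero, mul_zero] at hle
      exact le_antisymm hle (H.green_nonneg _)
  · refine le_antisymm ?_ (H.green_nonneg _)
    exact le_of_tendsto_of_tendsto' ((H.green_cont.tendsto _).comp hwI) hdel s10
  · have hor : ∀ᶠ j in (F : Filter ℕ), |w j| = 1 ∨ ψ j (w j * Complex.I) ∈ Metric.ball p (1 / ((j : ℝ) + 1)) :=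
      Eventually.of_forall s11
    rw [Ultrafilter.eventually_or] at hor
    rcases hor with h1 | h1
    · left
      exact tendsto_nhds_unique (hw0.abs) (tendsto_const_nhds.congr' (h1.mono fun j hj => hj.symm))
    · right
      refine tendsto_nhds_unique hwI ?_
      rw [tendsto_iff_dist_tendsto_zero]
      exact squeeze_zero' (Eventually.of_forall fun j => dist_nonneg) (h1.mono fun j hj => le_of_lt hj) hdel


theorem growth_absurd {h : ℂ × ℂ → ℂ × ℂ} {d : ℕ} {c : ℂ} {R C : ℝ} (H : Good h d c R C) {p : ℂ × ℂ} {n k : ℕ}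
    (hn : 1 ≤ n) (hk : 1 ≤ k) (hp : h^[n] p = p) (hT : ‖(fderiv ℂ (h^[n]) p) ^ k‖ < (0.92⁻¹ : ℝ) ^ k)
    {Ψ : ℂ → ℂ × ℂ} (hΨ : Differentiable ℂ Ψ) (h0 : Ψ 0 = p)
    (hHA : ∀ z : ℂ, z.im ≠ 0 → HA (fun ζ => green h d (Ψ ζ)) z) (hpos : 0 < green h d (Ψ Complex.I)) : False := by
  have hd := H.dpos
  set v : ℂ → ℝ := fun ζ => green h d (Ψ ζ) with hv
  set g := (h^[n])^[k] with hg
  have hgp : g p = p := iterate_fixed hp k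
  have hgd : HasFDerivAt g ((fderiv ℂ (h^[n]) p) ^ k) p :=
    HasFDerivAt.iterate ((H.iter_diff n) p).hasFDerivAt hp k
  set T := (fderiv ℂ (h^[n]) p) ^ k with hTd
  have hgG : ∀ z, (2 : ℝ) ^ k * green h d z ≤ green h d (g z) := by
    intro z
    rw [hg, ← iterate_mul, H.green_iter]
    have h1 : (2 : ℝ) ^ k ≤ (d : ℝ) ^ k := pow_le_pow_left₀ (by norm_num) hd k
    have h2 : (d : ℝ) ^ k ≤ (d : ℝ) ^ (n * k) := pow_le_pow_right₀ (by linarith) (by nlinarith)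
    exact mul_le_mul_of_nonneg_right (h1.trans h2) (H.green_nonneg z)
  set κ : ℝ := (0.92⁻¹ : ℝ) ^ k with hκ
  obtain ⟨δ0, hδ0, hδs⟩ : ∃ δ0 > 0, ∀ z ∈ Metric.closedBall p δ0, ‖g z - p‖ ≤ κ * ‖z - p‖ := by
    have hev := hgd.isLittleO.def (sub_pos.2 hT)
    obtain ⟨δ, hδ, hs⟩ := Metric.nhds_basis_closedBall.mem_iff.1 hev
    refine ⟨δ, hδ, fun z hz => ?_⟩
    have h1 := hs hz
    simp only [mem_setOf_eq, hgp] at h1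
    have h2 := T.le_opNorm (z - p)
    have h3 : g z - p = (g z - p - T (z - p)) + T (z - p) := by abel
    rw [h3]
    refine (norm_add_le _ _).trans ?_
    linarith
  obtain ⟨B, hB⟩ := ((isCompact_closedBall p δ0).bddAbove_image H.green_cont.continuousOn)
  have hB' : ∀ z ∈ Metric.closedBall p δ0, green h d z ≤ B := fun z hz => hB (mem_image_of_mem _ hz)
  set θ : ℝ := 0.92 with hθ
  have hθ0 : 0 < θ := by norm_num [hθ]
  have hθ1 : θ < 1 := by norm_num [hθ]
  have hκθ : κ * θ ^ k = 1 := by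
    rw [hκ, ← mul_pow, inv_mul_cancel₀ hθ0.ne', one_pow]
  have hdec : ∀ j : ℕ, ∀ z, ‖z - p‖ ≤ δ0 * θ ^ (k * j) → (2 : ℝ) ^ (k * j) * green h d z ≤ B := by
    intro j
    induction j with
    | zero =>
      intro z hz
      simp only [mul_zero, pow_zero, mul_one, one_mul] at hz ⊢
      exact hB' z (by rwa [Metric.mem_closedBall, dist_eq_norm])
    | succ j ih =>
      intro z hz
      have hle1 : θ ^ (k * (j + 1)) ≤ 1 := pow_le_one₀ hθ0.le hθ1.le
      have hz1 : z ∈ Metric.closedBall p δ0 := by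
        rw [Metric.mem_closedBall, dist_eq_norm]
        exact hz.trans (mul_le_of_le_one_right hδ0.le hle1)
      have h1 := ih (g z) (by
        refine (hδs z hz1).trans ?_
        have hκ0 : 0 ≤ κ := by positivity
        calc κ * ‖z - p‖ ≤ κ * (δ0 * θ ^ (k * (j + 1))) := by gcongr
          _ = (κ * θ ^ k) * (δ0 * θ ^ (k * j)) := by rw [mul_add, pow_add, mul_one]; ring
          _ = _ := by rw [hκθ, one_mul])
      have h2 := hgG z
      calc (2 : ℝ) ^ (k * (j + 1)) * green h d z = 2 ^ (k * j) * (2 ^ k * green h d z) := by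
            rw [mul_add, pow_add, mul_one]; ring
        _ ≤ 2 ^ (k * j) * green h d (g z) := by gcongr
        _ ≤ B := h1
  -- lower bound
  have hadm : Adm v (fun _ => 0) {z | z.im ≠ 0} :=
    ⟨fun z _ => H.green_nonneg _, (H.green_cont.comp hΨ.continuous).continuousOn, fun z hz => .inl (hHA z hz)⟩
  have hlow : ∀ l : ℕ, v Complex.I ≤ 1.2 ^ l * v ((θ ^ l : ℝ) * Complex.I) := by
    intro l
    have h1 := (hadm.vert (fun x y => by rw [sub_self, abs_zero]; positivity) (x := 0) (S := 1) (σ := 1) (by simp) one_pos (by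
      intro s hs _ z hz
      rw [Metric.mem_ball, Complex.dist_eq] at hz
      have h2 := (Complex.abs_im_le_norm _).trans_lt hz
      have h3 : s / 1.1 ≤ s := div_le_self hs.le (by norm_num)
      simp only [gpt, Complex.sub_im, abs_lt] at h2
      have : 0 < z.im := by linarith [h2.1]
      exact this.ne') l (θ ^ l) (pow_le_one₀ hθ0.le hθ1.le) (by rw [mul_one])).2
    have e1 : gpt (fun _ => 0) 0 (1 * 1) = Complex.I := by apply Complex.ext <;> simp [gpt]
    have e2 : gpt (fun _ => 0) 0 (1 * θ ^ l) = (θ ^ l : ℝ) * Complex.I := by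
      apply Complex.ext
      · simp only [gpt, Complex.re_ofReal_mul, Complex.I_re, mul_zero]
      · simp only [gpt, Complex.im_ofReal_mul, Complex.I_im, mul_one, one_mul, zero_add]
    rwa [e1, e2] at h1
  -- Lipschitz at zero
  obtain ⟨A, hA⟩ := ((hΨ 0).isBigO_sub).bound
  rw [h0] at hA
  obtain ⟨r, hr, hrs⟩ := Metric.eventually_nhds_iff_ball.1 hA
  obtain ⟨l0, hl0⟩ := exists_pow_lt_of_lt_one (show (0 : ℝ) < min r (δ0 / (|A| + 1)) by positivity) hθ1
  have hmain : ∀ j : ℕ, (2 : ℝ) ^ (k * j) * v Complex.I ≤ 1.2 ^ (k * j) * (1.2 ^ l0 * B) := by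
    intro j
    have h1 := hlow (k * j + l0)
    have hle : θ ^ (k * j + l0) ≤ θ ^ l0 := pow_le_pow_of_le_one hθ0.le hθ1.le (by omega)
    have hnorm : ‖((θ ^ (k * j + l0) : ℝ) : ℂ) * Complex.I‖ = θ ^ (k * j + l0) := by
      rw [norm_mul, Complex.norm_I, mul_one, Complex.norm_real, Real.norm_of_nonneg (by positivity)]
    have h2 := hrs (((θ ^ (k * j + l0) : ℝ) : ℂ) * Complex.I) (by
      rw [mem_ball_zero_iff, hnorm]
      exact hle.trans_lt (hl0.trans_le (min_le_left _ _)))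
    rw [sub_zero, hnorm] at h2
    have h3 : θ ^ l0 * (|A| + 1) ≤ δ0 := by
      rw [← le_div_iff₀ (by positivity)]; exact hl0.le.trans (min_le_right _ _)
    have h4 := hdec j _ (h2.trans (by
      have hp1 : 0 < θ ^ (k * j) := by positivity
      have hp2 : 0 < θ ^ l0 := by positivity
      calc A * θ ^ (k * j + l0) ≤ (|A| + 1) * θ ^ (k * j + l0) := by
            gcongr; linarith [le_abs_self A]
        _ = (θ ^ l0 * (|A| + 1)) * θ ^ (k * j) := by rw [pow_add]; ring
        _ ≤ _ := by gcongr))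
    calc (2 : ℝ) ^ (k * j) * v Complex.I ≤ 2 ^ (k * j) * (1.2 ^ (k * j + l0) * v ((θ ^ (k * j + l0) : ℝ) * Complex.I)) := by gcongr
      _ = 1.2 ^ (k * j) * (1.2 ^ l0 * (2 ^ (k * j) * v ((θ ^ (k * j + l0) : ℝ) * Complex.I))) := by rw [pow_add]; ring
      _ ≤ _ := by gcongr
  obtain ⟨j, hj⟩ := pow_unbounded_of_one_lt (1.2 ^ l0 * B / v Complex.I) (show (1 : ℝ) < 2 / 1.2 by norm_num)
  have h1 := hmain j
  have h2 : ((2 : ℝ) / 1.2) ^ j ≤ (2 / 1.2) ^ (k * j) := pow_le_pow_right₀ (by norm_num) (by nlinarith)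
  rw [div_lt_iff₀ hpos] at hj
  have h3 : 1.2 ^ l0 * B < (2 / 1.2) ^ (k * j) * v Complex.I :=
    hj.trans_le (mul_le_mul_of_nonneg_right h2 hpos.le)
  rw [div_pow, div_mul_eq_mul_div, lt_div_iff₀ (by positivity)] at h3
  linarith

theorem heninv_cont (p : Polynomial ℂ) (a : ℂ) : Continuous (heninv p a) := by
  unfold heninv
  have := p.continuous
  fun_prop

theorem core {h : ℂ × ℂ → ℂ × ℂ} (hh : HComp h) {γ : ℂ → ℂ × ℂ} (hγ : DifferentiableOn ℂ γ unitDisk)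
    (h1 : ∃ z ∈ unitDisk, γ z ∈ Kplus h)
    (h2 : ¬ ∀ z ∈ unitDisk, γ z ∈ Kplus h) {I : Set ℝ} {η : ℝ → ℂ} (hI : IsOpen I)
    (hinj : InjOn η I) (hη : ContDiffOn ℝ 1 η I) (hd : ∀ t ∈ I, deriv η t ≠ 0)
    (hsub : juliaSlice h γ ⊆ η '' I) {p : ℂ × ℂ} {n k : ℕ}
    (hn : 1 ≤ n) (hk : 1 ≤ k) (hp : h^[n] p = p) (hT : ‖(fderiv ℂ (h^[n]) p) ^ k‖ < (0.92⁻¹ : ℝ) ^ k)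
    (hdet : ‖LinearMap.det (fderiv ℂ (h^[n]) p).toLinearMap‖ < 1) : False := by
  obtain ⟨d, c, R, C, H, q, a, rot, cr, Rr, Cr, dk, ck, Rk, Ck, ha, hq, Hr, Hk, hrot⟩ := hh.inner
  obtain ⟨kk, d', c1, R1, C1, c2, R2, C2, H1, H2, i1, i2⟩ := hh.inv_good
  obtain rfl : d = d' := H.d_unique H1
  obtain ⟨p1, a1, ha1, hp1, R0, hout⟩ := hh.outer
  obtain ⟨γ0, ρ0, hρ0, hγ0, hg0, hne, hadm⟩ := local_setup H hγ h1 h2 hI hinj hη hd hsub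
  have hdp := H.dpos
  have hpg : green h d p = 0 := by
    have := H.green_iter n p
    rw [hp] at this
    have h3 : (2 : ℝ) ≤ (d : ℝ) ^ n := by
      calc (2 : ℝ) ≤ d := hdp
        _ = (d : ℝ) ^ 1 := (pow_one _).symm
        _ ≤ _ := pow_le_pow_right₀ (by linarith) hn
    have h4 := H.green_nonneg p
    nlinarith
  set M := max R (max R0 (‖γ0 0‖ + 1)) with hM
  have hMR : R ≤ M := le_max_left _ _
  have hM0 : R0 ≤ M := (le_max_left _ _).trans (le_max_right _ _)
  have hMg : ‖γ0 0‖ < M := (lt_add_one _).trans_le ((le_max_right _ _).trans (le_max_right _ _))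
  have hsel := fun j : ℕ => select H H2 hh.contDiff i2 (back_green H2 i1 hn hp) (back_pos H H2 i1 hp hdet) hpg hρ0 hγ0
    hg0 hne hadm hMR hMg (ε := 0.1 * (1 / ((j : ℝ) + 1))) (by positivity) (by
      have : 1 / ((j : ℝ) + 1) ≤ 1 := by
        rw [div_le_one (by positivity)]; linarith [(Nat.cast_nonneg j : (0 : ℝ) ≤ j)]
      linarith) (δ := 1 / ((j : ℝ) + 1)) (by positivity) (by
        rw [div_le_one (by positivity)]; linarith [(Nat.cast_nonneg j : (0 : ℝ) ≤ j)]) (K := 20 / 0.92 ^ j) (by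
        rw [le_div_iff₀ (by positivity)]
        have : (0.92 : ℝ) ^ j ≤ 1 := pow_le_one₀ (by norm_num) (by norm_num)
        linarith)
  choose ψ ξ φ w s1 s2 s3 s4 s5 s6 s7 s8 s9 s10 s11 using hsel
  obtain ⟨Ψ, w0, hΨ, hO, hO1, hmax, hHA, hw0, hor⟩ := limit_map H (p := p) hMR (heninv_cont p1 a1) (hout M hM0)
    s1 s2 s3 s4 s5 s6 s7 s8 s9 s10 s11
  have hcont : Continuous fun ζ => green h d (Ψ ζ) := H.green_cont.comp hΨ.continuous
  -- one sided vanishing is impossible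
  have key : ∀ Φ : ℂ → ℂ × ℂ, Differentiable ℂ Φ → (∀ ζ, Φ ζ ∈ Om M) → (∀ ζ, heninv p1 a1 (Φ ζ) ∈ Om M) →
      1 ≤ max (green h d (Φ Complex.I)) (green h d (Φ (-Complex.I))) →
      (∀ z : ℂ, z.im ≠ 0 → HA (fun ζ => green h d (Φ ζ)) z) →
      (∀ z : ℂ, 0 < z.im → green h d (Φ (-z)) = 0) → False := by
    intro Φ hΦ k1 k2 k3 k4 k5
    have hc : Continuous fun ζ => green h d (Φ ζ) := H.green_cont.comp hΦ.continuous
    have hz : ∀ z : ℂ, z.im ≤ 0 → green h d (Φ z) = 0 := by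
      intro z hz
      have hcl : IsClosed {t : ℝ | green h d (Φ (z - t * Complex.I)) = 0} :=
        isClosed_eq (hc.comp (by fun_prop : Continuous fun t : ℝ => z - t * Complex.I)) continuous_const
      have hsub : Ioi (0 : ℝ) ⊆ {t : ℝ | green h d (Φ (z - t * Complex.I)) = 0} := by
        intro t ht
        have := k5 (-(z - t * Complex.I)) (by simp; exact lt_of_le_of_lt hz ht)
        rwa [neg_neg] at this
      have h3 := closure_minimal hsub hcl
      rw [closure_Ioi] at h3
      have := h3 (self_mem_Ici (a := (0 : ℝ)))
      simpa using this
    obtain ⟨a0, ha0, hform⟩ := halfplane hc (fun z => H.green_nonneg _) hz (fun z hz => k4 z hz.ne')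
    have ha0' : 0 < a0 := by
      rcases ha0.lt_or_eq with h3 | h3
      · exact h3
      · rw [hform, hform, ← h3] at k3
        simp at k3
        linarith
    exact no_half ha ha1 hp1 H Hr Hk hrot hΦ k1 k2 ha0' hform
  have hHAn : ∀ z : ℂ, z.im ≠ 0 → HA (fun ζ => green h d (Ψ (-ζ))) z := fun z hz =>
    (hHA (-z) (by simpa using hz)).comp_analytic (g := fun z => -z) (by fun_prop)
  have posup : ∀ z : ℂ, 0 < z.im → 0 < green h d (Ψ z) := by
    intro z hz
    refine (H.green_nonneg _).lt_of_ne fun h3 => ?_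
    have h4 := hp_zero (v := fun ζ => green h d (Ψ ζ)) (fun z _ => H.green_nonneg _) (fun z hz => hHA z hz.ne') hz h3.symm
    refine key (fun ζ => Ψ (-ζ)) (hΨ.comp differentiable_neg) (fun ζ => hO _) (fun ζ => hO1 _) ?_ hHAn ?_
    · rw [neg_neg, max_comm]; exact hmax
    · intro z hz; rw [neg_neg]; exact h4 z hz
  have posdn : ∀ z : ℂ, 0 < z.im → 0 < green h d (Ψ (-z)) := by
    intro z hz
    refine (H.green_nonneg _).lt_of_ne fun h3 => ?_
    have h4 := hp_zero (v := fun ζ => green h d (Ψ (-ζ))) (fun z _ => H.green_nonneg _) (fun z hz => hHAn z hz.ne') hz h3.symm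
    exact key Ψ hΨ hO hO1 hmax hHA h4
  have hw : w0 = 0 := by
    rcases lt_trichotomy w0 0 with h3 | h3 | h3
    · have := posdn (-(w0 * Complex.I)) (by simpa using h3)
      rw [neg_neg] at this
      linarith
    · exact h3
    · have := posup (w0 * Complex.I) (by simpa using h3)
      linarith
  have hΨ0 : Ψ 0 = p := by
    rcases hor with h3 | h3
    · rw [hw] at h3; simp at h3
    · rw [hw] at h3; simpa using h3
  exact growth_absurd H hn hk hp hT hΨ hΨ0 hHA (posup _ (by simp))


theorem IsPolyMap.differentiable {F : ℂ × ℂ → ℂ × ℂ} (hF : IsPolyMap F) : Differentiable ℂ F := by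
  obtain ⟨P, Q, h⟩ := hF
  have key : ∀ P : MvPolynomial (Fin 2) ℂ,
      Differentiable ℂ (fun z : ℂ × ℂ => MvPolynomial.eval ![z.1, z.2] P) := by
    intro P z
    have := AnalyticAt.aeval_mvPolynomial (𝕜 := ℂ) (A := ℂ) (z := z)
      (f := fun z : ℂ × ℂ => (![z.1, z.2] : Fin 2 → ℂ)) (by
        intro i
        fin_cases i
        · exact analyticAt_fst
        · exact analyticAt_snd) P
    exact this.differentiableAt
  have e : F = fun z => (MvPolynomial.eval ![z.1, z.2] P, MvPolynomial.eval ![z.1, z.2] Q) :=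
    funext h
  rw [e]
  exact (key P).prodMk (key Q)

theorem isEigenvalue_iff_det (T : (ℂ × ℂ) →L[ℂ] ℂ × ℂ) (l : ℂ) :
    IsEigenvalue T l ↔
      ((T (1, 0)).1 - l) * ((T (0, 1)).2 - l) - (T (0, 1)).1 * (T (1, 0)).2 = 0 := by
  have e := det2 (T.toLinearMap - l • LinearMap.id)
  have e2 : LinearMap.det (T.toLinearMap - l • LinearMap.id) =
      ((T (1, 0)).1 - l) * ((T (0, 1)).2 - l) - (T (0, 1)).1 * (T (1, 0)).2 := by
    rw [e]; simp
  rw [← e2]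
  constructor
  · rintro ⟨v, hv, hT⟩
    by_contra hne
    have hu : IsUnit (LinearMap.det (T.toLinearMap - l • LinearMap.id)) := isUnit_iff_ne_zero.2 hne
    have hu2 := (LinearMap.isUnit_iff_isUnit_det _).2 hu
    have hb := (Module.End.isUnit_iff _).1 hu2
    apply hv
    apply hb.1
    simp [hT]
  · intro h0
    have hk := LinearMap.bot_lt_ker_of_det_eq_zero h0
    obtain ⟨v, hv, hv0⟩ := (Submodule.ne_bot_iff _).1 hk.ne'
    refine ⟨v, hv0, ?_⟩
    have : T v - l • v = 0 := by simpa using hv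
    exact sub_eq_zero.1 this

theorem exists_eigs (T : (ℂ × ℂ) →L[ℂ] ℂ × ℂ) : ∃ l1 l2 : ℂ, ‖l1‖ ≤ ‖l2‖ ∧
    LinearMap.det T.toLinearMap = l1 * l2 ∧ ∀ l, IsEigenvalue T l ↔ l = l1 ∨ l = l2 := by
  have main : ∃ l1 l2 : ℂ, 
    LinearMap.det T.toLinearMap = l1 * l2 ∧ ∀ l, IsEigenvalue T l ↔ l = l1 ∨ l = l2 := by
    have hd := det2 T.toLinearMap
    set a := (T (1, 0)).1 with ha
    set b := (T (0, 1)).1 with hb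
    set c := (T (1, 0)).2 with hc
    set d := (T (0, 1)).2 with hd'
    obtain ⟨s, hs⟩ := IsAlgClosed.exists_pow_nat_eq ((a - d) ^ 2 + 4 * b * c) (n := 2) (by norm_num)
    refine ⟨(a + d + s) / 2, (a + d - s) / 2, ?_, ?_⟩
    · rw [hd]
      change a * d - b * c = _
      linear_combination (1 / 4 : ℂ) * hs
    · intro l
      rw [isEigenvalue_iff_det]
      change (a - l) * (d - l) - b * c = 0 ↔ _
      have : (a - l) * (d - l) - b * c = (l - (a + d + s) / 2) * (l - (a + d - s) / 2) := by
        linear_combination (1 / 4 : ℂ) * hs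
      rw [this, mul_eq_zero, sub_eq_zero, sub_eq_zero]
  obtain ⟨l1, l2, h1, h2⟩ := main
  rcases le_total ‖l1‖ ‖l2‖ with h | h
  · exact ⟨l1, l2, h, h1, h2⟩
  · exact ⟨l2, l1, h, by rw [h1, mul_comm], fun l => by rw [h2, or_comm]⟩

theorem exists_pow_small (S : (ℂ × ℂ) →L[ℂ] ℂ × ℂ) (h : ∀ l, IsEigenvalue S l → ‖l‖ ≤ 1) :
    ∃ k : ℕ, 1 ≤ k ∧ ‖S ^ k‖ < (0.92⁻¹ : ℝ) ^ k := by
  have hsp : spectralRadius ℂ S ≤ 1 := by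
    refine iSup₂_le fun l hl => ?_
    have hE : IsEigenvalue S l := by
      rw [spectrum.mem_iff, ContinuousLinearMap.isUnit_iff_bijective] at hl
      by_contra hne
      apply hl
      have hinj : Injective (algebraMap ℂ ((ℂ × ℂ) →L[ℂ] ℂ × ℂ) l - S).toLinearMap := by
        rw [← LinearMap.ker_eq_bot, LinearMap.ker_eq_bot']
        intro v hv
        by_contra hv0
        refine hne ⟨v, hv0, ?_⟩
        have : l • v - S v = 0 := by simpa [Algebra.algebraMap_eq_smul_one] using hv
        exact (sub_eq_zero.1 this).symm
      exact ⟨hinj, LinearMap.surjective_of_injective hinj⟩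
    have := h l hE
    exact_mod_cast this
  have ht := spectrum.pow_norm_pow_one_div_tendsto_nhds_spectralRadius S
  have hlt : spectralRadius ℂ S < ENNReal.ofReal (0.92⁻¹ : ℝ) := by
    refine hsp.trans_lt ?_
    rw [← ENNReal.ofReal_one]
    exact (ENNReal.ofReal_lt_ofReal_iff (by norm_num)).2 (by norm_num)
  have hev := ht.eventually (gt_mem_nhds hlt)
  obtain ⟨k, hk, hk1⟩ := (hev.and (eventually_ge_atTop 1)).exists
  refine ⟨k, hk1, ?_⟩
  have hk2 := (ENNReal.ofReal_lt_ofReal_iff (by norm_num)).1 hk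
  have hk0 : (k : ℝ) ≠ 0 := by positivity
  have := pow_lt_pow_left₀ hk2 (by positivity) (n := k) (by omega)
  rwa [← Real.rpow_natCast, ← Real.rpow_mul (norm_nonneg _), one_div, inv_mul_cancel₀ hk0, Real.rpow_one] at this

theorem det_iter_lt {f : ℂ × ℂ → ℂ × ℂ} (hf : Differentiable ℂ f)
    (hdiss : ∀ z : ℂ × ℂ, ‖LinearMap.det (fderiv ℂ f z).toLinearMap‖ < 1) (n : ℕ) (p : ℂ × ℂ) :
    ‖LinearMap.det (fderiv ℂ (f^[n + 1]) p).toLinearMap‖ < 1 := by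
  induction n generalizing p with
  | zero => simpa using hdiss p
  | succ n ih =>
    rw [iterate_succ, fderiv_comp p (hf.iterate (n + 1) _) (hf p)]
    rw [ContinuousLinearMap.toLinearMap_comp, LinearMap.det_comp, norm_mul]
    calc _ < (1 : ℝ) * 1 := mul_lt_mul'' (ih _) (hdiss p) (norm_nonneg _) (norm_nonneg _)
      _ = 1 := one_mul 1

theorem bdd_image {u : ℂ × ℂ → ℂ × ℂ} (hu : Continuous u) (C : ℝ) :
    ∃ D : ℝ, ∀ z, ‖z‖ ≤ C → ‖u z‖ ≤ D := by
  obtain ⟨D, hD⟩ := (isCompact_closedBall (0 : ℂ × ℂ) C).exists_bound_of_continuousOn hu.continuousOn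
  exact ⟨D, fun z hz => hD z (by simpa using hz)⟩

theorem main_saddle
    (f : ℂ × ℂ → ℂ × ℂ) (hf : IsLoxodromic f)
    (hreal : ∃ (γ : ℂ → ℂ × ℂ), IsTransversal f γ ∧
      ∃ (I : Set ℝ) (η : ℝ → ℂ), IsOpen I ∧ I.OrdConnected ∧
        Set.InjOn η I ∧ ContDiffOn ℝ 1 η I ∧ (∀ t ∈ I, deriv η t ≠ 0) ∧
        juliaSlice f γ ⊆ η '' I)
    (hdiss : ∀ z : ℂ × ℂ, ‖LinearMap.det (fderiv ℂ f z).toLinearMap‖ < 1) :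
    ∀ (p : ℂ × ℂ) (n : ℕ), 1 ≤ n → f^[n] p = p →
      ∃ l₁ l₂ : ℂ, IsEigenvalue (fderiv ℂ (f^[n]) p) l₁ ∧
        IsEigenvalue (fderiv ℂ (f^[n]) p) l₂ ∧ ‖l₁‖ < 1 ∧ 1 < ‖l₂‖ ∧
        ∀ l : ℂ, IsEigenvalue (fderiv ℂ (f^[n]) p) l → l = l₁ ∨ l = l₂ := by

  obtain ⟨γ, ⟨-, hγ, hγ1, hγ2⟩, I, η, hI, -, hinj, hη, hηd, hsub⟩ := hreal
  obtain ⟨hfp, u, uinv, hs, hu, hl, hr, hs0, hhs, hfe⟩ := hf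
  have hfd := hfp.1.differentiable
  have hud := hu.1.differentiable
  have hvd : Differentiable ℂ uinv := by
    obtain ⟨-, G, hG, hG1, -⟩ := hu
    have : uinv = G := by
      funext w
      rw [← hG1 (uinv w), hr]
    rw [this]; exact hG.differentiable
  have hh := HComp.of_list hs hs0 hhs
  set h := hs.foldr (fun h acc => h ∘ acc) id with hdef
  have hsemi : Semiconj u f h := fun z => by rw [hfe, hr]
  have hit : ∀ m z, u (f^[m] z) = h^[m] (u z) := fun m z => hsemi.iterate_right m z
  have hit' : ∀ m z, f^[m] z = uinv (h^[m] (u z)) := fun m z => by rw [← hit, hl]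
  have hK : ∀ z, z ∈ Kplus f ↔ u z ∈ Kplus h := by
    intro z
    constructor
    · rintro ⟨C, hC⟩
      obtain ⟨D, hD⟩ := bdd_image hud.continuous C
      exact ⟨D, fun m => by rw [← hit]; exact hD _ (hC m)⟩
    · rintro ⟨C, hC⟩
      obtain ⟨D, hD⟩ := bdd_image hvd.continuous C
      exact ⟨D, fun m => by rw [hit']; exact hD _ (hC m)⟩
  have hJ : juliaSlice h (u ∘ γ) = juliaSlice f γ := by
    simp only [juliaSlice, hK, comp_apply]
  intro p n hn hp
  have hhd : Differentiable ℂ h := hh.contDiff.differentiable (by norm_num)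
  have hA : HasFDerivAt u (fderiv ℂ u p) p := (hud p).hasFDerivAt
  have hB : HasFDerivAt uinv (fderiv ℂ uinv (u p)) (u p) := (hvd _).hasFDerivAt
  have hS : HasFDerivAt (h^[n]) (fderiv ℂ (h^[n]) (u p)) (u p) := (hhd.iterate n _).hasFDerivAt
  have hT : HasFDerivAt (f^[n]) (fderiv ℂ (f^[n]) p) p := (hfd.iterate n _).hasFDerivAt
  set A := fderiv ℂ u p
  set B := fderiv ℂ uinv (u p)
  set S := fderiv ℂ (h^[n]) (u p)
  set T := fderiv ℂ (f^[n]) p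
  have hBA : B.comp A = ContinuousLinearMap.id ℂ (ℂ × ℂ) := by
    have h1 := hB.comp p hA
    have e : uinv ∘ u = id := funext hl
    rw [e] at h1
    exact h1.unique (hasFDerivAt_id p)
  have hAB : A.comp B = ContinuousLinearMap.id ℂ (ℂ × ℂ) := by
    have hA' : HasFDerivAt u A (uinv (u p)) := by rw [hl]; exact hA
    have h1 := hA'.comp (u p) hB
    have e : u ∘ uinv = id := funext hr
    rw [e] at h1
    exact h1.unique (hasFDerivAt_id _)
  have hAT : A.comp T = S.comp A := by
    have hA' : HasFDerivAt u A (f^[n] p) := by rw [hp]; exact hA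
    have h1 := hA'.comp p hT
    have h2 := hS.comp p hA
    have e : u ∘ f^[n] = h^[n] ∘ u := funext (hit n)
    rw [e] at h1
    exact h1.unique h2
  have hSe : S = (A.comp T).comp B := by
    rw [hAT, ContinuousLinearMap.comp_assoc, hAB, ContinuousLinearMap.comp_id]
  have hdetT : ‖LinearMap.det T.toLinearMap‖ < 1 := by
    obtain ⟨m, rfl⟩ := Nat.exists_eq_add_of_le' hn
    exact det_iter_lt hfd hdiss m p
  have hdetS : LinearMap.det S.toLinearMap = LinearMap.det T.toLinearMap := by
    have h1 : LinearMap.det A.toLinearMap * LinearMap.det B.toLinearMap = 1 := by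
      rw [← LinearMap.det_comp, ← ContinuousLinearMap.toLinearMap_comp, hAB]
      simp
    rw [hSe, ContinuousLinearMap.toLinearMap_comp, ContinuousLinearMap.toLinearMap_comp, LinearMap.det_comp, LinearMap.det_comp]
    linear_combination LinearMap.det T.toLinearMap * h1
  have hBA' : ∀ v, B (A v) = v := fun v => congrArg (fun L : (ℂ × ℂ) →L[ℂ] ℂ × ℂ => L v) hBA
  have hAB' : ∀ v, A (B v) = v := fun v => congrArg (fun L : (ℂ × ℂ) →L[ℂ] ℂ × ℂ => L v) hAB
  have hAT' : ∀ v, A (T v) = S (A v) := fun v => congrArg (fun L : (ℂ × ℂ) →L[ℂ] ℂ × ℂ => L v) hAT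
  have heig : ∀ l, IsEigenvalue S l → IsEigenvalue T l := by
    rintro l ⟨v, hv, hSv⟩
    refine ⟨B v, fun h0 => hv ?_, ?_⟩
    · rw [← hAB' v, h0, map_zero]
    · rw [← hBA' (T (B v)), hAT', hAB', hSv, map_smul]
  obtain ⟨l1, l2, hle, hdet, hev⟩ := exists_eigs T
  have hbig : 1 < ‖l2‖ := by
    by_contra hcon
    push Not at hcon
    obtain ⟨k, hk, hSk⟩ := exists_pow_small S (fun l hl' => by
      rcases (hev l).1 (heig l hl') with rfl | rfl
      · exact hle.trans hcon
      · exact hcon)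
    refine core hh (γ := u ∘ γ) (hud.comp_differentiableOn hγ) ?_ ?_ hI hinj hη hηd (hJ ▸ hsub) hn hk
      (p := u p) ?_ hSk ?_
    · obtain ⟨z, hz, hz2⟩ := hγ1
      exact ⟨z, hz, (hK _).1 hz2⟩
    · intro hall
      exact hγ2 fun z hz => (hK _).2 (hall z hz)
    · rw [← hit, hp]
    · rw [hdetS]; exact hdetT
  refine ⟨l1, l2, (hev _).2 (Or.inl rfl), (hev _).2 (Or.inr rfl), ?_, hbig, fun l hl' => (hev l).1 hl'⟩
  rw [hdet, norm_mul] at hdetT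
  nlinarith [norm_nonneg l1]

/-- an unstably real dissipative loxodromic automorphism of `ℂ²` has only
saddle periodic points. -/
theorem unstably_real_dissipative_all_periodic_points_are_saddles
    (f : ℂ × ℂ → ℂ × ℂ) (hf : IsLoxodromic f)
    (hreal : ∃ (γ : ℂ → ℂ × ℂ), IsTransversal f γ ∧
      ∃ (I : Set ℝ) (η : ℝ → ℂ), IsOpen I ∧ I.OrdConnected ∧
        Set.InjOn η I ∧ ContDiffOn ℝ 1 η I ∧ (∀ t ∈ I, deriv η t ≠ 0) ∧
        juliaSlice f γ ⊆ η '' I)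
    (hdiss : ∀ z : ℂ × ℂ, ‖LinearMap.det (fderiv ℂ f z).toLinearMap‖ < 1) :
    ∀ (p : ℂ × ℂ) (n : ℕ), 1 ≤ n → f^[n] p = p →
      ∃ l₁ l₂ : ℂ, IsEigenvalue (fderiv ℂ (f^[n]) p) l₁ ∧
        IsEigenvalue (fderiv ℂ (f^[n]) p) l₂ ∧ ‖l₁‖ < 1 ∧ 1 < ‖l₂‖ ∧
        ∀ l : ℂ, IsEigenvalue (fderiv ℂ (f^[n]) p) l → l = l₁ ∨ l = l₂ := by
  exact main_saddle f hf hreal hdiss
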